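/- Let F be an algebraically closed field of characteristic zero and n,m ≥ 1. Then the Jordan superalgebra osp(n,m) cannot be written as A + B for two proper nontrivial simple subsuperalgebras A and B. -/

import Mathlib

open Matrix

namespace SJ

section SuperDefs

variable {F : Type*} [Field F] {J : Type*} [AddCommGroup J] [Module F J]

/-- A graded subspace: `A = (A ∩ J₀) ⊕ (A ∩ J₁)`. -/
def IsGradedG (ev od : Submodule F J) (A : Submodule F J) : Prop :=
  A = (A ⊓ ev) ⊔ (A ⊓ od)

/-- A subsuperalgebra: a graded subspace closed under the product. -/
def IsSubalgG (mul : J → J → J) (ev od : Submodule F J) (A : Submodule F J) : Prop :=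
  IsGradedG ev od A ∧ ∀ x ∈ A, ∀ y ∈ A, mul x y ∈ A

/-- Nontrivial: `A ∩ J₁ ≠ {0}`. -/
def NontrivG (od : Submodule F J) (A : Submodule F J) : Prop := A ⊓ od ≠ ⊥

/-- Simple: `A∘A ≠ 0` and the only graded subspaces `I ⊆ A` with `A∘I ⊆ I` are `0` and `A`. -/
def IsSimpleG (mul : J → J → J) (ev od : Submodule F J) (A : Submodule F J) : Prop :=
  (∃ x ∈ A, ∃ y ∈ A, mul x y ≠ 0) ∧
  ∀ I : Submodule F J, I ≤ A → IsGradedG ev od I →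
    (∀ x ∈ A, ∀ y ∈ I, mul x y ∈ I) → I = ⊥ ∨ I = A

/-- An isomorphism of superalgebras: an F-linear bijection mapping even part onto even
part, odd part onto odd part, and preserving the product. -/
def SuperIsoG {J₂ : Type*} [AddCommGroup J₂] [Module F J₂]
    (mul₁ : J → J → J) (ev₁ od₁ : Submodule F J)
    (mul₂ : J₂ → J₂ → J₂) (ev₂ od₂ : Submodule F J₂)
    (A : Submodule F J) (B : Submodule F J₂) : Prop :=
  ∃ e : A ≃ₗ[F] B,
    (∀ x : A, (x : J) ∈ ev₁ ↔ (e x : J₂) ∈ ev₂) ∧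
    (∀ x : A, (x : J) ∈ od₁ ↔ (e x : J₂) ∈ od₂) ∧
    ∀ x y z : A, mul₁ x y = (z : J) → mul₂ (e x) (e y) = (e z : J₂)

end SuperDefs

/-- The space of (n+m)×(n+m) matrices, indices split into even (`inl`) and odd (`inr`) ones. -/
abbrev MJ (F : Type*) [Field F] (n m : ℕ) :=
  Matrix (Fin n ⊕ Fin m) (Fin n ⊕ Fin m) F

/-- Parity of an index. -/
def pty {n m : ℕ} : Fin n ⊕ Fin m → Bool := Sum.elim (fun _ => false) (fun _ => true)

variable (F : Type*) [Field F]

/-- The odd component of a matrix (block-antidiagonal part). -/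
def oddPart {n m : ℕ} (X : MJ F n m) : MJ F n m :=
  Matrix.of fun i j => if pty i = pty j then 0 else X i j

/-- The even component of a matrix (block-diagonal part). -/
def evenPart {n m : ℕ} (X : MJ F n m) : MJ F n m :=
  Matrix.of fun i j => if pty i = pty j then X i j else 0

variable {F}

/-- The super-Jordan product on `M_{n,m}(F)^{(+)}`:  `x∘y = (xy+yx)/2` when `x` or `y` is
even and `x∘y = (xy−yx)/2` when both are odd, extended bilinearly.  (For arbitrary
matrices this bilinear extension equals `(xy+yx)/2 − y₁x₁` where `x₁, y₁` are the odd
components.) -/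
def jmul {n m : ℕ} (X Y : MJ F n m) : MJ F n m :=
  (2 : F)⁻¹ • (X * Y + Y * X) - oddPart F Y * oddPart F X

variable (F)

/-- The even part `J₀` of `M_{n,m}(F)^{(+)}`: block-diagonal matrices. -/
def evenSub (n m : ℕ) : Submodule F (MJ F n m) where
  carrier := {X | ∀ i j, pty i ≠ pty j → X i j = 0}
  zero_mem' := by intro i j _; simp
  add_mem' := by
    intro a b ha hb i j h
    simp only [Matrix.add_apply, ha i j h, hb i j h, add_zero]
  smul_mem' := by
    intro c a ha i j h
    simp only [Matrix.smul_apply, ha i j h, smul_zero]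

/-- The odd part `J₁` of `M_{n,m}(F)^{(+)}`: block-antidiagonal matrices. -/
def oddSub (n m : ℕ) : Submodule F (MJ F n m) where
  carrier := {X | ∀ i j, pty i = pty j → X i j = 0}
  zero_mem' := by intro i j _; simp
  add_mem' := by
    intro a b ha hb i j h
    simp only [Matrix.add_apply, ha i j h, hb i j h, add_zero]
  smul_mem' := by
    intro c a ha i j h
    simp only [Matrix.smul_apply, ha i j h, smul_zero]

/-- Statements about `M_{n,m}(F)^{(+)}` specialized from the generic definitions. -/
abbrev IsGraded {n m : ℕ} (A : Submodule F (MJ F n m)) : Prop :=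
  IsGradedG (evenSub F n m) (oddSub F n m) A

abbrev IsSubalg {n m : ℕ} (A : Submodule F (MJ F n m)) : Prop :=
  IsSubalgG jmul (evenSub F n m) (oddSub F n m) A

abbrev Nontriv {n m : ℕ} (A : Submodule F (MJ F n m)) : Prop :=
  NontrivG (oddSub F n m) A

abbrev IsSimple {n m : ℕ} (A : Submodule F (MJ F n m)) : Prop :=
  IsSimpleG jmul (evenSub F n m) (oddSub F n m) A

abbrev SuperIso {n₁ m₁ n₂ m₂ : ℕ}
    (A : Submodule F (MJ F n₁ m₁)) (B : Submodule F (MJ F n₂ m₂)) : Prop :=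
  SuperIsoG jmul (evenSub F n₁ m₁) (oddSub F n₁ m₁)
    jmul (evenSub F n₂ m₂) (oddSub F n₂ m₂) A B

/-- The standard symplectic matrix `S = [[0, I_q],[−I_q, 0]]` of size `2q`. -/
def SMat (q : ℕ) : Matrix (Fin (2 * q)) (Fin (2 * q)) F :=
  Matrix.of fun i j =>
    if (j : ℕ) = (i : ℕ) + q then (1 : F) else if (i : ℕ) = (j : ℕ) + q then -1 else 0

/-- `osp(p,q)`: block matrices `[[A, C],[S⁻¹Cᵀ, D]]` inside `M_{p,2q}(F)^{(+)}` with
`A` symmetric, `C` arbitrary and `Dᵀ S = S D`.  The condition on the lower-left block is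
recorded in the equivalent form `S · C₂₁ = C₁₂ᵀ`. -/
def ospSub (p q : ℕ) : Submodule F (MJ F p (2 * q)) where
  carrier := {X | (X.toBlocks₁₁)ᵀ = X.toBlocks₁₁ ∧
    SMat F q * X.toBlocks₂₁ = (X.toBlocks₁₂)ᵀ ∧
    (X.toBlocks₂₂)ᵀ * SMat F q = SMat F q * X.toBlocks₂₂}
  zero_mem' := by
    refine ⟨?_, ?_, ?_⟩ <;> ext i j <;>
      simp [Matrix.toBlocks₁₁, Matrix.toBlocks₁₂, Matrix.toBlocks₂₁, Matrix.toBlocks₂₂,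
        Matrix.mul_apply]
  add_mem' := by
    rintro a b ⟨ha1, ha2, ha3⟩ ⟨hb1, hb2, hb3⟩
    have e11 : (a + b).toBlocks₁₁ = a.toBlocks₁₁ + b.toBlocks₁₁ := rfl
    have e12 : (a + b).toBlocks₁₂ = a.toBlocks₁₂ + b.toBlocks₁₂ := rfl
    have e21 : (a + b).toBlocks₂₁ = a.toBlocks₂₁ + b.toBlocks₂₁ := rfl
    have e22 : (a + b).toBlocks₂₂ = a.toBlocks₂₂ + b.toBlocks₂₂ := rfl
    refine ⟨?_, ?_, ?_⟩
    · rw [e11, Matrix.transpose_add, ha1, hb1]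
    · rw [e21, e12, Matrix.mul_add, Matrix.transpose_add, ha2, hb2]
    · rw [e22, Matrix.transpose_add, Matrix.add_mul, Matrix.mul_add, ha3, hb3]
  smul_mem' := by
    rintro c a ⟨ha1, ha2, ha3⟩
    have e11 : (c • a).toBlocks₁₁ = c • a.toBlocks₁₁ := rfl
    have e12 : (c • a).toBlocks₁₂ = c • a.toBlocks₁₂ := rfl
    have e21 : (c • a).toBlocks₂₁ = c • a.toBlocks₂₁ := rfl
    have e22 : (c • a).toBlocks₂₂ = c • a.toBlocks₂₂ := rfl
    refine ⟨?_, ?_, ?_⟩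
    · rw [e11, Matrix.transpose_smul, ha1]
    · rw [e21, e12, Matrix.mul_smul, Matrix.transpose_smul, ha2]
    · rw [e22, Matrix.transpose_smul, Matrix.smul_mul, Matrix.mul_smul, ha3]

/-- `Q(n)`: matrices `[[A, B],[B, A]]` inside `M_{n,n}(F)^{(+)}`. -/
def QSub (n : ℕ) : Submodule F (MJ F n n) where
  carrier := {X | (∀ i j, X (Sum.inr i) (Sum.inr j) = X (Sum.inl i) (Sum.inl j)) ∧
    (∀ i j, X (Sum.inr i) (Sum.inl j) = X (Sum.inl i) (Sum.inr j))}
  zero_mem' := by constructor <;> intro i j <;> simp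
  add_mem' := by
    rintro a b ⟨ha1, ha2⟩ ⟨hb1, hb2⟩
    constructor <;> intro i j <;>
      simp only [Matrix.add_apply, ha1 i j, ha2 i j, hb1 i j, hb2 i j]
  smul_mem' := by
    rintro c a ⟨ha1, ha2⟩
    constructor <;> intro i j <;>
      simp only [Matrix.smul_apply, ha1 i j, ha2 i j]

/-- `P(n)`: matrices `[[A, B],[C, Aᵀ]]` with `B` symmetric and `C` skew-symmetric,
inside `M_{n,n}(F)^{(+)}`. -/
def PSub (n : ℕ) : Submodule F (MJ F n n) where
  carrier := {X | (∀ i j, X (Sum.inr i) (Sum.inr j) = X (Sum.inl j) (Sum.inl i)) ∧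
    (∀ i j, X (Sum.inl i) (Sum.inr j) = X (Sum.inl j) (Sum.inr i)) ∧
    (∀ i j, X (Sum.inr i) (Sum.inl j) = - X (Sum.inr j) (Sum.inl i))}
  zero_mem' := by refine ⟨?_, ?_, ?_⟩ <;> intro i j <;> simp
  add_mem' := by
    rintro a b ⟨ha1, ha2, ha3⟩ ⟨hb1, hb2, hb3⟩
    refine ⟨?_, ?_, ?_⟩ <;> intro i j <;>
      simp only [Matrix.add_apply, ha1 i j, ha2 i j, ha3 i j, hb1 i j, hb2 i j, hb3 i j] <;>
      ring
  smul_mem' := by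
    rintro c a ⟨ha1, ha2, ha3⟩
    refine ⟨?_, ?_, ?_⟩ <;> intro i j <;>
      simp only [Matrix.smul_apply, ha1 i j, ha2 i j, ha3 i j, smul_neg]



end SJ

open Matrix
namespace SJ
set_option linter.unusedSectionVars false
section Jac
variable {F : Type*} [Field F] {V : Type*} [AddCommGroup V] [Module F V]

def kseq (M : Submodule F (Module.End F V)) : ℕ → Submodule F V
  | 0 => ⊥
  | i+1 => ⨅ x ∈ M, (kseq M i).comap x

lemma mem_kseq_succ {M : Submodule F (Module.End F V)} {i : ℕ} {v : V} :
    v ∈ kseq M (i+1) ↔ ∀ x ∈ M, x v ∈ kseq M i := by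
  simp [kseq, Submodule.mem_iInf]

lemma kseq_le_succ (M : Submodule F (Module.End F V)) (i : ℕ) : kseq M i ≤ kseq M (i+1) := by
  induction i with
  | zero => simp [kseq]
  | succ k ih =>
    intro v hv
    rw [mem_kseq_succ] at hv ⊢
    exact fun x hx => ih (hv x hx)

lemma kseq_mono (M : Submodule F (Module.End F V)) : Monotone (kseq M) :=
  monotone_nat_of_le_succ (kseq_le_succ M)

lemma kseq_act {M : Submodule F (Module.End F V)} {x : Module.End F V} (hx : x ∈ M) {i : ℕ} {v : V}
    (hv : v ∈ kseq M i) : x v ∈ kseq M (i-1) := by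
  cases i with
  | zero => simp [kseq] at hv; simp [hv]
  | succ k => exact mem_kseq_succ.1 hv x hx

def DD (M : Submodule F (Module.End F V)) (r t : ℕ) (Z : Module.End F V) : Prop :=
  ∀ i, ∀ v ∈ kseq M i, Z v ∈ kseq M (i + r - t)

lemma DD_zero {M : Submodule F (Module.End F V)} {r : ℕ} (hr : kseq M r = ⊤) (Z : Module.End F V) :
    DD M r 0 Z := by
  intro i v _
  have : kseq M r ≤ kseq M (i + r - 0) := kseq_mono M (by omega)
  rw [hr] at this
  exact this trivial

lemma DD_step {M : Submodule F (Module.End F V)} {r t : ℕ} {x Z : Module.End F V} (hx : x ∈ M)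
    (hZ : DD M r t Z) : DD M r (t+1) (x * Z + Z * x) := by
  intro i v hv
  refine add_mem ?_ ?_
  · exact kseq_mono M (by omega) (kseq_act hx (hZ i v hv))
  · cases i with
    | zero => simp [kseq] at hv; simp [hv]
    | succ k => exact kseq_mono M (by omega) (hZ k _ (kseq_act hx hv))

lemma DD_end {M : Submodule F (Module.End F V)} {r : ℕ} (hr : kseq M r = ⊤) {Z : Module.End F V}
    (hZ : DD M r (2*r) Z) : Z = 0 := by
  ext v
  have := hZ r v (by rw [hr]; trivial)
  rw [show r + r - 2*r = 0 by omega] at this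
  simpa [kseq] using this

def quoN (K : Submodule F V) (N : Submodule F (Module.End F V)) :
    Submodule F (Module.End F (V ⧸ K)) where
  carrier := {φ | ∃ x ∈ N, φ ∘ₗ K.mkQ = K.mkQ ∘ₗ x}
  zero_mem' := ⟨0, zero_mem _, by simp⟩
  add_mem' := by
    rintro a b ⟨x, hx, h1⟩ ⟨y, hy, h2⟩
    exact ⟨x+y, add_mem hx hy, by rw [LinearMap.add_comp, LinearMap.comp_add, h1, h2]⟩
  smul_mem' := by
    rintro c a ⟨x, hx, h1⟩
    exact ⟨c • x, N.smul_mem c hx, by rw [LinearMap.smul_comp, LinearMap.comp_smul, h1]⟩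

def resN (W : Submodule F V) (N : Submodule F (Module.End F V)) :
    Submodule F (Module.End F W) where
  carrier := {φ | ∃ x ∈ N, W.subtype ∘ₗ φ = x ∘ₗ W.subtype}
  zero_mem' := ⟨0, zero_mem _, by simp⟩
  add_mem' := by
    rintro a b ⟨x, hx, h1⟩ ⟨y, hy, h2⟩
    exact ⟨x+y, add_mem hx hy, by rw [LinearMap.add_comp, LinearMap.comp_add, h1, h2]⟩
  smul_mem' := by
    rintro c a ⟨x, hx, h1⟩
    exact ⟨c • x, N.smul_mem c hx, by rw [LinearMap.smul_comp, LinearMap.comp_smul, h1]⟩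

variable [FiniteDimensional F V]

lemma finrank_quoN (K : Submodule F V) (N : Submodule F (Module.End F V)) :
    Module.finrank F (quoN K N) ≤ Module.finrank F N := by
  let g : Module.End F (V ⧸ K) →ₗ[F] (V →ₗ[F] V ⧸ K) := LinearMap.lcomp F _ K.mkQ
  let h : Module.End F V →ₗ[F] (V →ₗ[F] V ⧸ K) := LinearMap.llcomp F V V (V ⧸ K) K.mkQ
  have hg : Function.Injective g := by
    intro a b hab
    ext v
    exact LinearMap.congr_fun hab v
  have h1 : Submodule.map g (quoN K N) ≤ Submodule.map h N := by
    rintro _ ⟨φ, ⟨x, hx, hh⟩, rfl⟩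
    exact ⟨x, hx, hh.symm⟩
  calc _ = Module.finrank F (Submodule.map g (quoN K N)) :=
        (LinearEquiv.finrank_eq (Submodule.equivMapOfInjective g hg _))
    _ ≤ Module.finrank F (Submodule.map h N) := Submodule.finrank_mono h1
    _ ≤ _ := Submodule.finrank_map_le h N

lemma finrank_resN (W : Submodule F V) (N : Submodule F (Module.End F V)) {x : Module.End F V}
    (hx : x ∈ N) (hx0 : x ≠ 0) (hxW : ∀ w ∈ W, x w = 0) :
    Module.finrank F (resN W N) < Module.finrank F N := by
  let g : Module.End F W →ₗ[F] (W →ₗ[F] V) := LinearMap.llcomp F W W V W.subtype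
  let h : Module.End F V →ₗ[F] (W →ₗ[F] V) := LinearMap.lcomp F _ W.subtype
  have hg : Function.Injective g := by
    intro a b hab
    ext v
    exact LinearMap.congr_fun hab v
  have h1 : Submodule.map g (resN W N) ≤ LinearMap.range (h.domRestrict N) := by
    rintro _ ⟨φ, ⟨x, hx, hh⟩, rfl⟩
    exact ⟨⟨x, hx⟩, hh.symm⟩
  have h2 : 0 < Module.finrank F (LinearMap.ker (h.domRestrict N)) := by
    rw [Nat.pos_iff_ne_zero, Ne, Submodule.finrank_eq_zero]
    intro h0
    have : (⟨x, hx⟩ : N) ∈ LinearMap.ker (h.domRestrict N) := by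
      ext w
      exact hxW w w.2
    rw [h0] at this
    exact hx0 (congrArg Subtype.val ((Submodule.mem_bot F).1 this))
  have h3 := LinearMap.finrank_range_add_finrank_ker (h.domRestrict N)
  have h4 := Submodule.finrank_mono h1
  have h5 := (LinearEquiv.finrank_eq (Submodule.equivMapOfInjective g hg (resN W N)))
  omega

lemma nil_quo {K : Submodule F V} {x : Module.End F V} {φ : Module.End F (V ⧸ K)}
    (h : φ ∘ₗ K.mkQ = K.mkQ ∘ₗ x) (hn : IsNilpotent x) : IsNilpotent φ := by
  obtain ⟨k, hk⟩ := hn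
  refine ⟨k, ?_⟩
  have : ∀ j : ℕ, (φ^j) ∘ₗ K.mkQ = K.mkQ ∘ₗ (x^j) := by
    intro j
    induction j with
    | zero => rfl
    | succ j ih =>
      rw [pow_succ, pow_succ, Module.End.mul_eq_comp, Module.End.mul_eq_comp, LinearMap.comp_assoc, h,
        ← LinearMap.comp_assoc, ih, LinearMap.comp_assoc]
  ext v
  have := LinearMap.congr_fun (this k) v
  simpa [hk] using this

lemma nil_res {W : Submodule F V} {x : Module.End F V} {φ : Module.End F W}
    (h : W.subtype ∘ₗ φ = x ∘ₗ W.subtype) (hn : IsNilpotent x) : IsNilpotent φ := by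
  obtain ⟨k, hk⟩ := hn
  refine ⟨k, ?_⟩
  have : ∀ j : ℕ, W.subtype ∘ₗ (φ^j) = (x^j) ∘ₗ W.subtype := by
    intro j
    induction j with
    | zero => rfl
    | succ j ih =>
      rw [pow_succ, pow_succ', Module.End.mul_eq_comp, Module.End.mul_eq_comp, ← LinearMap.comp_assoc, ih,
        LinearMap.comp_assoc, h, ← LinearMap.comp_assoc, ← Module.End.mul_eq_comp, ← Module.End.mul_eq_comp,
        ← pow_succ, ← pow_succ']
  ext v
  have := LinearMap.congr_fun (this k) v
  simpa [hk] using this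

/-- closed under squares and nil -/
def SqNil (N : Submodule F (Module.End F V)) : Prop :=
  (∀ x ∈ N, x * x ∈ N) ∧ ∀ x ∈ N, IsNilpotent x

lemma SqNil.jmem {N : Submodule F (Module.End F V)} (hN : SqNil N) {x y : Module.End F V}
    (hx : x ∈ N) (hy : y ∈ N) : x * y + y * x ∈ N := by
  have := N.sub_mem (N.sub_mem (hN.1 _ (N.add_mem hx hy)) (hN.1 _ hx)) (hN.1 _ hy)
  convert this using 1
  noncomm_ring

lemma SqNil.quo {N : Submodule F (Module.End F V)} (hN : SqNil N) (K : Submodule F V) :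
    SqNil (quoN K N) := by
  constructor
  · rintro φ ⟨x, hx, h⟩
    refine ⟨x*x, hN.1 x hx, ?_⟩
    rw [Module.End.mul_eq_comp, Module.End.mul_eq_comp, LinearMap.comp_assoc, h, ← LinearMap.comp_assoc, h,
      LinearMap.comp_assoc]
  · rintro φ ⟨x, hx, h⟩
    exact nil_quo h (hN.2 x hx)

lemma SqNil.res {N : Submodule F (Module.End F V)} (hN : SqNil N) (W : Submodule F V) :
    SqNil (resN W N) := by
  constructor
  · rintro φ ⟨x, hx, h⟩
    refine ⟨x*x, hN.1 x hx, ?_⟩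
    rw [Module.End.mul_eq_comp, Module.End.mul_eq_comp, ← LinearMap.comp_assoc, h, LinearMap.comp_assoc, h,
      LinearMap.comp_assoc]
  · rintro φ ⟨x, hx, h⟩
    exact nil_res h (hN.2 x hx)

/-- from common kernels on quotients to a full flag -/
lemma flag_of_quo {N : Submodule F (Module.End F V)}
    (H : ∀ K : Submodule F V, K ≠ ⊤ → ∃ v : V ⧸ K, v ≠ 0 ∧ ∀ φ ∈ quoN K N, φ v = 0) :
    ∃ r, kseq N r = ⊤ := by
  by_contra hcon
  push Not at hcon
  have key : ∀ i, i ≤ Module.finrank F (kseq N i) := by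
    intro i
    induction i with
    | zero => simp
    | succ k ih =>
      have hlt : kseq N k < kseq N (k+1) := by
        refine lt_of_le_of_ne (kseq_le_succ N k) ?_
        intro heq
        obtain ⟨v, hv, hφ⟩ := H (kseq N k) (hcon k)
        obtain ⟨u, rfl⟩ := Submodule.mkQ_surjective _ v
        apply hv
        have : u ∈ kseq N (k+1) := by
          rw [mem_kseq_succ]
          intro x hx
          have hst : kseq N k ≤ (kseq N k).comap x := fun w hw =>
            kseq_mono N (by omega) (kseq_act hx hw)
          have := hφ (Submodule.mapQ _ _ x hst) ⟨x, hx, by ext; rfl⟩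
          simpa using this
        rw [← heq] at this
        simpa using this
      have := Submodule.finrank_lt_finrank_of_lt hlt
      omega
  have := key (Module.finrank F V + 1)
  have := Submodule.finrank_le (kseq N (Module.finrank F V + 1))
  omega

end Jac

lemma jac_aux {F : Type*} [Field F] (d : ℕ) : ∀ (V : Type*) [AddCommGroup V] [Module F V]
    [FiniteDimensional F V] (N : Submodule F (Module.End F V)), SqNil N → Module.finrank F N ≤ d →
    Nontrivial V → ∃ v : V, v ≠ 0 ∧ ∀ x ∈ N, x v = 0 := by
  induction d with
  | zero =>
    intro V _ _ _ N hN hd hV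
    obtain ⟨v, hv⟩ := exists_ne (0:V)
    refine ⟨v, hv, ?_⟩
    have : N = ⊥ := Submodule.finrank_eq_zero.1 (by omega)
    subst this
    intro x hx
    simp at hx
    simp [hx]
  | succ d ih =>
    intro V _ _ _ N hN hd hV
    by_cases hN0 : N = ⊥
    · obtain ⟨v, hv⟩ := exists_ne (0:V)
      refine ⟨v, hv, ?_⟩
      subst hN0
      intro x hx
      simp at hx
      simp [hx]
    obtain ⟨M, ⟨hMN, hMsq⟩, hMmax⟩ := (wellFounded_gt (α := Submodule F (Module.End F V))).has_min
      {M | M < N ∧ ∀ x ∈ M, x * x ∈ M} ⟨⊥, bot_lt_iff_ne_bot.2 hN0, by simp⟩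
    have hmax : ∀ M' : Submodule F (Module.End F V), M' ≤ N → (∀ x ∈ M', x * x ∈ M') → M < M' → M' = N := by
      intro M' h1 h2 h3
      by_contra h4
      exact hMmax M' ⟨lt_of_le_of_ne h1 h4, h2⟩ h3
    by_cases hM0 : M = ⊥
    · subst hM0
      obtain ⟨n, hnN, hn0⟩ := Submodule.exists_mem_ne_zero_of_ne_bot hN0
      have : ∃ z ∈ N, z ≠ 0 ∧ z * z = 0 := by
        by_contra hcon
        push Not at hcon
        have hk : ∀ k : ℕ, n ^ (2^k) ∈ N ∧ n ^ (2^k) ≠ 0 := by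
          intro k
          induction k with
          | zero => simpa using ⟨hnN, hn0⟩
          | succ k ihk =>
            have e : n ^ (2^(k+1)) = n ^ (2^k) * n^(2^k) := by rw [← pow_add]; congr 1; ring
            rw [e]
            exact ⟨hN.1 _ ihk.1, hcon _ ihk.1 ihk.2⟩
        obtain ⟨j, hj⟩ := hN.2 n hnN
        exact (hk j).2 (pow_eq_zero_of_le (Nat.lt_two_pow_self).le hj)
      obtain ⟨z, hzN, hz0, hzz⟩ := this
      have hspan : Submodule.span F {z} = N := by
        apply hmax
        · simpa using hzN
        · intro x hx
          obtain ⟨a, rfl⟩ := Submodule.mem_span_singleton.1 hx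
          simp [hzz]
        · rw [bot_lt_iff_ne_bot]
          simpa using hz0
      have : ∃ v, z v ≠ 0 := by
        by_contra h
        push Not at h
        exact hz0 (LinearMap.ext h)
      obtain ⟨v, hv⟩ := this
      refine ⟨z v, hv, ?_⟩
      intro x hx
      rw [← hspan] at hx
      obtain ⟨a, rfl⟩ := Submodule.mem_span_singleton.1 hx
      have := LinearMap.congr_fun hzz v
      simp at this
      simp [this]
    · have hMS : SqNil M := ⟨hMsq, fun x hx => hN.2 x (hMN.le hx)⟩
      have hMd : Module.finrank F M ≤ d := by
        have := Submodule.finrank_lt_finrank_of_lt hMN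
        omega
      obtain ⟨r, hr⟩ : ∃ r, kseq M r = ⊤ := by
        apply flag_of_quo
        intro K hK
        have : Nontrivial (V ⧸ K) := Submodule.Quotient.nontrivial_iff.2 hK
        exact ih (V ⧸ K) (quoN K M) (hMS.quo K) ((finrank_quoN K M).trans hMd) this
      have hy : ∃ y ∈ N, y ∉ M ∧ ∀ x ∈ M, x * y + y * x ∈ M := by
        by_contra hcon
        push Not at hcon
        have : ∀ t, ∃ y ∈ N, y ∉ M ∧ DD M r t y := by
          intro t
          induction t with
          | zero =>
            obtain ⟨y, hy1, hy2⟩ := SetLike.exists_of_lt hMN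
            exact ⟨y, hy1, hy2, DD_zero hr y⟩
          | succ t iht =>
            obtain ⟨y, hy1, hy2, hy3⟩ := iht
            obtain ⟨x, hx, hxy⟩ := hcon y hy1 hy2
            exact ⟨_, hN.jmem (hMN.le hx) hy1, hxy, DD_step hx hy3⟩
        obtain ⟨y, _, hy2, hy3⟩ := this (2*r)
        apply hy2
        rw [DD_end hr hy3]
        exact zero_mem _
      obtain ⟨y, hyN, hyM, hyMM⟩ := hy
      let W : Submodule F V := kseq M 1
      have hW : ∀ v, v ∈ W ↔ ∀ x ∈ M, x v = 0 := by
        intro v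
        exact mem_kseq_succ
      let N' : Submodule F (Module.End F V) := N ⊓
        { carrier := {x | ∀ w ∈ W, x w ∈ W}
          zero_mem' := by intro w _; simp
          add_mem' := fun ha hb w hw => add_mem (ha w hw) (hb w hw)
          smul_mem' := fun c a ha w hw => W.smul_mem c (ha w hw) }
      have hN' : N' = N := by
        apply hmax
        · exact inf_le_left
        · rintro x ⟨hx1, hx2⟩
          exact ⟨hN.1 x hx1, fun w hw => hx2 _ (hx2 w hw)⟩
        · refine lt_of_le_of_ne ?_ ?_
          · intro x hx
            refine ⟨hMN.le hx, fun w hw => ?_⟩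
            rw [(hW w).1 hw x hx]
            exact zero_mem _
          · intro h
            apply hyM
            rw [h]
            refine ⟨hyN, fun w hw => ?_⟩
            rw [hW]
            intro x hx
            have h1 := (hW w).1 hw _ (hyMM x hx)
            simpa [(hW w).1 hw x hx] using h1
      have hstab : ∀ x ∈ N, ∀ w ∈ W, x w ∈ W := by
        intro x hx
        rw [← hN'] at hx
        exact hx.2
      obtain ⟨v0, hv0, hv0M⟩ := ih V M hMS hMd hV
      have hWn : Nontrivial W := ⟨⟨⟨v0, (hW v0).2 hv0M⟩, 0, fun h => hv0 (congrArg Subtype.val h)⟩⟩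
      obtain ⟨x0, hx0, hx0'⟩ := Submodule.exists_mem_ne_zero_of_ne_bot hM0
      have hlt := finrank_resN W N (hMN.le hx0) hx0' (fun w hw => (hW w).1 hw x0 hx0)
      obtain ⟨w, hw0, hw⟩ := ih W (resN W N) (hN.res W) (by omega) hWn
      refine ⟨w, fun h => hw0 (Subtype.ext h), ?_⟩
      intro x hx
      have := hw (x.restrict (hstab x hx)) ⟨x, hx, by ext; rfl⟩
      exact congrArg Subtype.val this

theorem jac_flag {F : Type*} [Field F] {V : Type*} [AddCommGroup V] [Module F V]
    [FiniteDimensional F V] (N : Submodule F (Module.End F V)) (hN : SqNil N) :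
    ∃ r, kseq N r = ⊤ := by
  apply flag_of_quo
  intro K hK
  have : Nontrivial (V ⧸ K) := Submodule.Quotient.nontrivial_iff.2 hK
  exact jac_aux _ (V ⧸ K) (quoN K N) (hN.quo K) le_rfl this

/-- TrZero -/
theorem jac_tr {F : Type*} [Field F] {V : Type*} [AddCommGroup V] [Module F V]
    [FiniteDimensional F V] (N : Submodule F (Module.End F V)) (hN : SqNil N)
    (S : Set (Module.End F V)) (hS : ∀ s ∈ S, ∀ a ∈ N, ∃ b ∈ N, ∃ c ∈ N, a * s = s * b + c) :
    ∀ a ∈ N, ∀ t ∈ Algebra.adjoin F S, LinearMap.trace F V (a * t) = 0 := by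
  obtain ⟨r, hr⟩ := jac_flag N hN
  intro a ha t ht
  have hst : ∀ t ∈ Algebra.adjoin F S, ∀ i, ∀ v ∈ kseq N i, t v ∈ kseq N i := by
    intro t ht
    induction ht using Algebra.adjoin_induction with
    | mem s hs =>
      intro i
      induction i with
      | zero => intro v hv; simp [kseq] at hv; simp [hv]
      | succ k ih =>
        intro v hv
        rw [mem_kseq_succ]
        intro a ha
        obtain ⟨b, hb, c, hc, h⟩ := hS s hs a ha
        have := LinearMap.congr_fun h v
        simp at this
        rw [this]
        exact add_mem (ih _ (kseq_act hb hv)) (kseq_act hc hv)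
    | algebraMap c => intro i v hv; exact Submodule.smul_mem _ c hv
    | add x y _ _ hx hy => intro i v hv; exact add_mem (hx i v hv) (hy i v hv)
    | mul x y _ _ hx hy => intro i v hv; exact hx i _ (hy i v hv)
  have hnil : IsNilpotent (a * t) := by
    refine ⟨r, ?_⟩
    have : ∀ j v, ((a*t)^j) v ∈ kseq N (r - j) := by
      intro j
      induction j with
      | zero => intro v; rw [Nat.sub_zero, hr]; trivial
      | succ j ih =>
        intro v
        rw [pow_succ']
        exact kseq_mono N (by omega) (kseq_act ha (hst t ht _ _ (ih v)))
    ext v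
    have := this r v
    simpa [kseq] using this
  exact (LinearMap.isNilpotent_trace_of_isNilpotent hnil).eq_zero
end SJ

open Matrix
namespace SJ
set_option linter.unusedSectionVars false
section M
variable {F : Type*} [Field F] {ι : Type*} [Fintype ι] [DecidableEq ι]

/-- closed under squares and nil -/
def SqNilM (N : Submodule F (Matrix ι ι F)) : Prop :=
  (∀ x ∈ N, x * x ∈ N) ∧ ∀ x ∈ N, IsNilpotent x

def toE (N : Submodule F (Matrix ι ι F)) : Submodule F (Module.End F (ι → F)) :=
  N.map (Matrix.toLinAlgEquiv' : Matrix ι ι F ≃ₐ[F] _).toLinearMap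

lemma mem_toE {N : Submodule F (Matrix ι ι F)} {x : Matrix ι ι F} :
    Matrix.toLinAlgEquiv' x ∈ toE N ↔ x ∈ N := by
  constructor
  · rintro ⟨y, hy, h⟩
    have : y = x := (Matrix.toLinAlgEquiv' : Matrix ι ι F ≃ₐ[F] _).injective h
    rwa [← this]
  · exact fun h => ⟨x, h, rfl⟩

lemma SqNilM.toE {N : Submodule F (Matrix ι ι F)} (hN : SqNilM N) : SqNil (toE N) := by
  constructor
  · rintro _ ⟨x, hx, rfl⟩
    refine ⟨x * x, hN.1 x hx, ?_⟩
    exact map_mul (Matrix.toLinAlgEquiv' : Matrix ι ι F ≃ₐ[F] _) x x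
  · rintro _ ⟨x, hx, rfl⟩
    exact (hN.2 x hx).map (Matrix.toLinAlgEquiv' : Matrix ι ι F ≃ₐ[F] _)

theorem jacM_tr (N : Submodule F (Matrix ι ι F)) (hN : SqNilM N)
    (S : Set (Matrix ι ι F)) (hS : ∀ s ∈ S, ∀ a ∈ N, ∃ b ∈ N, ∃ c ∈ N, a * s = s * b + c) :
    ∀ a ∈ N, ∀ t ∈ Algebra.adjoin F S, (a * t).trace = 0 := by
  intro a ha t ht
  have h := jac_tr (toE N) hN.toE ((Matrix.toLinAlgEquiv' : Matrix ι ι F ≃ₐ[F] _).toAlgHom '' S) ?_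
    (Matrix.toLinAlgEquiv' a) (mem_toE.2 ha) (Matrix.toLinAlgEquiv' t) ?_
  · rw [← map_mul] at h
    rw [← Matrix.trace_toLin'_eq]
    exact h
  · rintro _ ⟨s, hs, rfl⟩ _ ⟨a, ha, rfl⟩
    obtain ⟨b, hb, c, hc, h⟩ := hS s hs a ha
    refine ⟨_, mem_toE.2 hb, _, mem_toE.2 hc, ?_⟩
    have := congrArg (Matrix.toLinAlgEquiv' : Matrix ι ι F ≃ₐ[F] _) h
    rw [map_add, map_mul, map_mul] at this
    exact this
  · rw [← AlgHom.map_adjoin]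
    exact ⟨t, ht, rfl⟩

theorem jacM_span (N O : Submodule F (Matrix ι ι F)) (hN : SqNilM N)
    (hO : O ≤ Submodule.span F {z | ∃ a ∈ N, ∃ x ∈ O, z = a * x + x * a}) : O = ⊥ := by
  obtain ⟨r, hr⟩ := jac_flag _ hN.toE
  have h : ∀ t, ∀ x ∈ O, DD (toE N) r t (Matrix.toLinAlgEquiv' x) := by
    intro t
    induction t with
    | zero => intro x _; exact DD_zero hr _
    | succ t ih =>
      intro x hx
      have hx' := hO hx
      clear hx
      induction hx' using Submodule.span_induction with
      | mem z hz =>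
        obtain ⟨a, ha, x, hx, rfl⟩ := hz
        rw [map_add, map_mul, map_mul]
        exact DD_step (mem_toE.2 ha) (ih x hx)
      | zero => intro i v _; simp
      | add x y _ _ h1 h2 => intro i v hv; rw [map_add]; exact add_mem (h1 i v hv) (h2 i v hv)
      | smul c x _ h1 => intro i v hv; rw [map_smul]; exact Submodule.smul_mem _ c (h1 i v hv)
  rw [eq_bot_iff]
  intro x hx
  have := DD_end hr (h (2*r) x hx)
  exact (Matrix.toLinAlgEquiv' : Matrix ι ι F ≃ₐ[F] _).injective (by rw [this, map_zero])

lemma fitting (c : Matrix ι ι F) : ∃ P Q : Polynomial F, Polynomial.X ∣ P ∧ Polynomial.X ∣ Q ∧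
    Polynomial.aeval c P * Polynomial.aeval c P = Polynomial.aeval c P ∧
    IsNilpotent ((1 - Polynomial.aeval c P) * c) ∧ c * Polynomial.aeval c Q = Polynomial.aeval c P := by
  open Polynomial in
  have hχ : c.charpoly ≠ 0 := (Matrix.charpoly_monic c).ne_zero
  obtain ⟨R, hR, hR0⟩ := Polynomial.exists_eq_pow_rootMultiplicity_mul_and_not_dvd c.charpoly hχ 0
  set k := Polynomial.rootMultiplicity 0 c.charpoly
  rw [map_zero, sub_zero] at hR hR0
  have hcop : IsCoprime (Polynomial.X ^ (k+2)) R :=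
    (Irreducible.coprime_iff_not_dvd Polynomial.irreducible_X).2 hR0 |>.pow_left
  obtain ⟨u, v, huv⟩ := hcop
  have hX : Polynomial.aeval c (Polynomial.X ^ k * R) = 0 := by
    rw [← hR]; exact Matrix.aeval_self_charpoly c
  have hz : ∀ T : Polynomial F, Polynomial.X ^ k * R ∣ T → Polynomial.aeval c T = 0 := by
    rintro _ ⟨T, rfl⟩
    rw [map_mul, hX, zero_mul]
  refine ⟨u * Polynomial.X ^ (k+2), u * Polynomial.X ^ (k+1), ?_, ?_, ?_, ?_, ?_⟩
  · exact Dvd.intro_left (u * Polynomial.X ^ (k+1)) (by ring)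
  · exact Dvd.intro_left (u * Polynomial.X ^ k) (by ring)
  · rw [← map_mul, ← sub_eq_zero, ← map_sub]
    apply hz
    refine ⟨- u * v * Polynomial.X^2, ?_⟩
    linear_combination (u * Polynomial.X ^ (k+2)) * huv
  · refine ⟨k+1, ?_⟩
    have : (1 - Polynomial.aeval c (u * Polynomial.X ^ (k+2))) * c =
        Polynomial.aeval c ((v * R) * Polynomial.X) := by
      rw [map_mul _ (v * R), Polynomial.aeval_X, ← map_one (Polynomial.aeval (R := F) c), ← map_sub]
      congr 2
      linear_combination -huv
    rw [this, ← map_pow]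
    apply hz
    refine ⟨v * (v * R)^k * Polynomial.X, by ring⟩
  · have : u * Polynomial.X ^ (k+2) = Polynomial.X * (u * Polynomial.X ^ (k+1)) := by ring
    rw [this, map_mul _ Polynomial.X, Polynomial.aeval_X]

/-- Jordan closed -/
def JC (E : Submodule F (Matrix ι ι F)) : Prop := ∀ a ∈ E, ∀ b ∈ E, a * b + b * a ∈ E

variable [CharZero F]

lemma JC.pow {E : Submodule F (Matrix ι ι F)} (hE : JC E) {c : Matrix ι ι F} (hc : c ∈ E) (k : ℕ) :
    c ^ (k+1) ∈ E := by
  induction k with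
  | zero => simpa using hc
  | succ k ih =>
    have := E.smul_mem (2:F)⁻¹ (hE c hc _ ih)
    rwa [← pow_succ, ← pow_succ', ← two_smul F, smul_smul, inv_mul_cancel₀ two_ne_zero, one_smul] at this

lemma JC.aeval {E : Submodule F (Matrix ι ι F)} (hE : JC E) {c : Matrix ι ι F} (hc : c ∈ E)
    {P : Polynomial F} (hP : Polynomial.X ∣ P) : Polynomial.aeval c P ∈ E := by
  obtain ⟨Q, rfl⟩ := hP
  induction Q using Polynomial.induction_on' with
  | add p q hp hq => rw [mul_add, map_add]; exact add_mem hp hq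
  | monomial n a =>
    have : Polynomial.X * Polynomial.monomial n a = Polynomial.monomial (n+1) a := by
      rw [Polynomial.X_mul_monomial]
    rw [this, Polynomial.aeval_monomial, ← Algebra.smul_def]
    exact E.smul_mem _ (hE.pow hc n)

lemma JC.half {E : Submodule F (Matrix ι ι F)} {a : Matrix ι ι F} (h : (2:F) • a ∈ E) : a ∈ E := by
  have := E.smul_mem (2:F)⁻¹ h
  rwa [smul_smul, inv_mul_cancel₀ two_ne_zero, one_smul] at this

lemma JC.sq {E : Submodule F (Matrix ι ι F)} (hE : JC E) {c : Matrix ι ι F} (hc : c ∈ E) :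
    c * c ∈ E := by
  have := hE.pow hc 1
  rwa [pow_two] at this

lemma idem_tr_zero {e : Matrix ι ι F} (he : e * e = e) (ht : e.trace = 0) : e = 0 := by
  have h1 : IsIdempotentElem (Matrix.toLinAlgEquiv' e) := by
    unfold IsIdempotentElem
    rw [← map_mul, he]
  have h2 : LinearMap.trace F (ι → F) (Matrix.toLinAlgEquiv' e) = 0 := by
    rw [← ht, ← Matrix.trace_toLin'_eq]; rfl
  have := (LinearMap.IsIdempotentElem.trace_eq_zero_iff h1).1 h2
  exact (Matrix.toLinAlgEquiv' : Matrix ι ι F ≃ₐ[F] _).injective (by rw [this, map_zero])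

lemma trace_nil {a : Matrix ι ι F} (h : IsNilpotent a) : a.trace = 0 :=
  (Matrix.isNilpotent_trace_of_isNilpotent h).eq_zero

/-- elements in the trace radical of a Jordan algebra are nilpotent -/
lemma nil_of_rad {E : Submodule F (Matrix ι ι F)} (hE : JC E) {a : Matrix ι ι F} (ha : a ∈ E)
    (h : ∀ b ∈ E, (a * b).trace = 0) : IsNilpotent a := by
  obtain ⟨P, Q, hP, hQ, h1, h2, h3⟩ := fitting a
  have : Polynomial.aeval a P = 0 := by
    apply idem_tr_zero h1
    rw [← h3]
    exact h _ (hE.aeval ha hQ)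
  rwa [this, sub_zero, one_mul] at h2

structure Simp (E O : Submodule F (Matrix ι ι F)) : Prop where
  ee : JC E
  eo : ∀ a ∈ E, ∀ x ∈ O, a * x + x * a ∈ O
  oo : ∀ x ∈ O, ∀ y ∈ O, x * y - y * x ∈ E
  simp : ∀ I0 I1 : Submodule F (Matrix ι ι F), I0 ≤ E → I1 ≤ O →
    (∀ a ∈ E, ∀ b ∈ I0, a * b + b * a ∈ I0) → (∀ x ∈ O, ∀ b ∈ I0, b * x + x * b ∈ I1) →
    (∀ a ∈ E, ∀ y ∈ I1, a * y + y * a ∈ I1) → (∀ x ∈ O, ∀ y ∈ I1, x * y - y * x ∈ I0) →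
    (I0 = ⊥ ∧ I1 = ⊥) ∨ (I0 = E ∧ I1 = O)
  nt : O ≠ ⊥
  pr : (∃ a ∈ E, ∃ b ∈ E, a * b + b * a ≠ 0) ∨ (∃ a ∈ E, ∃ x ∈ O, a * x + x * a ≠ 0) ∨
    (∃ x ∈ O, ∃ y ∈ O, x * y - y * x ≠ 0)

lemma Simp.span_odd {E O : Submodule F (Matrix ι ι F)} (h : Simp E O) :
    O = Submodule.span F {z | ∃ a ∈ E, ∃ x ∈ O, z = a * x + x * a} := by
  set I1 := Submodule.span F {z | ∃ a ∈ E, ∃ x ∈ O, z = a * x + x * a} with hI1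
  set I0 := Submodule.span F ({z | ∃ a ∈ E, ∃ b ∈ E, z = a * b + b * a} ∪
    {z | ∃ x ∈ O, ∃ y ∈ O, z = x * y - y * x}) with hI0
  have l0 : I0 ≤ E := by
    rw [hI0, Submodule.span_le]
    rintro _ (⟨a, ha, b, hb, rfl⟩ | ⟨a, ha, b, hb, rfl⟩)
    · exact h.ee a ha b hb
    · exact h.oo a ha b hb
  have l1 : I1 ≤ O := by
    rw [hI1, Submodule.span_le]
    rintro _ ⟨a, ha, b, hb, rfl⟩
    exact h.eo a ha b hb
  rcases h.simp I0 I1 l0 l1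
    (fun a ha b hb => Submodule.subset_span (Or.inl ⟨a, ha, b, l0 hb, rfl⟩))
    (fun x hx b hb => Submodule.subset_span ⟨b, l0 hb, x, hx, rfl⟩)
    (fun a ha y hy => Submodule.subset_span ⟨a, ha, y, l1 hy, rfl⟩)
    (fun x hx y hy => Submodule.subset_span (Or.inr ⟨x, hx, y, l1 hy, rfl⟩)) with ⟨h0, h1⟩ | ⟨h0, h1⟩
  · exfalso
    rcases h.pr with ⟨a, ha, b, hb, hn⟩ | ⟨a, ha, b, hb, hn⟩ | ⟨a, ha, b, hb, hn⟩
    · apply hn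
      rw [← Submodule.mem_bot F, ← h0]
      exact Submodule.subset_span (Or.inl ⟨a, ha, b, hb, rfl⟩)
    · apply hn
      rw [← Submodule.mem_bot F, ← h1]
      exact Submodule.subset_span ⟨a, ha, b, hb, rfl⟩
    · apply hn
      rw [← Submodule.mem_bot F, ← h0]
      exact Submodule.subset_span (Or.inr ⟨a, ha, b, hb, rfl⟩)
  · exact h1.symm

def trRad (E : Submodule F (Matrix ι ι F)) : Submodule F (Matrix ι ι F) where
  carrier := {a | a ∈ E ∧ ∀ b ∈ E, (a * b).trace = 0}
  zero_mem' := ⟨zero_mem _, by simp⟩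
  add_mem' := fun ha hb => ⟨add_mem ha.1 hb.1, fun c hc => by
    rw [add_mul, Matrix.trace_add, ha.2 c hc, hb.2 c hc, add_zero]⟩
  smul_mem' := fun r a ha => ⟨E.smul_mem r ha.1, fun c hc => by
    rw [smul_mul_assoc, Matrix.trace_smul, ha.2 c hc, smul_zero]⟩

theorem Simp.n0 {E O : Submodule F (Matrix ι ι F)} (h : Simp E O) : trRad E = ⊥ := by
  set N := trRad E with hN
  have NE : ∀ a ∈ E, ∀ b ∈ N, a * b + b * a ∈ N := by
    rintro a ha b ⟨hb, hb'⟩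
    refine ⟨h.ee a ha b hb, fun c hc => ?_⟩
    have := hb' _ (h.ee a ha c hc)
    rw [mul_add, Matrix.trace_add] at this
    rw [add_mul, Matrix.trace_add, ← this, add_comm]
    congr 1
    · rw [mul_assoc]
    · rw [mul_assoc, Matrix.trace_mul_comm, mul_assoc]
  have NS : SqNilM N := by
    refine ⟨fun x hx => ?_, fun x hx => nil_of_rad h.ee hx.1 hx.2⟩
    apply JC.half
    rw [two_smul]
    exact NE x hx.1 x hx
  have xxE : ∀ x ∈ O, ∀ b ∈ E, x * x * b - b * (x * x) ∈ E := by
    intro x hx b hb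
    convert h.oo x hx _ (h.eo b hb x hx) using 1
    noncomm_ring
  have xxN : ∀ x ∈ O, ∀ a ∈ N, a * (x * x) - x * x * a ∈ N := by
    intro x hx a ha
    constructor
    · rw [← neg_sub]; exact neg_mem (xxE x hx a ha.1)
    · intro b hb
      have := ha.2 _ (xxE x hx b hb)
      rw [← this, sub_mul, mul_sub, Matrix.trace_sub, Matrix.trace_sub]
      congr 1
      · rw [mul_assoc]
      · rw [mul_assoc, Matrix.trace_mul_comm, mul_assoc]
  have C0 : ∀ x ∈ O, ∀ a ∈ N, ∀ t ∈ Algebra.adjoin F ((E : Set (Matrix ι ι F)) ∪ {x * x}),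
      (a * t).trace = 0 := by
    intro x hx
    apply jacM_tr N NS
    rintro s (hs | rfl) a ha
    · exact ⟨-a, neg_mem ha, _, NE s hs a ha, by noncomm_ring⟩
    · exact ⟨a, ha, _, xxN x hx a ha, by noncomm_ring⟩
  set S0 := Algebra.adjoin F (E : Set (Matrix ι ι F)) with hS0
  have C1 : ∀ x ∈ O, ∀ a ∈ N, ∀ s ∈ S0, ∀ s' ∈ S0, (s * a * s' * (x * x)).trace = 0 := by
    intro x hx a ha s hs s' hs'
    have hle : S0 ≤ Algebra.adjoin F ((E : Set (Matrix ι ι F)) ∪ {x * x}) :=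
      Algebra.adjoin_mono Set.subset_union_left
    have := C0 x hx a ha (s' * (x * x) * s) (mul_mem (mul_mem (hle hs')
      (Algebra.subset_adjoin (Or.inr rfl))) (hle hs))
    rw [← this, ← Matrix.trace_mul_comm]
    rw [Matrix.trace_mul_comm, mul_assoc s, mul_assoc s, Matrix.trace_mul_comm]
    simp only [mul_assoc]
  have C2 : ∀ x ∈ O, ∀ y ∈ O, ∀ a ∈ N, ∀ s ∈ S0, ∀ s' ∈ S0, (s * a * s' * (x * y)).trace = 0 := by
    intro x hx y hy a ha s hs s' hs'
    have h1 := C1 _ (add_mem hx hy) a ha s hs s' hs'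
    have h2 := C1 _ hx a ha s hs s' hs'
    have h3 := C1 _ hy a ha s hs s' hs'
    have h4 : (s * a * s' * (x * y - y * x)).trace = 0 := by
      have := jacM_tr N NS E (fun s hs a ha => ⟨-a, neg_mem ha, _, NE s hs a ha, by noncomm_ring⟩)
        a ha (s' * (x * y - y * x) * s) (mul_mem (mul_mem hs'
        (Algebra.subset_adjoin (h.oo x hx y hy))) hs)
      rw [← this, mul_assoc s, mul_assoc s, Matrix.trace_mul_comm]
      simp only [mul_assoc]
    have e : (2:F) • (s * a * s' * (x * y)) = s * a * s' * ((x+y)*(x+y)) - s * a * s' * (x*x)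
        - s * a * s' * (y*y) + s * a * s' * (x * y - y * x) := by
      rw [two_smul]; noncomm_ring
    have := congrArg Matrix.trace e
    rw [Matrix.trace_smul, Matrix.trace_add, Matrix.trace_sub, Matrix.trace_sub, h1, h2, h3, h4] at this
    simpa using this
  have SO : ∀ s ∈ S0, ∀ x ∈ O, x * s ∈ Submodule.span F {z | ∃ t ∈ S0, ∃ y ∈ O, z = t * y} := by
    intro s hs
    induction hs using Algebra.adjoin_induction with
    | mem b hb =>
      intro x hx
      have : x * b = 1 * (b * x + x * b) + (-b) * x := by noncomm_ring
      rw [this]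
      refine add_mem (Submodule.subset_span ⟨1, one_mem _, _, h.eo b hb x hx, rfl⟩)
        (Submodule.subset_span ⟨-b, neg_mem (Algebra.subset_adjoin hb), x, hx, rfl⟩)
    | algebraMap c =>
      intro x hx
      refine Submodule.subset_span ⟨algebraMap _ _ c, Subalgebra.algebraMap_mem _ _, x, hx, ?_⟩
      exact (Algebra.commutes c x).symm
    | add s t _ _ h1 h2 => intro x hx; rw [mul_add]; exact add_mem (h1 x hx) (h2 x hx)
    | mul s t _ _ h1 h2 =>
      intro x hx
      rw [← mul_assoc]
      have := h1 x hx
      generalize x * s = w at this ⊢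
      induction this using Submodule.span_induction with
      | mem z hz =>
        obtain ⟨t', ht', y, hy, rfl⟩ := hz
        rw [mul_assoc]
        have := h2 y hy
        generalize y * t = w at this ⊢
        induction this using Submodule.span_induction with
        | mem z hz =>
          obtain ⟨t2, ht2, y2, hy2, rfl⟩ := hz
          rw [← mul_assoc]
          exact Submodule.subset_span ⟨_, mul_mem ht' ht2, y2, hy2, rfl⟩
        | zero => simp
        | add a b _ _ ha hb => rw [mul_add]; exact add_mem ha hb
        | smul c a _ ha => rw [mul_smul_comm]; exact Submodule.smul_mem _ _ ha
      | zero => simp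
      | add a b _ _ ha hb => rw [add_mul]; exact add_mem ha hb
      | smul c a _ ha => rw [smul_mul_assoc]; exact Submodule.smul_mem _ _ ha
  have C3 : ∀ x ∈ O, ∀ y ∈ O, ∀ a ∈ N, ∀ s ∈ S0, ∀ s' ∈ S0, ∀ s'' ∈ S0,
      (s * a * s' * ((x * s'') * y)).trace = 0 := by
    intro x hx y hy a ha s hs s' hs' s'' hs''
    have := SO s'' hs'' x hx
    generalize x * s'' = w at this ⊢
    induction this using Submodule.span_induction with
    | mem z hz =>
      obtain ⟨t2, ht2, y2, hy2, rfl⟩ := hz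
      have := C2 y2 hy2 y hy a ha s hs (s' * t2) (mul_mem hs' ht2)
      rw [← this]
      simp only [mul_assoc]
    | zero => simp
    | add a b _ _ ha hb => rw [add_mul, mul_add, Matrix.trace_add, ha, hb, add_zero]
    | smul c a _ ha => rw [smul_mul_assoc, mul_smul_comm, Matrix.trace_smul, ha, smul_zero]
  let I1 : Submodule F (Matrix ι ι F) :=
    { carrier := {w | w ∈ O ∧ ∀ s ∈ S0, ∀ s' ∈ S0, ∀ y ∈ O, (s * w * (s' * y)).trace = 0}
      zero_mem' := ⟨zero_mem _, by simp⟩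
      add_mem' := fun ha hb => ⟨add_mem ha.1 hb.1, fun s hs s' hs' y hy => by
        rw [mul_add, add_mul, Matrix.trace_add, ha.2 s hs s' hs' y hy, hb.2 s hs s' hs' y hy, add_zero]⟩
      smul_mem' := fun r a ha => ⟨O.smul_mem r ha.1, fun s hs s' hs' y hy => by
        rw [mul_smul_comm, smul_mul_assoc, Matrix.trace_smul, ha.2 s hs s' hs' y hy, smul_zero]⟩ }
  have hid := h.simp N I1 (fun a ha => ha.1) (fun a ha => ha.1) NE ?_ ?_ ?_
  · rcases hid with ⟨h1, _⟩ | ⟨h1, _⟩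
    · exact h1
    · exfalso
      apply h.nt
      apply jacM_span N O NS
      rw [h1]
      exact h.span_odd.le
  · intro x hx a ha
    refine ⟨h.eo a ha.1 x hx, ?_⟩
    intro s hs s' hs' y hy
    have h1 := C3 x hx y hy a ha s hs 1 (one_mem _) s' hs'
    have h2 := C3 y hy x hx a ha 1 (one_mem _) s' hs' s hs
    have e : s * (a * x + x * a) * (s' * y) = s * a * 1 * ((x * s') * y) + (s * x) * (a * s' * y) := by
      noncomm_ring
    rw [e, Matrix.trace_add, h1, zero_add, Matrix.trace_mul_comm, ← h2]
    simp only [mul_assoc, one_mul]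
  · intro a ha w hw
    refine ⟨h.eo a ha w hw.1, ?_⟩
    intro s hs s' hs' y hy
    have haS : a ∈ S0 := Algebra.subset_adjoin ha
    have h1 := hw.2 (s * a) (mul_mem hs haS) s' hs' y hy
    have h2 := hw.2 s hs (a * s') (mul_mem haS hs') y hy
    have e : s * (a * w + w * a) * (s' * y) = s * a * w * (s' * y) + s * w * (a * s' * y) := by
      noncomm_ring
    rw [e, Matrix.trace_add, h1, h2, add_zero]
  · intro x hx w hw
    refine ⟨h.oo x hx w hw.1, ?_⟩
    intro b hb
    have hbS : b ∈ S0 := Algebra.subset_adjoin hb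
    have h1 := hw.2 1 (one_mem _) b hbS x hx
    have h2 := hw.2 b hbS 1 (one_mem _) x hx
    rw [sub_mul, Matrix.trace_sub, mul_assoc, Matrix.trace_mul_comm x, mul_assoc w x,
      Matrix.trace_mul_comm w]
    rw [one_mul] at h1 h2
    rw [← mul_assoc] at h1
    rw [h1, zero_sub, neg_eq_zero, ← h2, Matrix.trace_mul_comm (b * w), ← mul_assoc, mul_assoc]

end M
end SJ

open Matrix
namespace SJ
set_option linter.unusedSectionVars false
section T
variable {F : Type*} [Field F] {ι : Type*} [Fintype ι] [DecidableEq ι] [CharZero F]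
variable {E O : Submodule F (Matrix ι ι F)}

lemma JC.u (h : JC E) {a b : Matrix ι ι F} (ha : a ∈ E) (hb : b ∈ E) : a * b * a ∈ E := by
  apply JC.half
  have h1 := h a ha _ (h a ha b hb)
  have h2 := h _ (h.sq ha) b hb
  convert sub_mem h1 h2 using 1
  rw [two_smul]; noncomm_ring

lemma JC.tri (h : JC E) {a b c : Matrix ι ι F} (ha : a ∈ E) (hb : b ∈ E) (hc : c ∈ E) :
    a * b * c + c * b * a ∈ E := by
  convert sub_mem (sub_mem (h.u (add_mem ha hc) hb) (h.u ha hb)) (h.u hc hb) using 1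
  noncomm_ring

lemma Simp.uo (h : Simp E O) {a x : Matrix ι ι F} (ha : a ∈ E) (hx : x ∈ O) : a * x * a ∈ O := by
  apply JC.half
  have h1 := h.eo a ha _ (h.eo a ha x hx)
  have h2 := h.eo _ (h.ee.sq ha) x hx
  convert sub_mem h1 h2 using 1
  rw [two_smul]; noncomm_ring

lemma JC.u1 (h : JC E) {c b : Matrix ι ι F} (hc : c ∈ E) (hb : b ∈ E) :
    (1 + c) * b * (1 + c) ∈ E := by
  convert add_mem (add_mem hb (h c hc b hb)) (h.u hc hb) using 1
  noncomm_ring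

lemma Simp.u1o (h : Simp E O) {c b : Matrix ι ι F} (hc : c ∈ E) (hb : b ∈ O) :
    (1 + c) * b * (1 + c) ∈ O := by
  convert add_mem (add_mem hb (h.eo c hc b hb)) (h.uo hc hb) using 1
  noncomm_ring

lemma JC.um (h : JC E) {c b : Matrix ι ι F} (hc : c ∈ E) (hb : b ∈ E) :
    (1 - c) * b * (1 - c) ∈ E := by
  rw [sub_eq_add_neg]; exact h.u1 (neg_mem hc) hb

lemma Simp.umo (h : Simp E O) {c b : Matrix ι ι F} (hc : c ∈ E) (hb : b ∈ O) :
    (1 - c) * b * (1 - c) ∈ O := by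
  rw [sub_eq_add_neg]; exact h.u1o (neg_mem hc) hb

lemma aeval_comm (d : Matrix ι ι F) (Q : Polynomial F) :
    Polynomial.aeval d Q * d = d * Polynomial.aeval d Q := by
  have := congrArg (Polynomial.aeval d) (mul_comm Q Polynomial.X)
  rwa [map_mul, map_mul, Polynomial.aeval_X] at this

lemma tr_peirce {g d : Matrix ι ι F} (h1 : g * d = d) (h2 : d * g = d) (b : Matrix ι ι F) :
    (d * b).trace = (d * (g * b * g)).trace := by
  rw [← mul_assoc, ← mul_assoc, h2, Matrix.trace_mul_comm _ g, ← mul_assoc, h1]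

lemma inv_poly {D D' : Matrix ι ι F} (h : D * D' = 1) : ∃ Q : Polynomial F, D' = Polynomial.aeval D Q := by
  obtain ⟨P, Q, hP, hQ, h1, h2, h3⟩ := fitting D
  set e := Polynomial.aeval D P with he
  have hc : Commute (1 - e) D := by
    refine (Commute.one_left D).sub_left ?_
    rw [he]
    exact aeval_comm D P
  have hi : (1 - e) * (1 - e) = 1 - e := by
    rw [mul_sub, sub_mul, sub_mul, h1]; simp
  obtain ⟨k, hk⟩ := h2
  have hk' := hk
  rw [hc.mul_pow] at hk
  have hik : (1 - e) ^ (k+1) = 1 - e := by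
    have : IsIdempotentElem (1 - e) := hi
    exact this.pow_succ_eq k
  have : (1 - e) ^ (k) = 0 := by
    have hDk : D ^ k * D' ^ k = 1 := by
      have hcm : Commute D D' := by
        unfold Commute SemiconjBy
        rw [h, mul_eq_one_comm.1 h]
      rw [← hcm.mul_pow, h, one_pow]
    calc (1 - e)^k = (1-e)^k * (D ^ k * D' ^ k) := by rw [hDk, mul_one]
      _ = 0 := by rw [← mul_assoc, hk, zero_mul]
  rw [pow_succ, this, zero_mul] at hik
  have he1 : e = 1 := (sub_eq_zero.1 hik.symm).symm
  rw [he1] at h3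
  refine ⟨Q, ?_⟩
  calc D' = D' * (D * Polynomial.aeval D Q) := by rw [h3, mul_one]
    _ = _ := by rw [← mul_assoc, mul_eq_one_comm.1 h, one_mul]

lemma JC.inv (hE : JC E) {c D' : Matrix ι ι F} (hc : c ∈ E) (h : (1 + c) * D' = 1) : D' - 1 ∈ E := by
  obtain ⟨Q, hQ⟩ := inv_poly h
  have : D' - 1 = Polynomial.aeval c (-(Polynomial.X * Q.comp (1 + Polynomial.X))) := by
    have e : Polynomial.aeval c (Q.comp (1 + Polynomial.X)) = D' := by
      rw [Polynomial.aeval_comp, hQ]; simp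
    rw [map_neg, map_mul, e, Polynomial.aeval_X]
    rw [← h]; noncomm_ring
  rw [this]
  exact hE.aeval hc ((Dvd.intro _ rfl).neg_right)

lemma exists_eval_ne {q : Polynomial F} (hq : q ≠ 0) : ∃ t, q.eval t ≠ 0 := by
  by_contra hcon
  push Not at hcon
  exact hq (Polynomial.funext (fun t => by simp [hcon t]))

lemma generic_unit (c : Matrix ι ι F) : ∃ q : Polynomial F, q ≠ 0 ∧
    ∀ t, q.eval t ≠ 0 → ∃ D', (1 + t • c) * D' = 1 := by
  refine ⟨(1 + (Polynomial.X : Polynomial F) • c.map Polynomial.C).det, ?_, ?_⟩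
  · intro h
    have := congrArg (Polynomial.eval 0) h
    rw [← Polynomial.coe_evalRingHom, RingHom.map_det] at this
    have e : (Polynomial.evalRingHom (0:F)).mapMatrix (1 + (Polynomial.X : Polynomial F) • c.map Polynomial.C) = 1 := by
      rw [map_add, map_one]
      ext i j
      simp
    rw [e] at this
    simp at this
  · intro t ht
    rw [← Polynomial.coe_evalRingHom, RingHom.map_det] at ht
    have e : (Polynomial.evalRingHom t).mapMatrix (1 + (Polynomial.X : Polynomial F) • c.map Polynomial.C) = 1 + t • c := by
      rw [map_add, map_one]
      ext i j
      simp; ring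
    rw [e] at ht
    exact ⟨(1 + t • c)⁻¹, Matrix.mul_nonsing_inv _ (isUnit_iff_ne_zero.2 ht)⟩

/-- idempotent family -/
def IdFam (E : Submodule F (Matrix ι ι F)) (s : ℕ) (e : Fin s → Matrix ι ι F) : Prop :=
  (∀ i, e i ∈ E ∧ e i ≠ 0 ∧ e i * e i = e i) ∧ ∀ i j, i ≠ j → e i * e j = 0

lemma IdFam.le {s : ℕ} {e : Fin s → Matrix ι ι F} (h : IdFam E s e) :
    s ≤ Module.finrank F (Matrix ι ι F) := by
  have : LinearIndependent F e := by
    rw [Fintype.linearIndependent_iff]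
    intro g hg j
    have := congrArg (fun z => e j * z) hg
    simp only [Finset.mul_sum, mul_smul_comm, mul_zero] at this
    rw [Finset.sum_eq_single j (fun i _ hi => by rw [h.2 j i hi.symm, smul_zero]) (by simp), (h.1 j).2.2] at this
    exact (smul_eq_zero.1 this).resolve_right (h.1 j).2.1
  simpa using this.fintype_card_le_finrank

lemma IdFam.mul_sum {s : ℕ} {e : Fin s → Matrix ι ι F} (h : IdFam E s e) (j : Fin s) :
    e j * (∑ i, e i) = e j := by
  rw [Finset.mul_sum, Finset.sum_eq_single j (fun i _ hi => h.2 j i hi.symm) (by simp), (h.1 j).2.2]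

lemma IdFam.sum_mul {s : ℕ} {e : Fin s → Matrix ι ι F} (h : IdFam E s e) (j : Fin s) :
    (∑ i, e i) * e j = e j := by
  rw [Finset.sum_mul, Finset.sum_eq_single j (fun i _ hi => h.2 i j hi) (by simp), (h.1 j).2.2]

lemma IdFam.mem_sum {s : ℕ} {e : Fin s → Matrix ι ι F} (h : IdFam E s e) : (∑ i, e i) ∈ E :=
  sum_mem (fun i _ => (h.1 i).1)

lemma IdFam.sum_sq {s : ℕ} {e : Fin s → Matrix ι ι F} (h : IdFam E s e) :
    (∑ i, e i) * (∑ i, e i) = ∑ i, e i := by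
  conv_lhs => rw [Finset.sum_mul]
  exact Finset.sum_congr rfl (fun j _ => h.mul_sum j)

lemma IdFam.cons {s : ℕ} {e : Fin s → Matrix ι ι F} (h : IdFam E s e) {f : Matrix ι ι F}
    (hf : f ∈ E) (hf0 : f ≠ 0) (hff : f * f = f) (h1 : ∀ i, e i * f = 0) (h2 : ∀ i, f * e i = 0) :
    IdFam E (s+1) (Fin.cons f e : Fin (s+1) → Matrix ι ι F) := by
  constructor
  · intro i
    refine Fin.cases ?_ ?_ i
    · simpa using ⟨hf, hf0, hff⟩
    · intro i; simpa using h.1 i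
  · intro i j
    refine Fin.cases ?_ ?_ i
    · refine Fin.cases ?_ ?_ j
      · simp
      · intro j _; simpa using h2 j
    · intro i
      refine Fin.cases ?_ ?_ j
      · intro _; simpa using h1 i
      · intro j hij; simpa using h.2 i j (fun h => hij (by rw [h]))

lemma IdFam.update {s : ℕ} {e : Fin s → Matrix ι ι F} (h : IdFam E s e) (i : Fin s) {f : Matrix ι ι F}
    (hf : f ∈ E) (hf0 : f ≠ 0) (hff : f * f = f) (h1 : e i * f = f) (h2 : f * e i = f) :
    IdFam E s (Function.update e i f) := by
  constructor
  · intro j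
    by_cases hj : j = i
    · subst hj; simpa using ⟨hf, hf0, hff⟩
    · simpa [hj] using h.1 j
  · intro j k hjk
    by_cases hj : j = i
    · subst hj
      rw [Function.update_self, Function.update_of_ne hjk.symm, ← h2, mul_assoc, h.2 _ _ hjk, mul_zero]
    · rw [Function.update_of_ne hj]
      by_cases hk : k = i
      · subst hk
        rw [Function.update_self, ← h1, ← mul_assoc, h.2 _ _ hjk, zero_mul]
      · rw [Function.update_of_ne hk]; exact h.2 _ _ hjk

lemma poly_left {g c : Matrix ι ι F} (h : g * c = c) {P : Polynomial F} (hP : Polynomial.X ∣ P) :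
    g * Polynomial.aeval c P = Polynomial.aeval c P := by
  obtain ⟨Q, rfl⟩ := hP
  rw [map_mul, Polynomial.aeval_X, ← mul_assoc, h]

lemma poly_right {g c : Matrix ι ι F} (h : c * g = c) {P : Polynomial F} (hP : Polynomial.X ∣ P) :
    Polynomial.aeval c P * g = Polynomial.aeval c P := by
  obtain ⟨Q, rfl⟩ := hP
  rw [mul_comm Polynomial.X Q, map_mul, Polynomial.aeval_X, mul_assoc, h]

lemma tr_nil_pair {x y : Matrix ι ι F} (hx : IsNilpotent x) (hy : IsNilpotent y)
    (hxy : IsNilpotent (x + y)) : (x * y).trace = 0 := by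
  have sqn : ∀ z : Matrix ι ι F, IsNilpotent z → (z * z).trace = 0 := by
    intro z hz
    exact trace_nil ((Commute.refl z).isNilpotent_mul_left hz)
  have e : (x+y)*(x+y) = x * x + y * y + (x * y + y * x) := by noncomm_ring
  have := sqn _ hxy
  rw [e, Matrix.trace_add, Matrix.trace_add, sqn x hx, sqn y hy, Matrix.trace_add,
    Matrix.trace_mul_comm y x, ← two_mul] at this
  simpa using this

lemma mem_trRad {a : Matrix ι ι F} : a ∈ trRad E ↔ a ∈ E ∧ ∀ b ∈ E, (a * b).trace = 0 := Iff.rfl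

theorem exists_idfam [IsAlgClosed F] (hE : JC E) (hrad : trRad E = ⊥) :
    ∃ (s : ℕ) (e : Fin s → Matrix ι ι F), IdFam E s e ∧
      (∀ i, ∀ c ∈ E, ∃ t : F, e i * c * e i = t • e i) ∧
      (∀ c ∈ E, (1 - ∑ i, e i) * c * (1 - ∑ i, e i) = 0) := by
  have hrad' : ∀ a ∈ E, (∀ b ∈ E, (a * b).trace = 0) → a = 0 := by
    intro a ha hb
    have : a ∈ trRad E := ⟨ha, hb⟩
    rwa [hrad] at this
  have : ∃ s, (∃ e, IdFam E s e) ∧ ¬ ∃ e, IdFam E (s+1) e := by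
    by_contra hcon
    push Not at hcon
    have : ∀ s, ∃ e, IdFam E s e := by
      intro s
      induction s with
      | zero => exact ⟨fun i => i.elim0, ⟨fun i => i.elim0, fun i => i.elim0⟩⟩
      | succ s ih => exact hcon s ih
    obtain ⟨e, he⟩ := this (Module.finrank F (Matrix ι ι F) + 1)
    have := he.le
    omega
  obtain ⟨s, ⟨e, he⟩, hmax⟩ := this
  refine ⟨s, e, he, ?_, ?_⟩
  · intro i
    have hei := he.1 i
    set f := e i with hf
    have key : ∀ c ∈ E, f * c = c → c * f = c → ∃ t : F, IsNilpotent (c - t • f) := by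
      intro c hc h1 h2
      -- eigenvalue on the range of f
      have : ∃ t : F, ∃ v : ι → F, v ≠ 0 ∧ f *ᵥ v = v ∧ c *ᵥ v = t • v := by
        let W : Submodule F (ι → F) := LinearMap.range (Matrix.toLin' f)
        have hW : ∀ v ∈ W, Matrix.toLin' c v ∈ W := by
          intro v _
          refine ⟨c *ᵥ v, ?_⟩
          simp [h1]
        have hfW : ∀ v ∈ W, f *ᵥ v = v := by
          rintro _ ⟨v, rfl⟩
          simp [hei.2.2]
        have : Nontrivial W := by
          rw [Submodule.nontrivial_iff_ne_bot]
          intro h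
          rw [LinearMap.range_eq_bot] at h
          exact hei.2.1 (Matrix.toLin'.injective (by rw [h, map_zero]))
        obtain ⟨t, ht⟩ := Module.End.exists_eigenvalue ((Matrix.toLin' c).restrict hW)
        obtain ⟨v, hv⟩ := ht.exists_hasEigenvector
        refine ⟨t, v, fun h => hv.2 (Subtype.ext h), hfW v v.2, ?_⟩
        have := congrArg Subtype.val hv.apply_eq_smul
        simpa using this
      obtain ⟨t, v, hv0, hfv, hcv⟩ := this
      refine ⟨t, ?_⟩
      set d := c - t • f with hd
      have hdE : d ∈ E := sub_mem hc (E.smul_mem t hei.1)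
      have hd1 : f * d = d := by rw [hd, mul_sub, h1, mul_smul_comm, hei.2.2]
      have hd2 : d * f = d := by rw [hd, sub_mul, h2, smul_mul_assoc, hei.2.2]
      obtain ⟨P, Q, hP, hQ, p1, p2, p3⟩ := fitting d
      set p := Polynomial.aeval d P with hp
      have pE : p ∈ E := hE.aeval hdE hP
      have fp : f * p = p := poly_left hd1 hP
      have pf : p * f = p := poly_right hd2 hP
      have hpf : p ≠ f := by
        intro h
        have hcomm : Polynomial.aeval d Q * d = p := by
          rw [← p3]; exact aeval_comm d Q
        have hdv : d *ᵥ v = 0 := by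
          rw [hd, Matrix.sub_mulVec, hcv, Matrix.smul_mulVec, hfv, sub_self]
        apply hv0
        rw [← hfv, ← h, ← hcomm, ← Matrix.mulVec_mulVec, hdv, Matrix.mulVec_zero]
      have hp0 : p = 0 := by
        by_contra hp0
        apply hmax
        have hfp : (f - p) * (f - p) = f - p := by
          rw [mul_sub, sub_mul, sub_mul, hei.2.2, fp, pf, p1]; simp
        have hu := he.update i (f := f - p) (sub_mem hei.1 pE) (sub_ne_zero.2 hpf.symm) hfp
          (by rw [← hf, mul_sub, fp, hei.2.2]) (by rw [← hf, sub_mul, pf, hei.2.2])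
        refine ⟨_, hu.cons pE hp0 p1 ?_ ?_⟩
        · intro j
          by_cases hj : j = i
          · subst hj; rw [Function.update_self, sub_mul, fp, p1, sub_self]
          · rw [Function.update_of_ne hj, ← fp, ← mul_assoc, he.2 _ _ hj, zero_mul]
        · intro j
          by_cases hj : j = i
          · subst hj; rw [Function.update_self, mul_sub, pf, p1, sub_self]
          · rw [Function.update_of_ne hj, ← pf, mul_assoc, he.2 _ _ (Ne.symm hj), mul_zero]
      rw [hp0, sub_zero, one_mul] at p2
      exact p2
    have ftr : f.trace ≠ 0 := fun h => hei.2.1 (idem_tr_zero hei.2.2 h)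
    -- sums of nilpotents
    have keyadd : ∀ c ∈ E, f * c = c → c * f = c → IsNilpotent c →
        ∀ d ∈ E, f * d = d → d * f = d → IsNilpotent d → IsNilpotent (c + d) := by
      intro c hc c1 c2 c3 d hd d1 d2 d3
      obtain ⟨t, ht⟩ := key (c + d) (add_mem hc hd) (by rw [mul_add, c1, d1]) (by rw [add_mul, c2, d2])
      have := trace_nil ht
      rw [Matrix.trace_sub, Matrix.trace_add, trace_nil c3, trace_nil d3, Matrix.trace_smul] at this
      have t0 : t = 0 := by
        have : t * f.trace = 0 := by simpa using this
        exact (mul_eq_zero.1 this).resolve_right ftr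
      simpa [t0] using ht
    intro c hc
    have hc' : f * c * f ∈ E := hE.u hei.1 hc
    have c1 : f * (f * c * f) = f * c * f := by rw [← mul_assoc, ← mul_assoc, hei.2.2]
    have c2 : (f * c * f) * f = f * c * f := by rw [mul_assoc, hei.2.2]
    obtain ⟨t, ht⟩ := key _ hc' c1 c2
    refine ⟨t, sub_eq_zero.1 ?_⟩
    set d := f * c * f - t • f with hd
    have hdE : d ∈ E := sub_mem hc' (E.smul_mem t hei.1)
    have hd1 : f * d = d := by rw [hd, mul_sub, c1, mul_smul_comm, hei.2.2]
    have hd2 : d * f = d := by rw [hd, sub_mul, c2, smul_mul_assoc, hei.2.2]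
    apply hrad' d hdE
    intro b hb
    have hb' : f * b * f ∈ E := hE.u hei.1 hb
    have b1 : f * (f * b * f) = f * b * f := by rw [← mul_assoc, ← mul_assoc, hei.2.2]
    have b2 : (f * b * f) * f = f * b * f := by rw [mul_assoc, hei.2.2]
    obtain ⟨r, hr⟩ := key _ hb' b1 b2
    set d' := f * b * f - r • f with hd'
    have hdE' : d' ∈ E := sub_mem hb' (E.smul_mem r hei.1)
    have hd1' : f * d' = d' := by rw [hd', mul_sub, b1, mul_smul_comm, hei.2.2]
    have hd2' : d' * f = d' := by rw [hd', sub_mul, b2, smul_mul_assoc, hei.2.2]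
    have e1 : (d * b).trace = (d * (f * b * f)).trace := tr_peirce hd1 hd2 b
    have e2 : f * b * f = d' + r • f := by rw [hd']; simp
    rw [e1, e2, mul_add, Matrix.trace_add, tr_nil_pair ht hr (keyadd d hdE hd1 hd2 ht d' hdE' hd1' hd2' hr),
      mul_smul_comm, hd2, Matrix.trace_smul, trace_nil ht]
    simp
  · set u := ∑ i, e i with hu
    have huE : u ∈ E := he.mem_sum
    have hgg : (1 - u) * (1 - u) = 1 - u := by
      have := he.sum_sq
      rw [← hu] at this
      rw [mul_sub, sub_mul, sub_mul, this]; simp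
    have hne : ∀ c ∈ E, IsNilpotent ((1 - u) * c * (1 - u)) := by
      intro c hc
      have hc' := hE.um huE hc
      set d := (1 - u) * c * (1 - u) with hd
      obtain ⟨P, Q, hP, hQ, p1, p2, p3⟩ := fitting d
      have d1 : (1 - u) * d = d := by rw [hd, ← mul_assoc, ← mul_assoc, hgg]
      have d2 : d * (1 - u) = d := by rw [hd, mul_assoc, hgg]
      set p := Polynomial.aeval d P with hp
      have gp : (1 - u) * p = p := poly_left d1 hP
      have pg : p * (1 - u) = p := poly_right d2 hP
      have : p = 0 := by
        by_contra hp0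
        apply hmax
        refine ⟨_, he.cons (hE.aeval hc' hP) hp0 p1 ?_ ?_⟩
        · intro i
          rw [← hp, ← gp, ← mul_assoc, mul_sub, he.mul_sum, mul_one, sub_self, zero_mul]
        · intro i
          rw [← hp, ← pg, mul_assoc, sub_mul, he.sum_mul, one_mul, sub_self, mul_zero]
      rwa [this, sub_zero, one_mul] at p2
    intro c hc
    apply hrad' _ (hE.um huE hc)
    intro b hb
    have e1 : ((1 - u) * c * (1 - u) * b).trace =
        (((1 - u) * c * (1 - u)) * ((1 - u) * b * (1 - u))).trace := by
      exact tr_peirce (by rw [← mul_assoc, ← mul_assoc, hgg]) (by rw [mul_assoc, hgg]) b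
    rw [e1]
    apply tr_nil_pair (hne c hc) (hne b hb)
    have := hne _ (add_mem hc hb)
    rwa [mul_add, add_mul] at this

end T
end SJ

open Matrix
namespace SJ
set_option linter.unusedSectionVars false
section O
variable {F : Type*} [Field F] {ι : Type*} [Fintype ι] [DecidableEq ι]

structure OG (σ G : Matrix ι ι F) : Prop where
  ss : σ * σ = 1
  gg : G * G = σ
  gt : Gᵀ = G * σ
  st : σᵀ = σ

def bil (G : Matrix ι ι F) (a b : ι → F) : F := a ⬝ᵥ (G *ᵥ b)
def RR (G : Matrix ι ι F) (a b : ι → F) : Matrix ι ι F := vecMulVec a (b ᵥ* G)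

def JE (σ G : Matrix ι ι F) : Submodule F (Matrix ι ι F) where
  carrier := {a | σ * a = a * σ ∧ aᵀ * G = G * a}
  zero_mem' := by simp
  add_mem' := fun ha hb => ⟨by rw [mul_add, add_mul, ha.1, hb.1], by
    rw [transpose_add, add_mul, mul_add, ha.2, hb.2]⟩
  smul_mem' := fun r a ha => ⟨by rw [mul_smul_comm, smul_mul_assoc, ha.1], by
    rw [transpose_smul, smul_mul_assoc, mul_smul_comm, ha.2]⟩

def JO (σ G : Matrix ι ι F) : Submodule F (Matrix ι ι F) where
  carrier := {a | σ * a = - (a * σ) ∧ aᵀ * G = G * a * σ}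
  zero_mem' := by simp
  add_mem' := fun ha hb => ⟨by rw [mul_add, add_mul, ha.1, hb.1, neg_add], by
    rw [transpose_add, add_mul, mul_add, add_mul, ha.2, hb.2]⟩
  smul_mem' := fun r a ha => ⟨by rw [mul_smul_comm, smul_mul_assoc, ha.1, smul_neg], by
    rw [transpose_smul, smul_mul_assoc, mul_smul_comm, smul_mul_assoc, ha.2]⟩

def J00 (σ G : Matrix ι ι F) : Submodule F (Matrix ι ι F) where
  carrier := {a | (σ * a = a ∧ a * σ = a) ∧ aᵀ * G = G * a}
  zero_mem' := by simp
  add_mem' := fun ha hb => ⟨⟨by rw [mul_add, ha.1.1, hb.1.1], by rw [add_mul, ha.1.2, hb.1.2]⟩, by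
    rw [transpose_add, add_mul, mul_add, ha.2, hb.2]⟩
  smul_mem' := fun r a ha => ⟨⟨by rw [mul_smul_comm, ha.1.1], by rw [smul_mul_assoc, ha.1.2]⟩, by
    rw [transpose_smul, smul_mul_assoc, mul_smul_comm, ha.2]⟩

variable {σ G : Matrix ι ι F}

lemma bil_add_left (a b c : ι → F) : bil G (a + b) c = bil G a c + bil G b c := by simp [bil, add_dotProduct]
lemma bil_add_right (a b c : ι → F) : bil G a (b + c) = bil G a b + bil G a c := by
  simp [bil, mulVec_add, dotProduct_add]
lemma bil_sub_left (a b c : ι → F) : bil G (a - b) c = bil G a c - bil G b c := by simp [bil, sub_dotProduct]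
lemma bil_sub_right (a b c : ι → F) : bil G a (b - c) = bil G a b - bil G a c := by
  simp [bil, mulVec_sub, dotProduct_sub]
lemma bil_neg_left (a c : ι → F) : bil G (-a) c = - bil G a c := by simp [bil]
lemma bil_neg_right (a c : ι → F) : bil G a (-c) = - bil G a c := by simp [bil, mulVec_neg]
lemma bil_smul_left (r : F) (a c : ι → F) : bil G (r • a) c = r * bil G a c := by simp [bil]
lemma bil_smul_right (r : F) (a c : ι → F) : bil G a (r • c) = r * bil G a c := by simp [bil, mulVec_smul]
lemma bil_zero_left (c : ι → F) : bil G 0 c = 0 := by simp [bil]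
lemma bil_zero_right (c : ι → F) : bil G c 0 = 0 := by simp [bil]

lemma RR_mulVec (a b v : ι → F) : RR G a b *ᵥ v = bil G b v • a := by
  ext i
  simp [RR, bil, vecMulVec, mulVec, dotProduct, vecMul, Finset.mul_sum, Finset.sum_mul, mul_assoc]
  rw [Finset.sum_comm]
  exact Finset.sum_congr rfl fun j _ => Finset.sum_congr rfl fun k _ => by ring

lemma mul_RR (X : Matrix ι ι F) (a b : ι → F) : X * RR G a b = RR G (X *ᵥ a) b := by
  simp [RR, mul_vecMulVec]

lemma trace_RR (a b : ι → F) : (RR G a b).trace = bil G b a := by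
  simp [RR, bil, trace_vecMulVec]
  rw [dotProduct_comm, ← dotProduct_mulVec]

lemma RR_transpose (hG : OG σ G) (a b : ι → F) : (RR G a b)ᵀ * G = G * RR G (σ *ᵥ b) a := by
  have : (RR G a b)ᵀ = Gᵀ * vecMulVec b a := by
    rw [RR, transpose_vecMulVec, mul_vecMulVec, mulVec_transpose]
  rw [this, hG.gt, mul_RR, RR, mul_vecMulVec, vecMulVec_mul, mulVec_mulVec]

lemma OG.sg (h : OG σ G) : σ * G = G * σ := by rw [← h.gg, mul_assoc]

lemma bil_tr {X Y : Matrix ι ι F} (h : Xᵀ * G = G * Y) (v w : ι → F) :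
    bil G (X *ᵥ v) w = bil G v (Y *ᵥ w) := by
  rw [bil, bil, mulVec_mulVec, ← h, ← mulVec_mulVec, dotProduct_mulVec, dotProduct_mulVec,
    dotProduct_mulVec, vecMul_transpose]

lemma RR_mul_tr {X Y : Matrix ι ι F} (h : Yᵀ * G = G * X) (v w : ι → F) :
    RR G v w * X = RR G v (Y *ᵥ w) := by
  rw [RR, RR, vecMulVec_mul, vecMul_vecMul, ← h, ← vecMul_vecMul, vecMul_transpose]

lemma OG.sT (h : OG σ G) : σᵀ * G = G * σ := by rw [h.st, h.sg]

lemma JE.bil {X : Matrix ι ι F} (h : X ∈ JE σ G) (v w : ι → F) :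
    bil G (X *ᵥ v) w = bil G v (X *ᵥ w) := bil_tr h.2 v w
lemma OG.bils (h : OG σ G) (v w : ι → F) :
    bil G (σ *ᵥ v) w = bil G v (σ *ᵥ w) := bil_tr h.sT v w
lemma JO.bil {X : Matrix ι ι F} (h : X ∈ JO σ G) (v w : ι → F) :
    bil G (X *ᵥ v) w = bil G v (X *ᵥ (σ *ᵥ w)) := by
  rw [bil_tr (h.2.trans (mul_assoc _ _ _)) v w, mulVec_mulVec]
lemma OG.swap (h : OG σ G) (a b : ι → F) : bil G b a = bil G a (σ *ᵥ b) := by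
  rw [SJ.bil, SJ.bil, mulVec_mulVec, ← h.gt, dotProduct_mulVec, mulVec_transpose, dotProduct_comm]

lemma RR_mul_JE {X : Matrix ι ι F} (h : X ∈ JE σ G) (v w : ι → F) :
    RR G v w * X = RR G v (X *ᵥ w) := RR_mul_tr h.2 v w
lemma RR_mul_s (h : OG σ G) (v w : ι → F) : RR G v w * σ = RR G v (σ *ᵥ w) := RR_mul_tr h.sT v w
lemma RR_mul_JO (hG : OG σ G) {X : Matrix ι ι F} (h : X ∈ JO σ G) (v w : ι → F) :
    RR G v w * X = RR G v (σ *ᵥ (X *ᵥ w)) := by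
  rw [mulVec_mulVec]
  refine RR_mul_tr ?_ v w
  rw [transpose_mul, hG.st, mul_assoc, hG.sg, ← mul_assoc, h.2, mul_assoc, hG.ss, mul_one]

lemma OG.nd_right (h : OG σ G) {a : ι → F} (ha : ∀ v, bil G v a = 0) : a = 0 := by
  have h1 : G *ᵥ a = 0 := by
    ext i
    have := ha (Pi.single i 1)
    simpa [SJ.bil] using this
  have : (σ * G * G) *ᵥ a = 0 := by rw [← mulVec_mulVec, h1, mulVec_zero]
  rwa [mul_assoc, h.gg, h.ss, one_mulVec] at this

lemma OG.inv (h : OG σ G) (a : ι → F) : σ *ᵥ (σ *ᵥ a) = a := by rw [mulVec_mulVec, h.ss, one_mulVec]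

lemma OG.nd_left (h : OG σ G) {a : ι → F} (ha : ∀ v, bil G a v = 0) : a = 0 :=
  h.nd_right fun v => by rw [h.swap, ha]

lemma RR_add_left (a b c : ι → F) : RR G (a + b) c = RR G a c + RR G b c := by simp [RR, add_vecMulVec]
lemma RR_add_right (a b c : ι → F) : RR G a (b + c) = RR G a b + RR G a c := by
  simp [RR, add_vecMul, vecMulVec_add]
lemma RR_smul_left (r : F) (a b : ι → F) : RR G (r • a) b = r • RR G a b := by simp [RR, smul_vecMulVec]
lemma RR_smul_right (r : F) (a b : ι → F) : RR G a (r • b) = r • RR G a b := by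
  simp [RR, smul_vecMul, vecMulVec_smul]
lemma RR_neg_left (a b : ι → F) : RR G (-a) b = - RR G a b := by
  rw [← neg_one_smul F a, RR_smul_left, neg_one_smul]
lemma RR_neg_right (a b : ι → F) : RR G a (-b) = - RR G a b := by
  rw [← neg_one_smul F b, RR_smul_right, neg_one_smul]
lemma RR_mul_RR (a b c d : ι → F) : RR G a b * RR G c d = bil G b c • RR G a d := by
  rw [mul_RR, RR_mulVec, RR_smul_left]

lemma RR_ne (h : OG σ G) {a b : ι → F} (ha : a ≠ 0) (hb : b ≠ 0) : RR G a b ≠ 0 := by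
  intro h0
  apply hb
  apply h.nd_left
  intro v
  have := RR_mulVec (G := G) a b v
  rw [h0, zero_mulVec] at this
  exact (smul_eq_zero.1 this.symm).resolve_right ha

lemma RR_JE_ev (hG : OG σ G) {a b : ι → F} (ha : σ *ᵥ a = a) (hb : σ *ᵥ b = b) :
    RR G a b + RR G b a ∈ JE σ G := by
  constructor
  · rw [mul_add, add_mul, mul_RR, mul_RR, RR_mul_s hG, RR_mul_s hG, ha, hb]
  · rw [transpose_add, add_mul, mul_add, RR_transpose hG, RR_transpose hG, ha, hb, add_comm]

lemma RR_J00 (hG : OG σ G) {a b : ι → F} (ha : σ *ᵥ a = a) (hb : σ *ᵥ b = b) :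
    RR G a b + RR G b a ∈ J00 σ G := by
  refine ⟨⟨?_, ?_⟩, (RR_JE_ev hG ha hb).2⟩
  · rw [mul_add, mul_RR, mul_RR, ha, hb]
  · rw [add_mul, RR_mul_s hG, RR_mul_s hG, ha, hb]

lemma RR_J00' (hG : OG σ G) {a : ι → F} (ha : σ *ᵥ a = a) : RR G a a ∈ J00 σ G := by
  refine ⟨⟨?_, ?_⟩, ?_⟩
  · rw [mul_RR, ha]
  · rw [RR_mul_s hG, ha]
  · rw [RR_transpose hG, ha]

lemma RR_JE_od (hG : OG σ G) {a b : ι → F} (ha : σ *ᵥ a = -a) (hb : σ *ᵥ b = -b) :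
    RR G a b - RR G b a ∈ JE σ G := by
  constructor
  · rw [mul_sub, sub_mul, mul_RR, mul_RR, RR_mul_s hG, RR_mul_s hG, ha, hb]
    simp [RR_neg_left, RR_neg_right]
  · rw [transpose_sub, sub_mul, mul_sub, RR_transpose hG, RR_transpose hG, ha, hb]
    simp only [RR_neg_left, mul_neg]; abel

lemma RR_JO (hG : OG σ G) {a b : ι → F} (ha : σ *ᵥ a = a) (hb : σ *ᵥ b = -b) :
    RR G a b - RR G b a ∈ JO σ G := by
  constructor
  · rw [mul_sub, sub_mul, mul_RR, mul_RR, RR_mul_s hG, RR_mul_s hG, ha, hb]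
    simp only [RR_neg_left, RR_neg_right]; abel
  · rw [transpose_sub, sub_mul, RR_transpose hG, RR_transpose hG, mul_assoc, sub_mul, RR_mul_s hG, RR_mul_s hG, ha, hb]
    simp only [RR_neg_left, RR_neg_right, mul_neg, mul_sub]; abel

lemma J00_le : J00 σ G ≤ JE σ G := fun _ ha => ⟨ha.1.1.trans ha.1.2.symm, ha.2⟩

lemma one_JE : (1 : Matrix ι ι F) ∈ JE σ G := ⟨by simp, by simp⟩
lemma sig_JE (hG : OG σ G) : σ ∈ JE σ G := ⟨rfl, hG.sT⟩

lemma JE_mul {a b : Matrix ι ι F} (ha : a ∈ JE σ G) (hb : b ∈ JE σ G) (hc : a * b = b * a) :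
    a * b ∈ JE σ G :=
  ⟨by rw [← mul_assoc, ha.1, mul_assoc, hb.1, mul_assoc], by
    rw [transpose_mul, mul_assoc, ha.2, ← mul_assoc, hb.2, mul_assoc, hc]⟩

variable [CharZero F]

lemma eq_zero_of_neg_self {a : F} (h : a = -a) : a = 0 := by
  have : (2 : F) * a = 0 := by linear_combination h
  simpa using this

lemma vec_zero_of_neg_self {a : ι → F} (h : a = -a) : a = 0 := by
  ext i; exact eq_zero_of_neg_self (congrFun h i)

lemma OG.orth (h : OG σ G) {a b : ι → F} (ha : σ *ᵥ a = a) (hb : σ *ᵥ b = -b) : bil G a b = 0 := by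
  apply eq_zero_of_neg_self
  rw [← bil_neg_right, ← hb, ← h.bils, ha]

lemma OG.orth' (h : OG σ G) {a b : ι → F} (ha : σ *ᵥ a = -a) (hb : σ *ᵥ b = b) : bil G a b = 0 := by
  rw [h.swap, ha, bil_neg_right, h.orth hb ha, neg_zero]

lemma OG.split (h : OG σ G) (v : ι → F) : ∃ a b, σ *ᵥ a = a ∧ σ *ᵥ b = -b ∧ v = a + b := by
  refine ⟨(2⁻¹ : F) • (v + σ *ᵥ v), (2⁻¹ : F) • (v - σ *ᵥ v), ?_, ?_, ?_⟩
  · rw [mulVec_smul, mulVec_add, h.inv, add_comm]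
  · rw [mulVec_smul, mulVec_sub, h.inv, ← smul_neg, neg_sub]
  · rw [← smul_add]; ext i; simp; ring

lemma OG.nd_ev (h : OG σ G) {a : ι → F} (ha : σ *ᵥ a = a) (h0 : ∀ v, σ *ᵥ v = v → bil G v a = 0) : a = 0 := by
  apply h.nd_right
  intro v
  obtain ⟨x, y, hx, hy, rfl⟩ := h.split v
  rw [bil_add_left, h0 x hx, h.orth' hy ha, add_zero]

lemma OG.nd_od (h : OG σ G) {a : ι → F} (ha : σ *ᵥ a = -a) (h0 : ∀ v, σ *ᵥ v = -v → bil G v a = 0) : a = 0 := by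
  apply h.nd_right
  intro v
  obtain ⟨x, y, hx, hy, rfl⟩ := h.split v
  rw [bil_add_left, h0 y hy, h.orth hx ha, add_zero]

lemma JE.ev {X : Matrix ι ι F} (hX : X ∈ JE σ G) {v : ι → F} (hv : σ *ᵥ v = v) :
    σ *ᵥ (X *ᵥ v) = X *ᵥ v := by rw [mulVec_mulVec, hX.1, ← mulVec_mulVec, hv]
lemma JE.od {X : Matrix ι ι F} (hX : X ∈ JE σ G) {v : ι → F} (hv : σ *ᵥ v = -v) :
    σ *ᵥ (X *ᵥ v) = -(X *ᵥ v) := by rw [mulVec_mulVec, hX.1, ← mulVec_mulVec, hv, mulVec_neg]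
lemma JO.ev {X : Matrix ι ι F} (hX : X ∈ JO σ G) {v : ι → F} (hv : σ *ᵥ v = v) :
    σ *ᵥ (X *ᵥ v) = -(X *ᵥ v) := by rw [mulVec_mulVec, hX.1, neg_mulVec, ← mulVec_mulVec, hv]
lemma JO.od {X : Matrix ι ι F} (hX : X ∈ JO σ G) {v : ι → F} (hv : σ *ᵥ v = -v) :
    σ *ᵥ (X *ᵥ v) = X *ᵥ v := by
  rw [mulVec_mulVec, hX.1, neg_mulVec, ← mulVec_mulVec, hv, mulVec_neg, neg_neg]

lemma JO_eq_zero (h : OG σ G) {X : Matrix ι ι F} (hX : X ∈ JO σ G)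
    (h0 : ∀ v, σ *ᵥ v = v → X *ᵥ v = 0) : X = 0 := by
  apply ext_of_mulVec_single
  intro i
  rw [zero_mulVec]
  obtain ⟨x, y, hx, hy, hv⟩ := h.split (Pi.single i 1)
  rw [hv, mulVec_add, h0 x hx, zero_add]
  apply h.nd_ev (JO.od hX hy)
  intro v hv
  have := JO.bil hX v (σ *ᵥ y)
  rw [h.inv, h0 v hv, bil_zero_left] at this
  exact this.symm

lemma J_ev_onto (hG : OG σ G) {v : ι → F} (hv : σ *ᵥ v = v) (h0 : v ≠ 0) (a : ι → F) (ha : σ *ᵥ a = a) :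
    ∃ j ∈ J00 σ G, j *ᵥ v = a := by
  obtain ⟨u, hu, hu1⟩ : ∃ u, σ *ᵥ u = u ∧ bil G u v ≠ 0 := by
    by_contra hc
    push Not at hc
    exact h0 (hG.nd_ev hv hc)
  refine ⟨(bil G u v)⁻¹ • ((RR G a u + RR G u a) - (bil G a v * (bil G u v)⁻¹) • (RR G u u)), ?_, ?_⟩
  · exact Submodule.smul_mem _ _ (Submodule.sub_mem _ (RR_J00 hG ha hu) (Submodule.smul_mem _ _ (RR_J00' hG hu)))
  · simp only [smul_mulVec, sub_mulVec, add_mulVec, RR_mulVec]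
    ext i; simp; field_simp; ring
end O
end SJ

open Matrix
namespace SJ
set_option linter.unusedSectionVars false
section B
variable {F : Type*} [Field F] 

lemma SMat_t (q : ℕ) : (SMat F q)ᵀ = - SMat F q := by
  ext i j
  simp only [SMat, transpose_apply, of_apply, Matrix.neg_apply]
  have hi := i.2
  have hj := j.2
  split_ifs <;> first | omega | simp

lemma SMat_sq (q : ℕ) : SMat F q * SMat F q = -1 := by
  ext i j
  rw [mul_apply]
  have hi := i.2
  have hj := j.2
  by_cases h : (i : ℕ) < q
  · rw [Finset.sum_eq_single (⟨i + q, by omega⟩ : Fin (2 * q))]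
    · simp only [SMat, of_apply, Matrix.neg_apply, Matrix.one_apply, Fin.ext_iff]
      split_ifs <;> first | omega | simp
    · intro k _ hk
      have : (k : ℕ) ≠ i + q := fun h => hk (Fin.ext h)
      have hk := k.2
      simp only [SMat, of_apply]
      split_ifs <;> first | omega | simp
    · simp
  · rw [Finset.sum_eq_single (⟨i - q, by omega⟩ : Fin (2 * q))]
    · simp only [SMat, of_apply, Matrix.neg_apply, Matrix.one_apply, Fin.ext_iff]
      split_ifs <;> first | omega | simp
    · intro k _ hk
      have : (k : ℕ) ≠ i - q := fun h => hk (Fin.ext h)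
      have hk := k.2
      simp only [SMat, of_apply]
      split_ifs <;> first | omega | simp
    · simp

variable (F) in
def sg (n m : ℕ) : MJ F n m := fromBlocks 1 0 0 (-1)
variable (F) in
def gM (n m : ℕ) : MJ F n (2 * m) := fromBlocks 1 0 0 (SMat F m)

lemma og (n m : ℕ) : OG (sg F n (2 * m)) (gM F n m) where
  ss := by simp [sg, fromBlocks_multiply, fromBlocks_one]
  gg := by simp [sg, gM, fromBlocks_multiply, SMat_sq]
  gt := by simp [sg, gM, fromBlocks_multiply, fromBlocks_transpose, SMat_t]
  st := by simp [sg, fromBlocks_transpose]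

lemma sg_diag (n m : ℕ) : sg F n m = diagonal (fun i => if pty i then (-1 : F) else 1) := by
  ext i j
  rcases i with i | i <;> rcases j with j | j <;> simp [sg, pty, diagonal, Matrix.one_apply, apply_ite]

variable [CharZero F]

lemma ev_iff {n m : ℕ} (X : MJ F n m) : X ∈ evenSub F n m ↔ sg F n m * X = X * sg F n m := by
  constructor
  · intro h
    ext i j
    rw [sg_diag, diagonal_mul, mul_diagonal]
    by_cases hp : pty i = pty j
    · rw [hp, mul_comm]
    · rw [h i j hp, zero_mul, mul_zero]
  · intro h i j hp
    have := congrFun (congrFun h i) j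
    rw [sg_diag, diagonal_mul, mul_diagonal] at this
    apply eq_zero_of_neg_self
    cases hi : pty i <;> cases hj : pty j <;> rw [hi, hj] at hp this <;> simp at hp this <;>
      first | exact this | exact this.symm

lemma od_iff {n m : ℕ} (X : MJ F n m) : X ∈ oddSub F n m ↔ sg F n m * X = -(X * sg F n m) := by
  constructor
  · intro h
    ext i j
    rw [Matrix.neg_apply, sg_diag, diagonal_mul, mul_diagonal]
    by_cases hp : pty i = pty j
    · rw [h i j hp, zero_mul, mul_zero, neg_zero]
    · cases hi : pty i <;> cases hj : pty j <;> simp_all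
  · intro h i j hp
    have := congrFun (congrFun h i) j
    rw [Matrix.neg_apply, sg_diag, diagonal_mul, mul_diagonal] at this
    apply eq_zero_of_neg_self
    cases hi : pty i <;> cases hj : pty j <;> rw [hi, hj] at hp this <;> simp at hp this <;>
      first | exact this | exact this.symm

lemma osp_ev {n m : ℕ} (X : MJ F n (2 * m)) :
    X ∈ JE (sg F n (2 * m)) (gM F n m) ↔ X ∈ ospSub F n m ∧ X ∈ evenSub F n (2 * m) := by
  rw [ev_iff]
  refine ⟨fun ⟨h1, h2⟩ => ⟨?_, h1⟩, fun ⟨h2, h1⟩ => ⟨h1, ?_⟩⟩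
  · rw [← fromBlocks_toBlocks X] at h1 h2
    simp only [sg, gM, fromBlocks_transpose, fromBlocks_multiply, fromBlocks_inj] at h1 h2
    simp at h1 h2
    have e1 : X.toBlocks₁₂ = 0 := by ext i j; exact eq_zero_of_neg_self (congrFun (congrFun h1.1 i) j)
    have e2 : X.toBlocks₂₁ = 0 := by ext i j; exact eq_zero_of_neg_self (congrFun (congrFun h1.2.symm i) j)
    exact ⟨h2.1, by rw [e1, e2]; simp, h2.2.2.2⟩
  · obtain ⟨a, b, d⟩ := h2
    rw [← fromBlocks_toBlocks X] at h1 ⊢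
    simp only [sg, gM, fromBlocks_transpose, fromBlocks_multiply, fromBlocks_inj] at h1 ⊢
    simp at h1 ⊢
    have e1 : X.toBlocks₁₂ = 0 := by ext i j; exact eq_zero_of_neg_self (congrFun (congrFun h1.1 i) j)
    have e2 : X.toBlocks₂₁ = 0 := by ext i j; exact eq_zero_of_neg_self (congrFun (congrFun h1.2.symm i) j)
    rw [e1, e2]
    simp [a, d]

lemma neg_self_mat {a b : Type*} {X : Matrix a b F} (h : -X = X) : X = 0 := by
  ext i j; exact eq_zero_of_neg_self (congrFun (congrFun h.symm i) j)

lemma osp_od {n m : ℕ} (X : MJ F n (2 * m)) :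
    X ∈ JO (sg F n (2 * m)) (gM F n m) ↔ X ∈ ospSub F n m ∧ X ∈ oddSub F n (2 * m) := by
  rw [od_iff]
  refine ⟨fun ⟨h1, h2⟩ => ⟨?_, h1⟩, fun ⟨h2, h1⟩ => ⟨h1, ?_⟩⟩
  · rw [← fromBlocks_toBlocks X] at h1 h2
    simp only [sg, gM, fromBlocks_transpose, fromBlocks_multiply, fromBlocks_inj, fromBlocks_neg] at h1 h2
    simp at h1 h2
    have e1 : X.toBlocks₁₁ = 0 := neg_self_mat h1.1.symm
    have e2 : X.toBlocks₂₂ = 0 := neg_self_mat h1.2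
    exact ⟨by rw [e1]; simp, h2.2.2.1.symm, by rw [e2]; simp⟩
  · obtain ⟨a, b, d⟩ := h2
    rw [← fromBlocks_toBlocks X] at h1 ⊢
    simp only [sg, gM, fromBlocks_transpose, fromBlocks_multiply, fromBlocks_inj, fromBlocks_neg] at h1 ⊢
    simp at h1 ⊢
    have e1 : X.toBlocks₁₁ = 0 := neg_self_mat h1.1.symm
    have e2 : X.toBlocks₂₂ = 0 := neg_self_mat h1.2
    rw [e1, e2]
    have b2 := congrArg transpose b
    rw [transpose_mul, SMat_t, transpose_transpose] at b2
    simp [b, ← b2]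

lemma jmul_ev {n m : ℕ} {X Y : MJ F n m} (h : X ∈ evenSub F n m ∨ Y ∈ evenSub F n m) :
    jmul X Y = (2⁻¹ : F) • (X * Y + Y * X) := by
  have key : ∀ X ∈ evenSub F n m, oddPart F X = 0 := by
    intro X hX
    ext i j
    simp only [oddPart, of_apply, Matrix.zero_apply]
    split_ifs with h
    · rfl
    · exact hX i j h
  rcases h with h | h <;> simp [jmul, key _ h]

lemma jmul_od {n m : ℕ} {X Y : MJ F n m} (h : X ∈ oddSub F n m) (h' : Y ∈ oddSub F n m) :
    jmul X Y = (2⁻¹ : F) • (X * Y - Y * X) := by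
  have key : ∀ X ∈ oddSub F n m, oddPart F X = X := by
    intro X hX
    ext i j
    simp only [oddPart, of_apply]
    split_ifs with h
    · rw [hX i j h]
    · rfl
  rw [jmul, key _ h, key _ h']
  ext i j; simp; ring

lemma ev_od_zero {n m : ℕ} {X : MJ F n m} (h : X ∈ evenSub F n m) (h' : X ∈ oddSub F n m) : X = 0 := by
  ext i j
  by_cases hp : pty i = pty j
  · exact h' i j hp
  · exact h i j hp

lemma jmul_add_left {n m : ℕ} (X X' Y : MJ F n m) : jmul (X + X') Y = jmul X Y + jmul X' Y := by
  have : oddPart F (X + X') = oddPart F X + oddPart F X' := by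
    ext i j; simp only [oddPart, of_apply, Matrix.add_apply]; split_ifs <;> simp
  simp only [jmul, this]
  rw [mul_add, add_mul, mul_add]; module
lemma jmul_add_right {n m : ℕ} (X Y Y' : MJ F n m) : jmul X (Y + Y') = jmul X Y + jmul X Y' := by
  have : oddPart F (Y + Y') = oddPart F Y + oddPart F Y' := by
    ext i j; simp only [oddPart, of_apply, Matrix.add_apply]; split_ifs <;> simp
  simp only [jmul, this]
  rw [mul_add, add_mul, add_mul]; module

lemma mem_of_half {V : Type*} [AddCommGroup V] [Module F V] {S : Submodule F V} {v : V} (h : (2⁻¹ : F) • v ∈ S) : v ∈ S := by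
  have := S.smul_mem 2 h
  rwa [smul_smul, mul_inv_cancel₀ two_ne_zero, one_smul] at this

lemma gr_split {n m : ℕ} {A : Submodule F (MJ F n m)} (h : IsGraded F A) {x : MJ F n m} (hx : x ∈ A) :
    ∃ a ∈ A ⊓ evenSub F n m, ∃ b ∈ A ⊓ oddSub F n m, a + b = x := by
  rw [h] at hx
  exact Submodule.mem_sup.1 hx

lemma simp_of {n m : ℕ} {A : Submodule F (MJ F n m)} (h1 : IsSubalg F A) (h2 : Nontriv F A)
    (h3 : IsSimple F A) : Simp (A ⊓ evenSub F n m) (A ⊓ oddSub F n m) where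
  ee := by
    rintro a ⟨ha, ha'⟩ b ⟨hb, hb'⟩
    refine ⟨mem_of_half (F := F) ?_, ?_⟩
    · rw [← jmul_ev (Or.inl ha')]; exact h1.2 a ha b hb
    · rw [SetLike.mem_coe, ev_iff] at *
      rw [mul_add, add_mul, ← mul_assoc, ← mul_assoc, ha', hb', mul_assoc, mul_assoc, ha', hb', mul_assoc, mul_assoc]
  eo := by
    rintro a ⟨ha, ha'⟩ b ⟨hb, hb'⟩
    refine ⟨mem_of_half (F := F) ?_, ?_⟩
    · rw [← jmul_ev (Or.inl ha')]; exact h1.2 a ha b hb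
    · rw [SetLike.mem_coe, od_iff] at *
      rw [ev_iff] at ha'
      rw [mul_add, add_mul, ← mul_assoc, ← mul_assoc, ha', hb', mul_assoc, neg_mul, mul_assoc b, ha', hb']
      noncomm_ring
  oo := by
    rintro a ⟨ha, ha'⟩ b ⟨hb, hb'⟩
    refine ⟨mem_of_half (F := F) ?_, ?_⟩
    · rw [← jmul_od ha' hb']; exact h1.2 a ha b hb
    · rw [SetLike.mem_coe, ev_iff]
      rw [SetLike.mem_coe, od_iff] at *
      rw [mul_sub, sub_mul, ← mul_assoc, ← mul_assoc, ha', hb', neg_mul, neg_mul, mul_assoc, mul_assoc, ha', hb']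
      noncomm_ring
  simp := by
    intro I0 I1 l0 l1 c1 c2 c3 c4
    have e0 : (I0 ⊔ I1) ⊓ evenSub F n m = I0 := by
      apply le_antisymm
      · rintro x ⟨hx, hx'⟩
        obtain ⟨a, ha, b, hb, rfl⟩ := Submodule.mem_sup.1 hx
        have : b = 0 := ev_od_zero (by simpa using Submodule.sub_mem _ hx' (l0 ha).2) (l1 hb).2
        rwa [this, add_zero]
      · exact le_inf le_sup_left (l0.trans inf_le_right)
    have e1 : (I0 ⊔ I1) ⊓ oddSub F n m = I1 := by
      apply le_antisymm
      · rintro x ⟨hx, hx'⟩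
        obtain ⟨a, ha, b, hb, rfl⟩ := Submodule.mem_sup.1 hx
        have : a = 0 := ev_od_zero (l0 ha).2 (by simpa using Submodule.sub_mem _ hx' (l1 hb).2)
        rwa [this, zero_add]
      · exact le_inf le_sup_right (l1.trans inf_le_right)
    rcases h3.2 (I0 ⊔ I1) (sup_le (l0.trans inf_le_left) (l1.trans inf_le_left))
      (by rw [IsGradedG, e0, e1]) (by
        intro x hx y hy
        obtain ⟨a, ha, b, hb, rfl⟩ := gr_split h1.1 hx
        obtain ⟨c, hc, d, hd, rfl⟩ := Submodule.mem_sup.1 hy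
        rw [jmul_add_left, jmul_add_right, jmul_add_right, jmul_ev (Or.inl ha.2), jmul_ev (Or.inl ha.2),
          jmul_ev (Or.inr (l0 hc).2), jmul_od hb.2 (l1 hd).2]
        refine Submodule.add_mem _ (Submodule.add_mem _ ?_ ?_) (Submodule.add_mem _ ?_ ?_) <;>
          apply Submodule.smul_mem
        · exact Submodule.mem_sup_left (c1 a ha c hc)
        · exact Submodule.mem_sup_right (c3 a ha d hd)
        · rw [add_comm]; exact Submodule.mem_sup_right (c2 b hb c hc)
        · exact Submodule.mem_sup_left (c4 b hb d hd)) with h | h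
    · left
      rw [h] at e0 e1
      simp at e0 e1
      exact ⟨e0.symm, e1.symm⟩
    · right
      rw [h] at e0 e1
      exact ⟨e0.symm, e1.symm⟩
  nt := h2
  pr := by
    obtain ⟨x, hx, y, hy, hxy⟩ := h3.1
    obtain ⟨a, ha, b, hb, rfl⟩ := gr_split h1.1 hx
    obtain ⟨c, hc, d, hd, rfl⟩ := gr_split h1.1 hy
    by_contra hcon
    push Not at hcon
    obtain ⟨q1, q2, q3⟩ := hcon
    apply hxy
    rw [jmul_add_left, jmul_add_right, jmul_add_right, jmul_ev (Or.inl ha.2), jmul_ev (Or.inl ha.2),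
          jmul_ev (Or.inr hc.2), jmul_od hb.2 hd.2, q1 a ha c hc, q2 a ha d hd, q3 b hb d hd,
          add_comm (b * c), q2 c hc b hb]
    simp

lemma sup_ev {n m : ℕ} {A B : Submodule F (MJ F n (2 * m))} (hA : IsSubalg F A) (hB : IsSubalg F B)
    (h : A ⊔ B = ospSub F n m) :
    (A ⊓ evenSub F n (2 * m)) ⊔ (B ⊓ evenSub F n (2 * m)) = JE (sg F n (2 * m)) (gM F n m) ∧
    (A ⊓ oddSub F n (2 * m)) ⊔ (B ⊓ oddSub F n (2 * m)) = JO (sg F n (2 * m)) (gM F n m) := by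
  have hAl : A ≤ ospSub F n m := h ▸ le_sup_left
  have hBl : B ≤ ospSub F n m := h ▸ le_sup_right
  constructor
  · apply le_antisymm
    · refine sup_le ?_ ?_
      · exact fun x hx => (osp_ev x).2 ⟨hAl hx.1, hx.2⟩
      · exact fun x hx => (osp_ev x).2 ⟨hBl hx.1, hx.2⟩
    · intro x hx
      obtain ⟨h1, h2⟩ := (osp_ev x).1 hx
      rw [← h] at h1
      obtain ⟨a, ha, b, hb, rfl⟩ := Submodule.mem_sup.1 h1
      obtain ⟨a0, ha0, a1, ha1, rfl⟩ := gr_split hA.1 ha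
      obtain ⟨b0, hb0, b1, hb1, rfl⟩ := gr_split hB.1 hb
      have : a1 + b1 = 0 := ev_od_zero (by
        have := Submodule.sub_mem _ h2 (Submodule.add_mem _ ha0.2 hb0.2)
        convert this using 1; abel) (Submodule.add_mem _ ha1.2 hb1.2)
      have e : a0 + a1 + (b0 + b1) = a0 + b0 := by rw [add_add_add_comm, this, add_zero]
      rw [e]
      exact Submodule.add_mem_sup ha0 hb0
  · apply le_antisymm
    · refine sup_le ?_ ?_
      · exact fun x hx => (osp_od x).2 ⟨hAl hx.1, hx.2⟩
      · exact fun x hx => (osp_od x).2 ⟨hBl hx.1, hx.2⟩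
    · intro x hx
      obtain ⟨h1, h2⟩ := (osp_od x).1 hx
      rw [← h] at h1
      obtain ⟨a, ha, b, hb, rfl⟩ := Submodule.mem_sup.1 h1
      obtain ⟨a0, ha0, a1, ha1, rfl⟩ := gr_split hA.1 ha
      obtain ⟨b0, hb0, b1, hb1, rfl⟩ := gr_split hB.1 hb
      have : a0 + b0 = 0 := ev_od_zero (Submodule.add_mem _ ha0.2 hb0.2) (by
        have := Submodule.sub_mem _ h2 (Submodule.add_mem _ ha1.2 hb1.2)
        convert this using 1; abel)
      have e : a0 + a1 + (b0 + b1) = a1 + b1 := by rw [add_add_add_comm, this, zero_add]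
      rw [e]
      exact Submodule.add_mem_sup ha1 hb1

lemma osp_split {n m : ℕ} {x : MJ F n (2 * m)} (hx : x ∈ ospSub F n m) :
    ∃ a ∈ JE (sg F n (2 * m)) (gM F n m), ∃ b ∈ JO (sg F n (2 * m)) (gM F n m), x = a + b := by
  have e1 : (fromBlocks x.toBlocks₁₁ 0 0 x.toBlocks₂₂ : MJ F n (2 * m)) ∈ JE (sg F n (2 * m)) (gM F n m) := by
    constructor
    · simp [sg, fromBlocks_multiply]
    · simp [gM, fromBlocks_multiply, fromBlocks_transpose, hx.1, hx.2.2]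
  refine ⟨_, e1, fromBlocks 0 x.toBlocks₁₂ x.toBlocks₂₁ 0, ?_, ?_⟩
  · have b2 := congrArg transpose hx.2.1
    rw [transpose_mul, SMat_t, transpose_transpose] at b2
    constructor
    · simp [sg, fromBlocks_multiply, fromBlocks_neg]
    · simp [gM, sg, fromBlocks_multiply, fromBlocks_transpose, hx.2.1, ← b2]
  · rw [fromBlocks_add]; simp [fromBlocks_toBlocks]

lemma ne_osp {n m : ℕ} {A : Submodule F (MJ F n (2 * m))} (hA : A ≤ ospSub F n m) (hn : A ≠ ospSub F n m) :
    ¬ (JE (sg F n (2 * m)) (gM F n m) ≤ A ⊓ evenSub F n (2 * m) ∧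
    JO (sg F n (2 * m)) (gM F n m) ≤ A ⊓ oddSub F n (2 * m)) := by
  rintro ⟨h1, h2⟩
  apply hn
  apply le_antisymm hA
  intro x hx
  obtain ⟨a, ha, b, hb, rfl⟩ := osp_split hx
  exact A.add_mem (h1 ha).1 (h2 hb).1

end B
end SJ

open Matrix
namespace SJ
set_option linter.unusedSectionVars false

lemma dim_pair {F V : Type*} [Field F] [AddCommGroup V] [Module F V] [FiniteDimensional F V]
    (L : V →ₗ[F] V →ₗ[F] F) (W U U' : Submodule F V) (hU : U' ≤ W)
    (nd : ∀ x ∈ W, (∀ y ∈ W, L x y = 0) → x = 0) (f : V →ₗ[F] V) (hf : ∀ u ∈ U, f u ∈ W)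
    (hi : ∀ u ∈ U, f u = 0 → u = 0) (ho : ∀ u ∈ U, ∀ v ∈ U', L (f u) v = 0) :
    Module.finrank F U + Module.finrank F U' ≤ Module.finrank F W := by
  let φ : U →ₗ[F] Module.Dual F W := ((Submodule.subtype W).dualMap ∘ₗ L) ∘ₗ f ∘ₗ U.subtype
  have φa : ∀ (u : U) (w : W), φ u w = L (f u) w := fun u w => rfl
  have hinj : Function.Injective φ := by
    rw [← LinearMap.ker_eq_bot, LinearMap.ker_eq_bot']
    intro u hu
    apply Subtype.ext
    apply hi u u.2
    apply nd _ (hf u u.2)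
    intro y hy
    rw [← φa u ⟨y, hy⟩, hu]; rfl
  have hr : LinearMap.range φ ≤ (Submodule.comap W.subtype U').dualAnnihilator := by
    rintro _ ⟨u, rfl⟩
    rw [Submodule.mem_dualAnnihilator]
    intro w hw
    rw [φa]
    exact ho u u.2 _ hw
  have h1 := Submodule.finrank_mono hr
  rw [LinearMap.finrank_range_of_inj hinj] at h1
  have h2 := Subspace.finrank_add_finrank_dualAnnihilator_eq (Submodule.comap W.subtype U')
  have h3 : Module.finrank F (Submodule.comap W.subtype U') = Module.finrank F U' :=
    (Submodule.comapSubtypeEquivOfLe hU).finrank_eq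
  omega

section S
variable {F : Type*} [Field F] [CharZero F] {ι : Type*} [Fintype ι] [DecidableEq ι]
variable {σ G : Matrix ι ι F}

lemma dim_half (L : Matrix ι ι F →ₗ[F] Matrix ι ι F →ₗ[F] F) (W U : Submodule F (Matrix ι ι F)) (hU : U ≤ W)
    (nd : ∀ x ∈ W, (∀ y ∈ W, L x y = 0) → x = 0) (f : Matrix ι ι F →ₗ[F] Matrix ι ι F) (hf : ∀ u ∈ U, f u ∈ W)
    (hi : ∀ u ∈ U, f u = 0 → u = 0) (ho : ∀ u ∈ U, ∀ v ∈ U, L (f u) v = 0) :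
    2 * Module.finrank F U ≤ Module.finrank F W ∧
    ((∃ l ∈ W, l ∉ U ∧ ∀ u ∈ U, L (f u) l = 0) → 2 * Module.finrank F U < Module.finrank F W) := by
  constructor
  · have := dim_pair L W U U hU nd f hf hi ho
    omega
  · rintro ⟨l, hl, hlU, hl2⟩
    have h1 := dim_pair L W U (U ⊔ Submodule.span F {l})
      (sup_le hU ((Submodule.span_singleton_le_iff_mem _ _).2 hl)) nd f hf hi (by
        intro u hu v hv
        obtain ⟨a, ha, b, hb, rfl⟩ := Submodule.mem_sup.1 hv
        obtain ⟨r, rfl⟩ := Submodule.mem_span_singleton.1 hb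
        rw [map_add, ho u hu a ha, map_smul, hl2 u hu]; simp)
    have h2 : U < U ⊔ Submodule.span F {l} := by
      refine lt_of_le_of_ne le_sup_left ?_
      intro h
      apply hlU
      rw [h]
      exact Submodule.mem_sup_right (Submodule.mem_span_singleton_self l)
    have := Submodule.finrank_lt_finrank_of_lt h2
    omega

/-- supertrace form -/
def strF (σ : Matrix ι ι F) : Matrix ι ι F →ₗ[F] Matrix ι ι F →ₗ[F] F :=
  LinearMap.mk₂ F (fun x y => (σ * (x * y)).trace)
    (by intros; simp [add_mul, mul_add]) (by intros; simp) (by intros; simp [mul_add]) (by intros; simp)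

def trF : Matrix ι ι F →ₗ[F] Matrix ι ι F →ₗ[F] F :=
  LinearMap.mk₂ F (fun x y => (x * y).trace)
    (by intros; simp [add_mul]) (by intros; simp) (by intros; simp [mul_add]) (by intros; simp)

def anti (h : Matrix ι ι F) : Matrix ι ι F →ₗ[F] Matrix ι ι F :=
  LinearMap.mulLeft F h + LinearMap.mulRight F h

lemma strF_apply (x y : Matrix ι ι F) : strF σ x y = (σ * (x * y)).trace := rfl
lemma trF_apply (x y : Matrix ι ι F) : trF x y = (x * y).trace := rfl
lemma anti_apply (h x : Matrix ι ι F) : anti h x = h * x + x * h := rfl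

lemma idem_trace_nat {e : Matrix ι ι F} (he : e * e = e) : ∃ k : ℕ, e.trace = k := by
  have h1 : IsIdempotentElem (Matrix.toLinAlgEquiv' e) := by
    unfold IsIdempotentElem
    rw [← map_mul, he]
  have h2 : LinearMap.trace F (ι → F) (Matrix.toLinAlgEquiv' e) = e.trace := by
    rw [← Matrix.trace_toLin'_eq]; rfl
  exact ⟨_, h2.symm.trans (LinearMap.IsIdempotentElem.isProj_range _ h1).trace⟩

/-- even projector -/
def pr (σ : Matrix ι ι F) : Matrix ι ι F := (2⁻¹ : F) • (1 + σ)

lemma pr_s (h : OG σ G) : pr σ * σ = pr σ := by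
  rw [pr, smul_mul_assoc, add_mul, one_mul, h.ss, add_comm]
lemma s_pr (h : OG σ G) : σ * pr σ = pr σ := by
  rw [pr, mul_smul_comm, mul_add, mul_one, h.ss, add_comm]
lemma pr_pr (h : OG σ G) : pr σ * pr σ = pr σ := by
  nth_rewrite 1 [pr]
  rw [smul_mul_assoc, add_mul, one_mul, s_pr h, ← two_smul F, smul_smul, inv_mul_cancel₀ two_ne_zero, one_smul]
lemma pr_JE {a : Matrix ι ι F} (ha : a ∈ JE σ G) : pr σ * a = a * pr σ := by
  rw [pr, smul_mul_assoc, mul_smul_comm, add_mul, mul_add, one_mul, mul_one, ha.1]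
lemma pr_JO {x : Matrix ι ι F} (hx : x ∈ JO σ G) : pr σ * x = x * (1 - pr σ) := by
  have : x = (2⁻¹ : F) • (x + x) := by
    rw [← two_smul F x, smul_smul, inv_mul_cancel₀ two_ne_zero, one_smul]
  rw [mul_sub, mul_one, pr, smul_mul_assoc, mul_smul_comm, add_mul, mul_add, one_mul, mul_one, hx.1]
  conv_rhs => rw [this]
  rw [this.symm]
  nth_rewrite 3 [this]
  module
lemma pr_mem (h : OG σ G) : pr σ ∈ JE σ G :=
  Submodule.smul_mem _ _ (Submodule.add_mem _ one_JE (sig_JE h))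
lemma pr_mul_J00 (h : OG σ G) {a : Matrix ι ι F} (ha : a ∈ JE σ G) : pr σ * a ∈ J00 σ G := by
  refine ⟨⟨?_, ?_⟩, ?_⟩
  · rw [← mul_assoc, s_pr h]
  · rw [mul_assoc, ← ha.1, ← mul_assoc, pr_s h]
  · exact (JE_mul (pr_mem h) ha (pr_JE ha)).2
lemma pr_J00 {a : Matrix ι ι F} (ha : a ∈ J00 σ G) : pr σ * a = a := by
  rw [pr, smul_mul_assoc, add_mul, ha.1.1, one_mul, ← two_smul F, smul_smul, inv_mul_cancel₀ two_ne_zero, one_smul]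
lemma J00_pr {a : Matrix ι ι F} (ha : a ∈ J00 σ G) : a * pr σ = a := by
  rw [← pr_JE (J00_le ha), pr_J00 ha]

lemma mat_ext {X Y : Matrix ι ι F} (h : ∀ v, X *ᵥ v = Y *ᵥ v) : X = Y :=
  ext_of_mulVec_single fun i => h _

lemma J00_vec {P : Matrix ι ι F} (hP : P ∈ J00 σ G) (v : ι → F) : σ *ᵥ (P *ᵥ v) = P *ᵥ v := by
  rw [mulVec_mulVec, hP.1.1]

lemma unit_vec [IsAlgClosed F] (h : OG σ G) {P : Matrix ι ι F} (hP : P ∈ J00 σ G) (h2 : P * P = P) (h0 : P ≠ 0) :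
    ∃ z, P *ᵥ z = z ∧ σ *ᵥ z = z ∧ bil G z z = 1 := by
  obtain ⟨v, hv⟩ : ∃ v, bil G (P *ᵥ v) (P *ᵥ v) ≠ 0 := by
    by_contra hc
    push Not at hc
    apply h0
    apply mat_ext
    intro v
    rw [zero_mulVec]
    apply h.nd_left
    intro w
    have h3 := hc (v + w)
    rw [mulVec_add, bil_add_left, bil_add_right, bil_add_right, hc v, hc w, h.swap (P *ᵥ v) (P *ᵥ w), J00_vec hP] at h3
    have h4 : bil G (P *ᵥ v) (P *ᵥ w) = 0 := eq_zero_of_neg_self (by linear_combination h3)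
    rw [← JE.bil (J00_le hP), mulVec_mulVec, h2] at h4
    exact h4
  obtain ⟨s, hs⟩ := IsAlgClosed.exists_pow_nat_eq (bil G (P *ᵥ v) (P *ᵥ v)) (n := 2) (by norm_num)
  have hs0 : s ≠ 0 := by rintro rfl; apply hv; rw [← hs]; simp
  refine ⟨s⁻¹ • (P *ᵥ v), ?_, ?_, ?_⟩
  · rw [mulVec_smul, mulVec_mulVec, h2]
  · rw [mulVec_smul, J00_vec hP]
  · rw [bil_smul_left, bil_smul_right, ← hs]; field_simp

lemma RR_facts (h : OG σ G) {P : Matrix ι ι F} (hP : P ∈ JE σ G) {z : ι → F} (h1 : P *ᵥ z = z) (h3 : bil G z z = 1) :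
    P * RR G z z = RR G z z ∧ RR G z z * P = RR G z z ∧ RR G z z * RR G z z = RR G z z ∧ (RR G z z).trace = 1 := by
  refine ⟨by rw [mul_RR, h1], by rw [RR_mul_JE hP, h1], by rw [RR_mul_RR, h3, one_smul], by rw [trace_RR, h3]⟩

lemma idem_sub {P R : Matrix ι ι F} (h1 : P * P = P) (h2 : P * R = R) (h3 : R * P = R) (h4 : R * R = R) :
    (P - R) * (P - R) = P - R := by
  rw [mul_sub, sub_mul, sub_mul, h1, h2, h3, h4]; abel

/-- local data at an idempotent -/
lemma locH [IsAlgClosed F] (h : OG σ G) {e : Matrix ι ι F} (he : e ∈ JE σ G) (hee : e * e = e)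
    (nr : ∀ w, w ≠ 0 → σ *ᵥ w = w → e ≠ RR G w w) :
    ∃ H K Q : Matrix ι ι F, H ∈ J00 σ G ∧ (pr σ * e) * H = H ∧ H * (pr σ * e) = H ∧
      (pr σ * e) * K = K ∧ K * (pr σ * e) = K ∧ K * (H * (H + 1)) = pr σ * e ∧
      (Q = 0 ∨ Q = e - pr σ * e) ∧ H.trace = Q.trace ∧ ((pr σ * e).trace = 1 → Q = e - pr σ * e) := by
  set P := pr σ * e with hP
  have pe : pr σ * e = e * pr σ := pr_JE he
  have hPJ : P ∈ J00 σ G := pr_mul_J00 h he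
  have PP : P * P = P := by
    calc P * P = pr σ * (e * pr σ) * e := by rw [hP]; noncomm_ring
      _ = (pr σ * pr σ) * (e * e) := by rw [← pe]; noncomm_ring
      _ = P := by rw [pr_pr h, hee]
  have eP : e * P = P := by rw [hP, ← mul_assoc, ← pe, mul_assoc, hee]
  have Pe : P * e = P := by rw [hP, mul_assoc, hee]
  have QQ : (e - P) * (e - P) = e - P := idem_sub hee eP Pe PP
  by_cases P0 : P = 0
  · refine ⟨0, 0, 0, zero_mem _, ?_, ?_, ?_, ?_, ?_, Or.inl rfl, rfl, ?_⟩
    any_goals simp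
    · exact P0.symm
    · rw [P0]; simp
  obtain ⟨z, z1, z2, z3⟩ := unit_vec h hPJ PP P0
  have z0 : z ≠ 0 := by rintro rfl; rw [bil_zero_left] at z3; exact zero_ne_one z3
  obtain ⟨PR, RP, hRR, tR⟩ := RR_facts h (J00_le hPJ) z1 z3
  set R := RR G z z with hR
  have hRJ : R ∈ J00 σ G := RR_J00' h z2
  by_cases t1 : P.trace = 1
  · have PeR : P = R := by
      have := idem_tr_zero (idem_sub PP PR RP hRR) (by rw [trace_sub, t1, tR, sub_self])
      exact sub_eq_zero.1 this
    obtain ⟨q, hq⟩ := idem_trace_nat QQ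
    have q0 : (q : F) ≠ 0 := by
      intro hq0
      rw [hq0] at hq
      have := idem_tr_zero QQ hq
      exact nr z z0 z2 (by rw [sub_eq_zero.1 this, PeR])
    have q1 : (q : F) + 1 ≠ 0 := by exact_mod_cast Nat.succ_ne_zero q
    refine ⟨(q : F) • P, ((q : F) * (q + 1))⁻¹ • P, e - P, Submodule.smul_mem _ _ hPJ, ?_, ?_, ?_, ?_, ?_, Or.inr rfl, ?_, fun _ => rfl⟩
    · rw [mul_smul_comm, PP]
    · rw [smul_mul_assoc, PP]
    · rw [mul_smul_comm, PP]
    · rw [smul_mul_assoc, PP]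
    · simp only [mul_add, mul_smul_comm, smul_mul_assoc, PP, mul_one, smul_smul, smul_add, ← add_smul]
      rw [← one_smul F P]; simp only [smul_smul]; congr 1; field_simp
    · rw [trace_smul, t1, hq]; simp
  · obtain ⟨p, hp⟩ := idem_trace_nat PP
    have p1 : p ≠ 1 := by rintro rfl; exact t1 (by simpa using hp)
    have p0 : p ≠ 0 := by rintro rfl; exact P0 (idem_tr_zero PP (by simpa using hp))
    have b0 : (2 - 2 * p : F) ≠ 0 := by
      have : ((2 - 2 * p : ℤ) : F) ≠ 0 := by
        rw [Int.cast_ne_zero]; omega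
      simpa using this
    have b1 : (2 - 2 * p : F) + 1 ≠ 0 := by
      have : ((2 - 2 * p + 1 : ℤ) : F) ≠ 0 := by
        rw [Int.cast_ne_zero]; omega
      simpa using this
    generalize hb : (2 - 2 * p : F) = β at b0 b1
    refine ⟨(2 : F) • (P - R) + β • R, (6⁻¹ : F) • (P - R) + (β * (β + 1))⁻¹ • R, 0,
      Submodule.add_mem _ (Submodule.smul_mem _ _ (Submodule.sub_mem _ hPJ hRJ)) (Submodule.smul_mem _ _ hRJ), ?_, ?_, ?_, ?_, ?_, Or.inl rfl, ?_, fun h => absurd h t1⟩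
    · simp only [mul_add, mul_smul_comm, mul_sub, PP, PR]
    · simp only [add_mul, smul_mul_assoc, sub_mul, PP, RP]
    · simp only [mul_add, mul_smul_comm, mul_sub, PP, PR]
    · simp only [add_mul, smul_mul_assoc, sub_mul, PP, RP]
    · simp only [mul_add, add_mul, mul_sub, sub_mul, mul_one, mul_smul_comm, smul_mul_assoc, PP, PR, RP, hRR, smul_add, smul_sub, sub_self, smul_smul, sub_zero, smul_zero, add_zero, zero_add]
      match_scalars <;> field_simp <;> ring
    · rw [trace_add, trace_smul, trace_smul, trace_sub, hp, tR, trace_zero, ← hb]; simp; ring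
end S
end SJ

open Matrix
namespace SJ
set_option linter.unusedSectionVars false
section S
variable {F : Type*} [Field F] [CharZero F] {ι : Type*} [Fintype ι] [DecidableEq ι]
variable {σ G : Matrix ι ι F} {E O : Submodule F (Matrix ι ι F)}

structure SA (σ G : Matrix ι ι F) (E O : Submodule F (Matrix ι ι F)) : Prop where
  og : OG σ G
  le0 : E ≤ JE σ G
  le1 : O ≤ JO σ G
  s : Simp E O

lemma JE_JO {a x : Matrix ι ι F} (ha : a ∈ JE σ G) (hx : x ∈ JO σ G) : a * x + x * a ∈ JO σ G := by
  constructor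
  · calc σ * (a * x + x * a) = (σ * a) * x + (σ * x) * a := by noncomm_ring
      _ = (a * σ) * x + (-(x * σ)) * a := by rw [ha.1, hx.1]
      _ = a * (σ * x) - x * (σ * a) := by noncomm_ring
      _ = a * (-(x * σ)) - x * (a * σ) := by rw [ha.1, hx.1]
      _ = _ := by noncomm_ring
  · calc (a * x + x * a)ᵀ * G = xᵀ * (aᵀ * G) + aᵀ * (xᵀ * G) := by
          rw [transpose_add, transpose_mul, transpose_mul]; noncomm_ring
      _ = xᵀ * (G * a) + aᵀ * (G * x * σ) := by rw [ha.2, hx.2]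
      _ = (xᵀ * G) * a + (aᵀ * G) * x * σ := by noncomm_ring
      _ = (G * x * σ) * a + (G * a) * x * σ := by rw [ha.2, hx.2]
      _ = G * x * (σ * a) + G * a * x * σ := by noncomm_ring
      _ = G * x * (a * σ) + G * a * x * σ := by rw [ha.1]
      _ = _ := by noncomm_ring

lemma str_cyc {x z : Matrix ι ι F} (hx : σ * x = -(x * σ)) : (σ * (x * z)).trace = - (σ * (z * x)).trace := by
  rw [← mul_assoc, hx, neg_mul, trace_neg, mul_assoc, trace_mul_comm, mul_assoc]

lemma str_cyc' {x z : Matrix ι ι F} (hx : σ * x = x * σ) : (σ * (x * z)).trace = (σ * (z * x)).trace := by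
  rw [← mul_assoc, hx, mul_assoc, trace_mul_comm, mul_assoc]

lemma JO_eq_zero' (h : OG σ G) {X : Matrix ι ι F} (hX : X ∈ JO σ G)
    (h0 : ∀ v, σ *ᵥ v = -v → X *ᵥ v = 0) : X = 0 := by
  apply JO_eq_zero h hX
  intro v hv
  apply h.nd_left
  intro w
  obtain ⟨x, y, hx, hy, rfl⟩ := h.split w
  rw [bil_add_right, h.orth' (JO.ev hX hv) hx, JO.bil hX, hy, mulVec_neg, h0 y hy, neg_zero, bil_zero_right, add_zero]

lemma strF_nd (h : OG σ G) : ∀ x ∈ JO σ G, (∀ y ∈ JO σ G, strF σ x y = 0) → x = 0 := by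
  intro x hx h0
  apply JO_eq_zero' h hx
  intro b hb
  apply h.nd_ev (JO.od hx hb)
  intro a ha
  have h1 := h0 _ (RR_JO h ha hb)
  rw [strF_apply, mul_sub, mul_sub, trace_sub, mul_RR, mul_RR, mul_RR, mul_RR, trace_RR, trace_RR, JO.ev hx ha, JO.od hx hb,
    bil_neg_right, h.swap (x *ᵥ a) b, hb, bil_neg_right, JO.bil hx, hb, mulVec_neg, bil_neg_right] at h1
  exact eq_zero_of_neg_self (by linear_combination -h1)

lemma tr_sc {e X c : Matrix ι ι F} {t : F} (h1 : e * X = X) (h2 : X * e = X) (h3 : e * c * e = t • e) :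
    (X * c).trace = t * X.trace := by
  calc (X * c).trace = (e * (X * e * c)).trace := by rw [h2, ← mul_assoc, h1]
    _ = (X * (e * c * e)).trace := by rw [trace_mul_comm]; congr 1; noncomm_ring
    _ = _ := by rw [h3, mul_smul_comm, trace_smul, h2, smul_eq_mul]

lemma sum_mul_orth {s : ℕ} {a b : Fin s → Matrix ι ι F} (h : ∀ i j, i ≠ j → a i * b j = 0) :
    (∑ i, a i) * (∑ i, b i) = ∑ i, a i * b i := by
  rw [Finset.sum_mul]
  refine Finset.sum_congr rfl fun i _ => ?_
  rw [Finset.mul_sum, Finset.sum_eq_single i (fun j _ hj => h i j hj.symm) (by simp)]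

/-- the supertrace radical is trivial or everything -/
lemma str_ideal (h : SA σ G E O) :
    (∀ x ∈ O, (∀ y ∈ O, (σ * (x * y)).trace = 0) → x = 0) ∨
    (∀ a ∈ E, ∀ b ∈ E, (σ * (a * b)).trace = 0) := by
  let Z0 : Submodule F (Matrix ι ι F) :=
    { carrier := {a | a ∈ E ∧ ∀ b ∈ E, (σ * (a * b)).trace = 0}
      zero_mem' := ⟨zero_mem _, by simp⟩
      add_mem' := fun ha hb => ⟨add_mem ha.1 hb.1, fun c hc => by
        rw [add_mul, mul_add, Matrix.trace_add, ha.2 c hc, hb.2 c hc, add_zero]⟩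
      smul_mem' := fun r a ha => ⟨E.smul_mem r ha.1, fun c hc => by
        rw [smul_mul_assoc, mul_smul_comm, Matrix.trace_smul, ha.2 c hc, smul_zero]⟩ }
  let Z1 : Submodule F (Matrix ι ι F) :=
    { carrier := {a | a ∈ O ∧ ∀ b ∈ O, (σ * (a * b)).trace = 0}
      zero_mem' := ⟨zero_mem _, by simp⟩
      add_mem' := fun ha hb => ⟨add_mem ha.1 hb.1, fun c hc => by
        rw [add_mul, mul_add, Matrix.trace_add, ha.2 c hc, hb.2 c hc, add_zero]⟩
      smul_mem' := fun r a ha => ⟨O.smul_mem r ha.1, fun c hc => by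
        rw [smul_mul_assoc, mul_smul_comm, Matrix.trace_smul, ha.2 c hc, smul_zero]⟩ }
  have key := h.s.simp Z0 Z1 (fun a ha => ha.1) (fun a ha => ha.1) ?_ ?_ ?_ ?_
  rcases key with ⟨_, h1⟩ | ⟨h0, _⟩
  · left
    intro x hx hy
    have : x ∈ Z1 := ⟨hx, hy⟩
    rwa [h1, Submodule.mem_bot] at this
  · right
    intro a ha b hb
    rw [← h0] at ha
    exact ha.2 b hb
  · intro a ha b hb
    refine ⟨h.s.ee a ha b hb.1, fun c hc => ?_⟩
    have := hb.2 _ (h.s.ee c hc a ha)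
    rw [add_mul, mul_add, trace_add, mul_assoc, str_cyc' (h.le0 ha).1, mul_assoc, mul_assoc]
    rw [mul_add, mul_add, trace_add] at this
    exact this
  · intro x hx b hb
    refine ⟨h.s.eo b hb.1 x hx, fun c hc => ?_⟩
    have := hb.2 _ (h.s.oo x hx c hc)
    rw [add_mul, mul_add, trace_add, mul_assoc, mul_assoc x, str_cyc (h.le1 hx).1, mul_assoc]
    rw [mul_sub, mul_sub, trace_sub] at this
    rw [← this]; ring
  · intro a ha y hy
    refine ⟨h.s.eo a ha y hy.1, fun c hc => ?_⟩
    have := hy.2 _ (h.s.eo a ha c hc)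
    rw [add_mul, mul_add, trace_add, mul_assoc, str_cyc' (h.le0 ha).1, mul_assoc, mul_assoc]
    rw [mul_add, mul_add, trace_add] at this
    rw [← this]; ring
  · intro x hx y hy
    refine ⟨h.s.oo x hx y hy.1, fun c hc => ?_⟩
    have := hy.2 _ (h.s.eo c hc x hx)
    rw [sub_mul, mul_sub, trace_sub, mul_assoc, str_cyc (h.le1 hx).1, mul_assoc, mul_assoc]
    rw [mul_add, mul_add, trace_add] at this
    rw [← neg_eq_zero, ← this]; ring

/-- a selfadjoint idempotent on the odd part cannot have trace one -/
lemma odd_idem_ne_one (h : OG σ G) {Q : Matrix ι ι F} (hQ : Q ∈ JE σ G) (hs : σ * Q = -Q) (QQ : Q * Q = Q)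
    (ht : Q.trace = 1) : False := by
  have hsv : ∀ v, σ *ᵥ (Q *ᵥ v) = -(Q *ᵥ v) := fun v => by rw [mulVec_mulVec, hs, neg_mulVec]
  have hQQ : ∀ v, Q *ᵥ (Q *ᵥ v) = Q *ᵥ v := fun v => by rw [mulVec_mulVec, QQ]
  obtain ⟨a, b, hab⟩ : ∃ a b, bil G (Q *ᵥ a) (Q *ᵥ b) = 1 := by
    by_contra hc
    push Not at hc
    have : Q = 0 := by
      apply mat_ext
      intro a
      rw [zero_mulVec]
      apply h.nd_left
      intro b
      by_contra h1
      have h2 : bil G (Q *ᵥ a) (Q *ᵥ b) ≠ 0 := by rwa [← JE.bil hQ, hQQ]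
      apply hc ((bil G (Q *ᵥ a) (Q *ᵥ b))⁻¹ • a) b
      rw [mulVec_smul, bil_smul_left, inv_mul_cancel₀ h2]
    rw [this] at ht
    simp at ht
  generalize hv : Q *ᵥ a = v at hab
  generalize hw : Q *ᵥ b = w at hab
  have sv : σ *ᵥ v = -v := hv ▸ hsv a
  have sw : σ *ᵥ w = -w := hw ▸ hsv b
  have Qv : Q *ᵥ v = v := hv ▸ hQQ a
  have Qw : Q *ᵥ w = w := hw ▸ hQQ b
  have vv : bil G v v = 0 := eq_zero_of_neg_self (by rw [← bil_neg_right, ← sv, ← h.swap])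
  have ww : bil G w w = 0 := eq_zero_of_neg_self (by rw [← bil_neg_right, ← sw, ← h.swap])
  have wv : bil G w v = -1 := by rw [h.swap, sw, bil_neg_right, hab]
  set R := RR G w v - RR G v w with hR
  have h1 : Q * R = R := by rw [hR, mul_sub, mul_RR, mul_RR, Qv, Qw]
  have h2 : R * Q = R := by rw [hR, sub_mul, RR_mul_JE hQ, RR_mul_JE hQ, Qv, Qw]
  have h3 : R * R = R := by
    rw [hR, mul_sub, sub_mul, sub_mul]
    simp only [RR_mul_RR, vv, ww, wv, hab]; module
  have h4 : R.trace = 2 := by rw [hR, trace_sub, trace_RR, trace_RR, wv, hab]; norm_num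
  obtain ⟨k, hk⟩ := idem_trace_nat (idem_sub QQ h1 h2 h3)
  rw [trace_sub, ht, h4] at hk
  have : ((k + 1 : ℕ) : F) = 0 := by push_cast; rw [← hk]; norm_num
  exact absurd (Nat.cast_eq_zero.1 this) (by omega)

theorem lemmaS [IsAlgClosed F] (h : SA σ G E O) (nr : ∀ w, w ≠ 0 → σ *ᵥ w = w → RR G w w ∉ E)
    {s : ℕ} {e : Fin s → Matrix ι ι F} (hid : IdFam E s e)
    (hsc : ∀ i, ∀ c ∈ E, ∃ t : F, e i * c * e i = t • e i)
    (hze : ∀ c ∈ E, (1 - ∑ i, e i) * c * (1 - ∑ i, e i) = 0) :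
    2 * Module.finrank F O ≤ Module.finrank F (JO σ G) ∧
    ∀ i, (pr σ * e i).trace = 1 → 2 * Module.finrank F O < Module.finrank F (JO σ G) := by
  have hG := h.og
  have eJ : ∀ i, e i ∈ JE σ G := fun i => h.le0 (hid.1 i).1
  have eE : ∀ i, e i ∈ E := fun i => (hid.1 i).1
  have ee : ∀ i, e i * e i = e i := fun i => (hid.1 i).2.2
  have pe : ∀ i, pr σ * e i = e i * pr σ := fun i => pr_JE (eJ i)
  have H' := fun i => locH hG (eJ i) (ee i) (fun w hw hw' hh => nr w hw hw' (hh ▸ eE i))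
  choose H K Q h1 h2 h3 h4 h5 h6 h7 h8 h9 using H'
  have eP : ∀ i, e i * (pr σ * e i) = pr σ * e i := fun i => by rw [← mul_assoc, ← pe, mul_assoc, ee]
  have Pe : ∀ i, (pr σ * e i) * e i = pr σ * e i := fun i => by rw [mul_assoc, ee]
  have eH : ∀ i, e i * H i = H i := fun i => by rw [← h2 i, ← mul_assoc, eP]
  have He : ∀ i, H i * e i = H i := fun i => by rw [← h3 i, mul_assoc, Pe]
  have eK : ∀ i, e i * K i = K i := fun i => by rw [← h4 i, ← mul_assoc, eP]
  have Ke : ∀ i, K i * e i = K i := fun i => by rw [← h5 i, mul_assoc, Pe]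
  have QJ : ∀ i, Q i ∈ JE σ G := fun i => by
    rcases h7 i with q | q <;> rw [q]
    · exact zero_mem _
    · exact Submodule.sub_mem _ (eJ i) (J00_le (pr_mul_J00 hG (eJ i)))
  have eQ : ∀ i, e i * Q i = Q i := fun i => by
    rcases h7 i with q | q <;> rw [q]
    · simp
    · rw [mul_sub, ee, eP]
  have Qe : ∀ i, Q i * e i = Q i := fun i => by
    rcases h7 i with q | q <;> rw [q]
    · simp
    · rw [sub_mul, ee, Pe]
  have sQ : ∀ i, σ * Q i = - Q i := fun i => by
    rcases h7 i with q | q <;> rw [q]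
    · simp
    · have : σ = (2:F) • pr σ - 1 := by rw [pr, smul_smul, mul_inv_cancel₀ two_ne_zero, one_smul]; abel
      have h2 : σ * (pr σ * e i) = pr σ * e i := by rw [← mul_assoc, s_pr hG]
      rw [mul_sub, h2]
      nth_rewrite 1 [this]
      rw [sub_mul, smul_mul_assoc, one_mul]; module
  have QQ : ∀ i, Q i * Q i = Q i := fun i => by
    have PP : (pr σ * e i) * (pr σ * e i) = pr σ * e i := by
      rw [pe, mul_assoc, ← mul_assoc (pr σ), pe, mul_assoc, pr_pr hG, ← mul_assoc, ee]
    rcases h7 i with q | q <;> rw [q]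
    · simp
    · exact idem_sub (ee i) (eP i) (Pe i) PP
  have pQ : ∀ i, pr σ * Q i = 0 := fun i => by
    rw [pr, smul_mul_assoc, add_mul, one_mul, sQ, add_neg_cancel, smul_zero]
  set e0 := 1 - ∑ i, e i with he0
  have e0J : e0 ∈ JE σ G := Submodule.sub_mem _ one_JE (Submodule.sum_mem _ fun i _ => eJ i)
  have e00 : e0 * e0 = e0 := by
    rw [he0, mul_sub, sub_mul, sub_mul, hid.sum_sq]; simp
  have ee0 : ∀ i, e i * e0 = 0 := fun i => by rw [he0, mul_sub, hid.mul_sum, mul_one, sub_self]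
  have e0e : ∀ i, e0 * e i = 0 := fun i => by rw [he0, sub_mul, hid.sum_mul, one_mul, sub_self]
  have pe0 : pr σ * e0 = e0 * pr σ := pr_JE e0J
  set hh := ∑ i, H i + ∑ i, Q i + pr σ * e0 with hhh
  have hJ : hh ∈ JE σ G := Submodule.add_mem _ (Submodule.add_mem _ (Submodule.sum_mem _ fun i _ => J00_le (h1 i))
    (Submodule.sum_mem _ fun i _ => QJ i)) (J00_le (pr_mul_J00 hG e0J))
  -- supertrace orthogonality
  have hstr : ∀ c ∈ E, (σ * (hh * c)).trace = 0 := by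
    intro c hc
    have s1 : σ * hh = ∑ i, (H i - Q i) + pr σ * e0 := by
      rw [hhh, mul_add, mul_add, Finset.mul_sum, Finset.mul_sum, ← mul_assoc, s_pr hG, ← Finset.sum_add_distrib]
      congr 1
      exact Finset.sum_congr rfl fun i _ => by rw [(h1 i).1.1, sQ]; abel
    rw [← mul_assoc, s1, add_mul, trace_add, Finset.sum_mul, trace_sum, Finset.sum_eq_zero, zero_add]
    · calc (pr σ * e0 * c).trace = (pr σ * e0 * e0 * c).trace := by rw [mul_assoc (pr σ) e0 e0, e00]
        _ = (e0 * (pr σ * e0 * c)).trace := by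
          congr 1
          calc pr σ * e0 * e0 * c = (pr σ * e0) * (e0 * c) := by noncomm_ring
            _ = e0 * pr σ * (e0 * c) := by rw [pe0]
            _ = _ := by noncomm_ring
        _ = (pr σ * (e0 * c * e0)).trace := by rw [trace_mul_comm]; congr 1; noncomm_ring
        _ = 0 := by rw [hze c hc]; simp
    · intro i _
      obtain ⟨t, ht⟩ := hsc i c hc
      rw [tr_sc (e := e i) (t := t) (by rw [mul_sub, eH, eQ]) (by rw [sub_mul, He, Qe]) ht, trace_sub, h8 i, sub_self, mul_zero]
  -- injectivity
  have hinj : ∀ x ∈ JO σ G, anti hh x = 0 → x = 0 := by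
    intro x hx hx0
    rw [anti_apply] at hx0
    have hKH : (∑ i, K i + (2⁻¹:F) • (pr σ * e0)) * ((∑ i, H i + pr σ * e0) * ((∑ i, H i + pr σ * e0) + 1)) = pr σ := by
      have z1 : (∑ i, H i) * (pr σ * e0) = 0 := by
        rw [Finset.sum_mul]
        exact Finset.sum_eq_zero fun i _ => by rw [pe0, ← mul_assoc, ← He i, mul_assoc (H i), ee0]; simp
      have z2 : (pr σ * e0) * (∑ i, H i) = 0 := by
        rw [Finset.mul_sum]
        exact Finset.sum_eq_zero fun i _ => by rw [mul_assoc, ← eH i, ← mul_assoc e0, e0e]; simp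
      have z3 : (∑ i, K i) * (pr σ * e0) = 0 := by
        rw [Finset.sum_mul]
        exact Finset.sum_eq_zero fun i _ => by rw [pe0, ← mul_assoc, ← Ke i, mul_assoc (K i), ee0]; simp
      have z4 : (pr σ * e0) * (pr σ * e0) = pr σ * e0 := by
        rw [mul_assoc, ← mul_assoc e0, ← pe0, mul_assoc, e00, ← mul_assoc, pr_pr hG]
      have z5 : (∑ i, H i) * (∑ i, H i) = ∑ i, H i * H i :=
        sum_mul_orth fun i j hij => by rw [← He i, ← eH j, mul_assoc, ← mul_assoc (e i), hid.2 i j hij]; simp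
      have z6 : (∑ i, K i) * (∑ i, H i * H i + ∑ i, H i) = ∑ i, pr σ * e i := by
        rw [← Finset.sum_add_distrib, sum_mul_orth]
        · exact Finset.sum_congr rfl fun i _ => by rw [← h6 i]; noncomm_ring
        · intro i j hij
          rw [← Ke i, ← eH j]
          have : K i * e i * (e j * H j * (e j * H j) + e j * H j) = K i * (e i * e j) * (H j * (e j * H j) + H j) := by noncomm_ring
          rw [this, hid.2 i j hij]; simp
      have z7 : (∑ i, H i + pr σ * e0) * ((∑ i, H i + pr σ * e0) + 1) = (∑ i, H i * H i + ∑ i, H i) + (2:F) • (pr σ * e0) := by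
        rw [mul_add, mul_add, add_mul, add_mul, mul_one, z1, z2, z4, z5]; module
      have z8 : pr σ * e0 * (∑ i, H i * H i + ∑ i, H i) = 0 := by
        rw [← z5, mul_add, ← mul_assoc, z2]; simp
      rw [z7, add_mul, mul_add, z6, mul_smul_comm, z3, mul_add, smul_mul_assoc, z8, smul_mul_assoc, mul_smul_comm, z4,
        smul_smul, inv_mul_cancel₀ two_ne_zero, ← Finset.mul_sum, he0, mul_sub]
      simp
    set h0 := ∑ i, H i + pr σ * e0 with hh0
    set hq := ∑ i, Q i with hhq
    have hsum : hh = h0 + hq := by rw [hhh, hh0]; abel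
    have ph0 : pr σ * h0 = h0 := by
      rw [hh0, mul_add, ← mul_assoc, pr_pr hG, Finset.mul_sum]
      congr 1
      exact Finset.sum_congr rfl fun i _ => pr_J00 (h1 i)
    have phq : pr σ * hq = 0 := by
      rw [hhq, Finset.mul_sum]
      exact Finset.sum_eq_zero fun i _ => pQ i
    have hqq : hq * hq = hq := by
      rw [hhq, sum_mul_orth]
      · exact Finset.sum_congr rfl fun i _ => QQ i
      · intro i j hij
        rw [← Qe i, ← eQ j, mul_assoc, ← mul_assoc (e i), hid.2 i j hij]; simp
    have pJ : pr σ * hh = hh * pr σ := pr_JE hJ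
    have hp : hh * pr σ = h0 := by rw [← pJ, hsum, mul_add, ph0, phq, add_zero]
    have px := pr_JO hx
    have hx1 : hh * x = - (x * hh) := eq_neg_of_add_eq_zero_left hx0
    have c1 : h0 * (pr σ * x) = - (pr σ * x * hq) := by
      have t1 : (1 - pr σ) * hh = hq := by rw [sub_mul, one_mul, pJ, hp, hsum]; abel
      calc h0 * (pr σ * x) = hh * (pr σ * pr σ) * x := by rw [← hp]; noncomm_ring
        _ = pr σ * (hh * x) := by rw [pr_pr hG, ← pJ, mul_assoc]
        _ = - (pr σ * x * hh) := by rw [hx1]; noncomm_ring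
        _ = - (x * ((1 - pr σ) * hh)) := by rw [px]; noncomm_ring
        _ = - (x * ((1 - pr σ) * hh)) := rfl
        _ = - (pr σ * x * hq) := by
          rw [px, t1]
          congr 1
          rw [mul_assoc, sub_mul, phq, one_mul, sub_zero]
    have c2 : h0 * (h0 + 1) * (pr σ * x) = 0 := by
      have : h0 * (h0 + 1) * (pr σ * x) = h0 * (h0 * (pr σ * x)) + h0 * (pr σ * x) := by noncomm_ring
      rw [this, c1, mul_neg, ← mul_assoc, c1, neg_mul, mul_assoc _ hq, hqq]; simp
    have c3 : pr σ * x = 0 := by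
      have : pr σ * (pr σ * x) = 0 := by rw [← hKH, mul_assoc, hKH, c2, mul_zero]
      rwa [← mul_assoc, pr_pr hG] at this
    apply JO_eq_zero' hG hx
    intro v hv
    have e1 := JO.od hx hv
    have : (pr σ * x) *ᵥ v = x *ᵥ v := by
      rw [← mulVec_mulVec, pr, smul_mulVec, add_mulVec, one_mulVec, e1, ← two_smul F, smul_smul, inv_mul_cancel₀ two_ne_zero, one_smul]
    rw [← this, c3, zero_mulVec]
  have hort : ∀ u ∈ O, ∀ v ∈ O, strF σ (anti hh u) v = 0 := by
    intro u hu v hv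
    have := hstr _ (h.s.oo u hu v hv)
    rw [mul_sub, mul_sub, trace_sub] at this
    rw [strF_apply, anti_apply, add_mul, mul_add, trace_add, mul_assoc u, str_cyc (h.le1 hu).1, mul_assoc, mul_assoc]
    rw [← this]; ring
  have D := dim_half (strF σ) (JO σ G) O h.le1 (strF_nd hG) (anti hh) (fun u hu => JE_JO hJ (h.le1 hu))
    (fun u hu => hinj u (h.le1 hu)) hort
  refine ⟨D.1, fun i hi => D.2 ?_⟩
  -- the strict case
  have Qi := h9 i hi
  have PJ : pr σ * e i ∈ J00 σ G := pr_mul_J00 hG (eJ i)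
  have PP : (pr σ * e i) * (pr σ * e i) = pr σ * e i := by
      rw [pe, mul_assoc, ← mul_assoc (pr σ), pe, mul_assoc, pr_pr hG, ← mul_assoc, ee]
  have P0 : pr σ * e i ≠ 0 := by intro h0; rw [h0] at hi; simp at hi
  obtain ⟨z, z1, z2, z3⟩ := unit_vec hG PJ PP P0
  have z0 : z ≠ 0 := by rintro rfl; rw [bil_zero_left] at z3; exact zero_ne_one z3
  obtain ⟨PR, RP, hRR, tR⟩ := RR_facts hG (J00_le PJ) z1 z3
  have PeR : pr σ * e i = RR G z z :=
    sub_eq_zero.1 (idem_tr_zero (idem_sub PP PR RP hRR) (by rw [trace_sub, hi, tR, sub_self]))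
  have Qne : Q i ≠ 0 := by
    intro hq
    rw [hq] at Qi
    apply nr z z0 z2
    rw [← PeR, ← sub_eq_zero.1 Qi.symm]
    exact eE i
  have ez : e i *ᵥ z = z := by rw [← z1, mulVec_mulVec, eP]
  rcases str_ideal h with hZ | hZ
  swap
  · exfalso
    have := hZ _ (eE i) _ (eE i)
    have e2 : e i = pr σ * e i + Q i := by rw [Qi]; abel
    rw [ee, e2, mul_add, sQ, ← mul_assoc, s_pr hG, trace_add, hi, trace_neg] at this
    exact odd_idem_ne_one hG (QJ i) (sQ i) (QQ i) (by linear_combination -this)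
  obtain ⟨v, hv⟩ : ∃ v, Q i *ᵥ v ≠ 0 := by
    by_contra hc
    push Not at hc
    exact Qne (mat_ext fun v => by rw [hc, zero_mulVec])
  set b := Q i *ᵥ v with hb
  have sb : σ *ᵥ b = -b := by rw [hb, mulVec_mulVec, sQ, neg_mulVec]
  have eb : e i *ᵥ b = b := by rw [hb, mulVec_mulVec, eQ]
  have exe : ∀ x ∈ O, e i * x * e i = 0 := by
    intro x hx
    have hx' := h.s.uo (eE i) hx
    apply hZ _ hx'
    intro y hy
    have hy' := h.s.uo (eE i) hy
    obtain ⟨t, ht⟩ := hsc i _ (h.s.oo _ hx' _ hy')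
    have r1 : e i * (e i * x * e i * (e i * y * e i) - e i * y * e i * (e i * x * e i)) * e i =
      e i * x * e i * (e i * y * e i) - e i * y * e i * (e i * x * e i) := by
      have a1 : ∀ z, e i * (e i * z) = e i * z := fun z => by rw [← mul_assoc, ee]
      simp only [mul_sub, sub_mul, mul_assoc, a1, ee]
    rw [r1] at ht
    have t0 : t = 0 := by
      have := congrArg trace ht
      rw [trace_sub, trace_mul_comm, sub_self, trace_smul, smul_eq_mul] at this
      rcases mul_eq_zero.1 this.symm with h | h
      · exact h
      · exact absurd (idem_tr_zero (ee i) h) (hid.1 i).2.1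
    rw [t0, zero_smul] at ht
    have s2 : (σ * (e i * x * e i * (e i * y * e i))).trace = 0 := by
      apply eq_zero_of_neg_self
      conv_rhs => rw [← str_cyc (h.le1 hy').1]
      rw [sub_eq_zero.1 ht]
    have s3 : (σ * (e i * x * e i * y)).trace = (σ * (e i * x * e i * (e i * y * e i))).trace := by
      calc (σ * (e i * x * e i * y)).trace = (σ * (e i * (e i * x * e i * y))).trace := by
              congr 2; rw [← mul_assoc (e i), ← mul_assoc (e i), ← mul_assoc (e i), ee]
        _ = (σ * (e i * x * (e i * e i) * y * e i)).trace := by rw [str_cyc' (eJ i).1, ee]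
        _ = _ := by congr 2; noncomm_ring
    rw [s3, s2]
  set l := RR G z b - RR G b z with hl
  have le : l * e i = l := by rw [hl, sub_mul, RR_mul_JE (eJ i), RR_mul_JE (eJ i), ez, eb]
  have el : e i * l = l := by rw [hl, mul_sub, mul_RR, mul_RR, ez, eb]
  refine ⟨l, RR_JO hG z2 sb, ?_, ?_⟩
  · intro hlO
    have := exe l hlO
    rw [el, le] at this
    have h2 := congrArg (fun X => X *ᵥ z) this
    simp only [hl, sub_mulVec, RR_mulVec, z3, hG.orth' sb z2, zero_mulVec] at h2
    exact hv (by simpa using h2)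
  · intro u hu
    have ch : e i * hh = hh * e i := by
      have q1 : e i * hh = H i + Q i := by
        rw [hhh, mul_add, mul_add, Finset.mul_sum, Finset.mul_sum, Finset.sum_eq_single i, Finset.sum_eq_single i, eH, eQ, ← mul_assoc, ← pe,
          mul_assoc, ee0]; simp
        · intro j _ hj; rw [← eQ j, ← mul_assoc, hid.2 i j hj.symm, zero_mul]
        · simp
        · intro j _ hj; rw [← eH j, ← mul_assoc, hid.2 i j hj.symm, zero_mul]
        · simp
      have q2 : hh * e i = H i + Q i := by
        rw [hhh, add_mul, add_mul, Finset.sum_mul, Finset.sum_mul, Finset.sum_eq_single i, Finset.sum_eq_single i, He, Qe, mul_assoc, e0e]; simp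
        · intro j _ hj; rw [← Qe j, mul_assoc, hid.2 j i hj, mul_zero]
        · simp
        · intro j _ hj; rw [← He j, mul_assoc, hid.2 j i hj, mul_zero]
        · simp
      rw [q1, q2]
    have u0 := exe u hu
    rw [strF_apply, ← el, ← le, anti_apply]
    have s4 : (hh * u + u * hh) * (e i * (l * e i)) = ((hh * u + u * hh) * e i * l) * e i := by noncomm_ring
    rw [s4, ← str_cyc' (eJ i).1]
    have s5 : e i * ((hh * u + u * hh) * e i * l) = 0 := by
      have : e i * ((hh * u + u * hh) * e i * l) = ((e i * hh) * u * e i + e i * u * (hh * e i)) * l := by noncomm_ring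
      rw [this, ch, ← ch]
      have : e i * hh * u * e i + e i * u * (e i * hh) = (e i * hh) * u * e i + (e i * u * e i) * hh := by noncomm_ring
      rw [this, ch, u0]
      have : hh * e i * u * e i = hh * (e i * u * e i) := by noncomm_ring
      rw [this, u0]; simp
    rw [s5]; simp
end S
end SJ

open Matrix
namespace SJ
set_option linter.unusedSectionVars false
section S
variable {F : Type*} [Field F] [CharZero F] {ι : Type*} [Fintype ι] [DecidableEq ι]
variable {σ G : Matrix ι ι F} {E O : Submodule F (Matrix ι ι F)}

lemma pow_sum_ne {M : ℕ} {k l : ℕ} (hkl : k ≠ l) {a b : ℤ} (ha : a ≠ 0) (hb : b ≠ 0) (ha' : |a| < M) (hb' : |b| < M) :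
    (M : ℤ) ^ k * a + (M : ℤ) ^ l * b ≠ 0 := by
  wlog h : k < l generalizing k l a b
  · rw [add_comm]
    exact this hkl.symm hb ha hb' ha' (lt_of_le_of_ne (not_lt.1 h) hkl.symm)
  intro h0
  obtain ⟨d, rfl⟩ := Nat.exists_eq_add_of_lt h
  have M0 : (M : ℤ) ≠ 0 := by
    intro hM; rw [hM] at ha'; exact absurd (abs_nonneg a) (by omega)
  have h1 : (M : ℤ) ^ k * (a + (M : ℤ) ^ (d+1) * b) = 0 := by rw [← h0]; ring
  rcases mul_eq_zero.1 h1 with h1 | h1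
  · exact pow_ne_zero _ M0 h1
  · have : (M : ℤ) ∣ a := ⟨-((M : ℤ) ^ d * b), by linear_combination h1⟩
    have := Int.le_of_dvd (abs_pos.2 ha) ((dvd_abs _ _).2 this)
    omega

lemma sy {h c f g : Matrix ι ι F} {x y : F} (hc : h * c + c * h = 0) (hf : f * h = x • f) (hg : h * g = y • g)
    (hxy : x + y ≠ 0) : f * c * g = 0 := by
  have : (x + y) • (f * c * g) = 0 := by
    calc (x + y) • (f * c * g) = (x • f) * c * g + f * c * (y • g) := by
          simp only [smul_mul_assoc, mul_smul_comm, add_smul]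
      _ = f * (h * c + c * h) * g := by rw [← hf, ← hg]; noncomm_ring
      _ = 0 := by rw [hc]; simp
  exact (smul_eq_zero.1 this).resolve_left hxy

def Dec (M : ℕ) (h P : Matrix ι ι F) (k : ℕ) : Prop :=
  ∃ f g : Matrix ι ι F, ∃ a b : ℤ, P = f + g ∧ a ≠ 0 ∧ b ≠ 0 ∧ |a| < M ∧ |b| < M ∧
    f * h = ((((M : ℤ) ^ k * a : ℤ)) : F) • f ∧ h * f = ((((M : ℤ) ^ k * a : ℤ)) : F) • f ∧
    g * h = ((((M : ℤ) ^ k * b : ℤ)) : F) • g ∧ h * g = ((((M : ℤ) ^ k * b : ℤ)) : F) • g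

lemma dec_zero {M : ℕ} {h P Q c : Matrix ι ι F} {k l : ℕ} (hkl : k ≠ l) (hP : Dec M h P k) (hQ : Dec M h Q l)
    (hc : h * c + c * h = 0) : P * c * Q = 0 := by
  obtain ⟨f, g, a, b, rfl, a0, b0, a1, b1, l1, l2, l3, l4⟩ := hP
  obtain ⟨f', g', a', b', rfl, a0', b0', a1', b1', l1', l2', l3', l4'⟩ := hQ
  have key : ∀ {x y : ℤ}, x ≠ 0 → y ≠ 0 → |x| < M → |y| < M →
     ((((M : ℤ) ^ k * x : ℤ)) : F) + ((((M : ℤ) ^ l * y : ℤ)) : F) ≠ 0 := by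
    intro x y hx hy hx' hy'
    rw [← Int.cast_add, Int.cast_ne_zero]
    exact pow_sum_ne hkl hx hy hx' hy'
  rw [add_mul, mul_add, add_mul, add_mul, sy hc l1 l2' (key a0 a0' a1 a1'), sy hc l1 l4' (key a0 b0' a1 b1'),
    sy hc l3 l2' (key b0 a0' b1 a1'), sy hc l3 l4' (key b0 b0' b1 b1')]
  simp

lemma trF_nd (h : OG σ G) : ∀ x ∈ J00 σ G, (∀ y ∈ J00 σ G, trF x y = 0) → x = 0 := by
  intro x hx h0
  apply mat_ext
  intro v
  rw [zero_mulVec]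
  apply h.nd_ev (J00_vec hx v)
  intro a ha
  obtain ⟨b, c, hb, hc, rfl⟩ := h.split v
  have c0 : x *ᵥ c = 0 := by
    have := J00_vec hx c
    have h2 : x *ᵥ (σ *ᵥ c) = x *ᵥ c := by rw [mulVec_mulVec, hx.1.2]
    rw [hc, mulVec_neg] at h2
    exact vec_zero_of_neg_self h2.symm
  rw [mulVec_add, c0, add_zero]
  have := h0 _ (RR_J00 h ha hb)
  rw [trF_apply, mul_add, trace_add, mul_RR, mul_RR, trace_RR, trace_RR, ← JE.bil (J00_le hx) b, h.swap a (x *ᵥ b), J00_vec hx] at this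
  exact eq_zero_of_neg_self (by linear_combination this)

lemma tr_le {P : Matrix ι ι F} (hP : P * P = P) {p : ℕ} (hp : P.trace = p) : p ≤ Fintype.card ι := by
  have : (1 - P) * (1 - P) = 1 - P := idem_sub (by simp) (by simp) (by simp) hP
  obtain ⟨k, hk⟩ := idem_trace_nat this
  rw [trace_sub, trace_one, hp, sub_eq_iff_eq_add] at hk
  have : Fintype.card ι = k + p := by exact_mod_cast hk
  omega

lemma locT [IsAlgClosed F] (h : OG σ G) {P : Matrix ι ι F} (hPJ : P ∈ J00 σ G) (PP : P * P = P) (t1 : P.trace ≠ 1) :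
    ∃ (R : Matrix ι ι F) (p : ℕ), R ∈ J00 σ G ∧ P.trace = p ∧ p ≠ 1 ∧ P * R = R ∧ R * P = R ∧ R * R = R ∧
      (p : F) * R.trace = p ∧ (P ≠ 0 → P - R ≠ 0 ∧ ∃ z w, σ *ᵥ z = z ∧ σ *ᵥ w = w ∧ P *ᵥ z = z ∧ P *ᵥ w = w ∧
        R *ᵥ z = z ∧ R *ᵥ w = 0 ∧ bil G z w = 0 ∧ bil G w z = 0 ∧ bil G w w = 1 ∧ bil G z z = 1) := by
  by_cases P0 : P = 0
  · refine ⟨0, 0, zero_mem _, ?_, ?_, ?_, ?_, ?_, ?_, ?_⟩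
    any_goals simp
    · rw [P0]; simp
    · exact fun h => absurd P0 h
  obtain ⟨z, z1, z2, z3⟩ := unit_vec h hPJ PP P0
  have z0 : z ≠ 0 := by rintro rfl; rw [bil_zero_left] at z3; exact zero_ne_one z3
  obtain ⟨PR, RP, hRR, tR⟩ := RR_facts h (J00_le hPJ) z1 z3
  have hRJ : RR G z z ∈ J00 σ G := RR_J00' h z2
  obtain ⟨p, hp⟩ := idem_trace_nat PP
  have S0 : P - RR G z z ≠ 0 := by
    intro hS
    apply t1
    rw [sub_eq_zero.1 hS, tR]
  have SJ := Submodule.sub_mem _ hPJ hRJ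
  obtain ⟨w, w1, w2, w3⟩ := unit_vec h SJ (idem_sub PP PR RP hRR) S0
  have zw : bil G z w = 0 := by
    rw [← w1, ← JE.bil (J00_le SJ), sub_mulVec, z1, RR_mulVec, z3, one_smul, sub_self, bil_zero_left]
  have wz : bil G w z = 0 := by rw [h.swap, w2, zw]
  refine ⟨RR G z z, p, hRJ, hp, ?_, PR, RP, hRR, by rw [tR, mul_one], fun _ => ⟨S0, z, w, z2, w2, z1, ?_, ?_, ?_, zw, wz, w3, z3⟩⟩
  · rintro rfl; exact t1 (by simpa using hp)
  · rw [← w1, mulVec_mulVec, mul_sub, PP, PR]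
  · rw [RR_mulVec, z3, one_smul]
  · rw [RR_mulVec, zw, zero_smul]

theorem lemmaT [IsAlgClosed F] (h : SA σ G E O) {w0 : ι → F} (hw0 : w0 ≠ 0) (hw1 : σ *ᵥ w0 = w0)
    {s : ℕ} {e : Fin s → Matrix ι ι F} (hid : IdFam E s e)
    (hsc : ∀ i, ∀ c ∈ E, ∃ t : F, e i * c * e i = t • e i)
    (hze : ∀ c ∈ E, (1 - ∑ i, e i) * c * (1 - ∑ i, e i) = 0)
    (ht1 : ∀ i, (pr σ * e i).trace ≠ 1) :
    2 * Module.finrank F (E.map (LinearMap.mulLeft F (pr σ))) < Module.finrank F (J00 σ G) := by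
  have hG := h.og
  have eJ : ∀ i, e i ∈ JE σ G := fun i => h.le0 (hid.1 i).1
  have ee : ∀ i, e i * e i = e i := fun i => (hid.1 i).2.2
  have pe : ∀ i, pr σ * e i = e i * pr σ := fun i => pr_JE (eJ i)
  set e0 := 1 - ∑ i, e i with he0
  have e0J : e0 ∈ JE σ G := Submodule.sub_mem _ one_JE (Submodule.sum_mem _ fun i _ => eJ i)
  have e00 : e0 * e0 = e0 := by
    rw [he0, mul_sub, sub_mul, sub_mul, hid.sum_sq]; simp
  have ee0 : ∀ i, e i * e0 = 0 := fun i => by rw [he0, mul_sub, hid.mul_sum, mul_one, sub_self]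
  have e0e : ∀ i, e0 * e i = 0 := fun i => by rw [he0, sub_mul, hid.sum_mul, one_mul, sub_self]
  have pe0 : pr σ * e0 = e0 * pr σ := pr_JE e0J
  obtain ⟨P, hP⟩ : ∃ P : Fin s → Matrix ι ι F, P = fun i => pr σ * e i := ⟨_, rfl⟩
  obtain ⟨P0, hP0⟩ : ∃ P0, P0 = pr σ * e0 := ⟨_, rfl⟩
  have cm : ∀ a b : Matrix ι ι F, pr σ * a = a * pr σ → (pr σ * a) * (pr σ * b) = pr σ * (a * b) := by
    intro a b hab
    calc (pr σ * a) * (pr σ * b) = pr σ * (a * pr σ) * b := by noncomm_ring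
      _ = (pr σ * pr σ) * (a * b) := by rw [← hab]; noncomm_ring
      _ = _ := by rw [pr_pr hG]
  have PP : ∀ i, P i * P i = P i := fun i => by simp only [hP]; rw [cm _ _ (pe i), ee]
  have PO : ∀ i j, i ≠ j → P i * P j = 0 := fun i j hij => by simp only [hP]; rw [cm _ _ (pe i), hid.2 i j hij, mul_zero]
  have P00 : P0 * P0 = P0 := by rw [hP0, cm _ _ pe0, e00]
  have PP0 : ∀ i, P i * P0 = 0 := fun i => by simp only [hP, hP0]; rw [cm _ _ (pe i), ee0, mul_zero]
  have P0P : ∀ i, P0 * P i = 0 := fun i => by simp only [hP, hP0]; rw [cm _ _ pe0, e0e, mul_zero]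
  have PJ : ∀ i, P i ∈ J00 σ G := fun i => by simp only [hP]; exact pr_mul_J00 hG (eJ i)
  have P0J : P0 ∈ J00 σ G := hP0 ▸ pr_mul_J00 hG e0J
  have Psum : pr σ = ∑ i, P i + P0 := by simp only [hP, hP0]; rw [← Finset.mul_sum, ← mul_add, he0]; simp
  set T := E.map (LinearMap.mulLeft F (pr σ)) with hT
  have Tm : ∀ d ∈ T, ∃ c ∈ E, d = pr σ * c := by
    rintro d ⟨c, hc, rfl⟩; exact ⟨c, hc, rfl⟩
  have TJ : T ≤ J00 σ G := by
    intro d hd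
    obtain ⟨c, hc, rfl⟩ := Tm d hd
    exact pr_mul_J00 hG (h.le0 hc)
  have Tsc : ∀ i, ∀ d ∈ T, ∃ t : F, P i * d * P i = t • P i := by
    intro i d hd
    obtain ⟨c, hc, rfl⟩ := Tm d hd
    obtain ⟨t, ht⟩ := hsc i c hc
    refine ⟨t, ?_⟩
    simp only [hP]
    have : pr σ * (e i * c) = (e i * c) * pr σ := by
      rw [← mul_assoc, pe, mul_assoc, pr_JE (h.le0 hc), mul_assoc]
    rw [cm _ _ (pe i), cm _ _ this, ht, mul_smul_comm]
  have Tz : ∀ d ∈ T, P0 * d * P0 = 0 := by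
    intro d hd
    obtain ⟨c, hc, rfl⟩ := Tm d hd
    have : pr σ * (e0 * c) = (e0 * c) * pr σ := by
      rw [← mul_assoc, pe0, mul_assoc, pr_JE (h.le0 hc), mul_assoc]
    rw [hP0, cm _ _ pe0, cm _ _ this, hze c hc, mul_zero]
  have Tm2 : ∀ c ∈ T, ∀ d ∈ T, c * d + d * c ∈ T := by
    intro c hc d hd
    obtain ⟨c, hc', rfl⟩ := Tm c hc
    obtain ⟨d, hd', rfl⟩ := Tm d hd
    clear hc hd
    rename' hc' => hc, hd' => hd
    rw [cm _ _ (pr_JE (h.le0 hc)), cm _ _ (pr_JE (h.le0 hd)), ← mul_add]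
    exact ⟨_, h.s.ee c hc d hd, rfl⟩
  clear_value T
  by_cases hall : ∀ i, P i = 0
  · have T0 : T = ⊥ := by
      rw [eq_bot_iff]
      intro d hd
      have h1 := Tz d hd
      have : P0 = pr σ := by rw [Psum, Finset.sum_eq_zero fun i _ => hall i, zero_add]
      rw [this, pr_J00 (TJ hd), J00_pr (TJ hd)] at h1
      exact (Submodule.mem_bot _).2 h1
    rw [T0, finrank_bot, mul_zero]
    have : J00 σ G ≠ ⊥ := by
      intro hb
      have := RR_J00' hG hw1
      rw [hb, Submodule.mem_bot] at this
      exact RR_ne hG hw0 hw0 this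
    rw [Nat.pos_iff_ne_zero, Ne, Submodule.finrank_eq_zero]
    exact this
  push Not at hall
  obtain ⟨i0, hi0⟩ := hall
  have L := fun i => locT hG (PJ i) (PP i) (by simp only [hP]; exact ht1 i)
  choose R p l1 l2 l3 l4 l5 l6 l7 l8 using L
  have hple : ∀ i, p i ≤ Fintype.card ι := fun i => tr_le (PP i) (l2 i)
  obtain ⟨M, hM⟩ : ∃ M : ℕ, M = Fintype.card ι + 2 := ⟨_, rfl⟩
  obtain ⟨H, hH⟩ : ∃ H : Fin s → Matrix ι ι F, H = fun i => ((M : F) ^ (i.val + 1)) • (P i - (p i : F) • R i) := ⟨_, rfl⟩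
  have HJ : ∀ i, H i ∈ J00 σ G := fun i => by
    simp only [hH]
    exact Submodule.smul_mem _ _ (Submodule.sub_mem _ (PJ i) (Submodule.smul_mem _ _ (l1 i)))
  have PH : ∀ i, P i * H i = H i := fun i => by simp only [hH, mul_smul_comm, mul_sub, PP, l4]
  have HP : ∀ i, H i * P i = H i := fun i => by simp only [hH, smul_mul_assoc, sub_mul, PP, l5]
  obtain ⟨hh, hhh⟩ : ∃ hh, hh = ∑ i, H i + P0 := ⟨_, rfl⟩
  have hhJ : hh ∈ J00 σ G := hhh ▸ Submodule.add_mem _ (Submodule.sum_mem _ fun i _ => HJ i) P0J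
  have Phh : ∀ i, P i * hh = H i := fun i => by
    rw [hhh, mul_add, PP0, add_zero, Finset.mul_sum, Finset.sum_eq_single i, PH]
    · intro j _ hj; rw [← PH j, ← mul_assoc, PO i j hj.symm, zero_mul]
    · simp
  have hhP : ∀ i, hh * P i = H i := fun i => by
    rw [hhh, add_mul, P0P, add_zero, Finset.sum_mul, Finset.sum_eq_single i, HP]
    · intro j _ hj; rw [← HP j, mul_assoc, PO j i hj, mul_zero]
    · simp
  have hP0h : P0 * hh = P0 := by
    rw [hhh, mul_add, P00, Finset.mul_sum, Finset.sum_eq_zero, zero_add]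
    intro j _; rw [← PH j, ← mul_assoc, P0P, zero_mul]
  have hhP0 : hh * P0 = P0 := by
    rw [hhh, add_mul, P00, Finset.sum_mul, Finset.sum_eq_zero, zero_add]
    intro j _; rw [← HP j, mul_assoc, PP0, mul_zero]
  have SPr : ∀ i, (P i - R i) * P i = P i - R i := fun i => by rw [sub_mul, PP, l5]
  have PSr : ∀ i, P i * (P i - R i) = P i - R i := fun i => by rw [mul_sub, PP, l4]
  have Sh : ∀ i, (P i - R i) * hh = ((M : F) ^ (i.val + 1)) • (P i - R i) := fun i => by
    rw [← SPr, mul_assoc, Phh]; simp only [hH, mul_smul_comm, mul_sub, sub_mul, PP, l4, l5, l6]; module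
  have hS : ∀ i, hh * (P i - R i) = ((M : F) ^ (i.val + 1)) • (P i - R i) := fun i => by
    rw [← PSr, ← mul_assoc, hhP]; simp only [hH, smul_mul_assoc, mul_sub, sub_mul, PP, l4, l5, l6]; module
  have Rh : ∀ i, R i * hh = ((M : F) ^ (i.val + 1) * (1 - p i)) • R i := fun i => by
    rw [← l5, mul_assoc, Phh]; simp only [hH, mul_smul_comm, mul_sub, l5, l6]; module
  have hR : ∀ i, hh * R i = ((M : F) ^ (i.val + 1) * (1 - p i)) • R i := fun i => by
    rw [← l4, ← mul_assoc, hhP]; simp only [hH, smul_mul_assoc, sub_mul, l4, l6]; module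
  have M1 : |(1 : ℤ)| < M := by rw [abs_one, hM]; push_cast; omega
  have decP : ∀ i : Fin s, Dec M hh (P i) (i.val + 1) := by
    intro i
    have := hple i
    have := l3 i
    refine ⟨P i - R i, R i, 1, 1 - p i, by abel, one_ne_zero, by omega, M1, ?_, ?_, ?_, ?_, ?_⟩
    · rw [abs_lt]; constructor <;> omega
    · rw [Sh]; push_cast; rw [mul_one]
    · rw [hS]; push_cast; rw [mul_one]
    · rw [Rh]; push_cast; rfl
    · rw [hR]; push_cast; rfl
  have dec0 : Dec M hh P0 0 :=
    ⟨P0, 0, 1, 1, by simp, one_ne_zero, one_ne_zero, M1, M1, by simp [hP0h], by simp [hhP0], by simp, by simp⟩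
  have hinj : ∀ d ∈ T, anti hh d = 0 → d = 0 := by
    intro d hd h0
    rw [anti_apply] at h0
    have dd : d = pr σ * d * pr σ := by rw [pr_J00 (TJ hd), J00_pr (TJ hd)]
    have b1 : ∀ i j, P i * d * P j = 0 := by
      intro i j
      by_cases hij : i = j
      · subst hij
        obtain ⟨t, ht⟩ := Tsc i d hd
        rw [ht]
        by_cases Pi0 : P i = 0
        · rw [Pi0, smul_zero]
        have k1 : (P i - R i) * d * (P i - R i) = 0 := sy h0 (Sh i) (hS i) (by
          have : (M : F) ≠ 0 := by rw [Nat.cast_ne_zero]; omega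
          rw [← two_mul]
          exact mul_ne_zero two_ne_zero (pow_ne_zero _ this))
        have k2 : (P i - R i) * d * (P i - R i) = t • (P i - R i) := by
          calc (P i - R i) * d * (P i - R i) = ((P i - R i) * P i) * d * (P i * (P i - R i)) := by rw [SPr, PSr]
            _ = (P i - R i) * (P i * d * P i) * (P i - R i) := by noncomm_ring
            _ = t • ((P i - R i) * P i * (P i - R i)) := by rw [ht, mul_smul_comm, smul_mul_assoc]
            _ = _ := by rw [SPr, idem_sub (PP i) (l4 i) (l5 i) (l6 i)]
        rw [k1] at k2
        rw [(smul_eq_zero.1 k2.symm).resolve_right (l8 i Pi0).1, zero_smul]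
      · exact dec_zero (by simpa [Fin.val_inj] using hij) (decP i) (decP j) h0
    have b2 : ∀ i, P i * d * P0 = 0 := fun i => dec_zero (by simp) (decP i) dec0 h0
    have b3 : ∀ i, P0 * d * P i = 0 := fun i => dec_zero (by simp) dec0 (decP i) h0
    rw [dd, Psum, add_mul, add_mul, mul_add, mul_add, Tz d hd, add_zero, Finset.sum_mul, Finset.sum_mul_sum,
      Finset.sum_mul, Finset.mul_sum]
    simp [b1, b2, b3]
  have htr : ∀ d ∈ T, (hh * d).trace = 0 := by
    intro d hd
    rw [hhh, add_mul, trace_add, Finset.sum_mul, trace_sum, Finset.sum_eq_zero, zero_add]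
    · rw [← P00, mul_assoc, trace_mul_comm, Tz d hd, trace_zero]
    · intro i _
      obtain ⟨t, ht⟩ := Tsc i d hd
      rw [tr_sc (PH i) (HP i) ht]
      simp only [hH, trace_smul, trace_sub, smul_eq_mul, l7, l2]; ring
  have hmv : ∀ u v : Matrix ι ι F, trF (anti hh u) v = (u * (hh * v + v * hh)).trace := by
    intro u v
    rw [trF_apply, anti_apply, add_mul, trace_add, mul_add, trace_add, mul_assoc, trace_mul_comm, mul_assoc, mul_assoc u hh v, add_comm]
  refine (dim_half trF (J00 σ G) T TJ (trF_nd hG) (anti hh) ?_ hinj ?_).2 ?_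
  · intro u hu
    refine ⟨⟨?_, ?_⟩, ?_⟩
    · rw [anti_apply, mul_add, ← mul_assoc, ← mul_assoc, hhJ.1.1, (TJ hu).1.1]
    · rw [anti_apply, add_mul, mul_assoc, mul_assoc, hhJ.1.2, (TJ hu).1.2]
    · rw [anti_apply, transpose_add, transpose_mul, transpose_mul, add_mul, mul_assoc, mul_assoc, hhJ.2, (TJ hu).2,
        ← mul_assoc, ← mul_assoc, hhJ.2, (TJ hu).2, mul_add]
      rw [add_comm, mul_assoc, mul_assoc]
  · intro u hu v hv
    rw [← htr _ (Tm2 u hu v hv), trF_apply, anti_apply, add_mul, mul_add, trace_add, trace_add, mul_assoc, mul_assoc u,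
      trace_mul_comm u, mul_assoc]
  · obtain ⟨-, z, w, z1, w1, z2, w2, z3, w3, zw, wz, ww, zz⟩ := l8 i0 hi0
    obtain ⟨l, hl⟩ : ∃ l, l = RR G z w + RR G w z := ⟨_, rfl⟩
    have Pl : P i0 * l = l := by rw [hl, mul_add, mul_RR, mul_RR, z2, w2]
    have lP : l * P i0 = l := by rw [hl, add_mul, RR_mul_JE (J00_le (PJ i0)), RR_mul_JE (J00_le (PJ i0)), z2, w2]
    refine ⟨l, hl ▸ RR_J00 hG z1 w1, ?_, ?_⟩
    · intro hlT
      obtain ⟨t, ht⟩ := Tsc i0 l hlT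
      rw [Pl, lP] at ht
      have := congrArg (fun X => bil G w (X *ᵥ z)) ht
      simp only [hl, add_mulVec, RR_mulVec, wz, zz, smul_mulVec, z2, bil_smul_right, zero_smul, zero_add, ww, mul_one, mul_zero] at this
      exact one_ne_zero this
    · intro u hu
      rw [hmv]
      have hz : hh *ᵥ z = ((M : F) ^ (i0.val + 1) * (1 - p i0)) • z := by
        conv_lhs => rw [← z3, mulVec_mulVec, hR, smul_mulVec, z3]
      have hw : hh *ᵥ w = ((M : F) ^ (i0.val + 1)) • w := by
        have Sw : (P i0 - R i0) *ᵥ w = w := by rw [sub_mulVec, w2, w3, sub_zero]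
        conv_lhs => rw [← Sw, mulVec_mulVec, hS, smul_mulVec, Sw]
      have k : hh * l + l * hh = ((M : F) ^ (i0.val + 1) * (2 - p i0)) • l := by
        rw [hl, mul_add, add_mul, mul_RR, mul_RR, RR_mul_JE (J00_le hhJ), RR_mul_JE (J00_le hhJ), hz, hw]
        simp only [RR_smul_left, RR_smul_right]; module
      obtain ⟨t, ht⟩ := Tsc i0 u hu
      rw [k, mul_smul_comm, trace_smul, trace_mul_comm, tr_sc Pl lP ht, hl, trace_add, trace_RR, trace_RR, zw, wz]
      simp

theorem case1 [IsAlgClosed F] {E' O' : Submodule F (Matrix ι ι F)} (h : SA σ G E O) (h' : SA σ G E' O')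
    {w0 : ι → F} (hw0 : w0 ≠ 0) (hw1 : σ *ᵥ w0 = w0)
    (nr : ∀ w, w ≠ 0 → σ *ᵥ w = w → RR G w w ∉ E) (nr' : ∀ w, w ≠ 0 → σ *ᵥ w = w → RR G w w ∉ E')
    (hs : E ⊔ E' = JE σ G) (ho : O ⊔ O' = JO σ G) : False := by
  obtain ⟨s, e, hid, hsc, hze⟩ := exists_idfam h.s.ee h.s.n0
  obtain ⟨s', e', hid', hsc', hze'⟩ := exists_idfam h'.s.ee h'.s.n0
  obtain ⟨S1, S2⟩ := lemmaS h nr hid hsc hze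
  obtain ⟨S1', S2'⟩ := lemmaS h' nr' hid' hsc' hze'
  have d1 := Submodule.finrank_add_le_finrank_add_finrank O O'
  rw [ho] at d1
  have T1 := lemmaT h hw0 hw1 hid hsc hze (fun i hi => by have := S2 i hi; omega)
  have T2 := lemmaT h' hw0 hw1 hid' hsc' hze' (fun i hi => by have := S2' i hi; omega)
  have d2 := Submodule.finrank_add_le_finrank_add_finrank (E.map (LinearMap.mulLeft F (pr σ))) (E'.map (LinearMap.mulLeft F (pr σ)))
  rw [← Submodule.map_sup, hs] at d2
  have : J00 σ G ≤ (JE σ G).map (LinearMap.mulLeft F (pr σ)) := fun a ha => ⟨a, J00_le ha, pr_J00 ha⟩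
  have := Submodule.finrank_mono this
  omega
end S
end SJ

open Matrix
namespace SJ
set_option linter.unusedSectionVars false
section S
variable {F : Type*} [Field F] [CharZero F] {ι : Type*} [Fintype ι] [DecidableEq ι]
variable {σ G : Matrix ι ι F} {E O : Submodule F (Matrix ι ι F)}

lemma dperp (h : OG σ G) (W : Submodule F (ι → F)) {v : ι → F}
    (hv : ∀ u, (∀ a ∈ W, bil G u a = 0) → bil G u v = 0) : v ∈ W := by
  rw [← Subspace.dualAnnihilator_dualCoannihilator_eq (W := W), Submodule.mem_dualCoannihilator]
  intro φ hφ
  rw [Submodule.mem_dualAnnihilator] at hφ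
  have key : ∀ a, bil G ((G * σ)ᵀ *ᵥ (fun i => φ (Pi.single i 1))) a = φ a := by
    intro a
    have h1 : G * σ * G = 1 := by rw [mul_assoc, h.sg, ← mul_assoc, h.gg, h.ss]
    rw [bil, mulVec_transpose, ← dotProduct_mulVec, mulVec_mulVec, h1, one_mulVec]
    conv_rhs => rw [← Finset.univ_sum_single a, map_sum]
    refine Finset.sum_congr rfl fun i _ => ?_
    have : (Pi.single i (a i) : ι → F) = a i • Pi.single i 1 := by
      rw [← Pi.single_smul, smul_eq_mul, mul_one]
    rw [this, map_smul, smul_eq_mul, mul_comm]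
  rw [← key]
  exact hv _ fun a ha => by rw [key]; exact hφ a ha

lemma full_of_nd (L : Matrix ι ι F →ₗ[F] Matrix ι ι F →ₗ[F] F) (U W : Submodule F (Matrix ι ι F)) (hU : U ≤ W)
    (nd : ∀ x ∈ W, (∀ y ∈ U, L x y = 0) → x = 0) : W ≤ U := by
  let φ : W →ₗ[F] Module.Dual F U := ((Submodule.subtype U).dualMap ∘ₗ L) ∘ₗ W.subtype
  have hinj : Function.Injective φ := by
    rw [← LinearMap.ker_eq_bot, LinearMap.ker_eq_bot']
    intro u hu
    apply Subtype.ext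
    apply nd u u.2
    intro y hy
    have : φ u ⟨y, hy⟩ = 0 := by rw [hu]; rfl
    exact this
  have h1 := LinearMap.finrank_le_finrank_of_injective hinj
  rw [Subspace.dual_finrank_eq] at h1
  exact (Submodule.eq_of_le_of_finrank_le hU h1).ge

lemma r1_norm [IsAlgClosed F] (h : SA σ G E O) {w : ι → F} (hw : w ≠ 0) (sw : σ *ᵥ w = w) (hE : RR G w w ∈ E) :
    ∃ w', σ *ᵥ w' = w' ∧ RR G w' w' ∈ E ∧ bil G w' w' = 1 := by
  obtain ⟨w', s1, e1, b1⟩ : ∃ w', σ *ᵥ w' = w' ∧ RR G w' w' ∈ E ∧ bil G w' w' ≠ 0 := by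
    by_cases b0 : bil G w w = 0
    · obtain ⟨c, hc, hc0⟩ : ∃ c ∈ E, bil G (c *ᵥ w) w ≠ 0 := by
        by_contra hcon
        push Not at hcon
        have : RR G w w ∈ trRad E := ⟨hE, fun c hc => by rw [RR_mul_JE (h.le0 hc), trace_RR, hcon c hc]⟩
        rw [h.s.n0, Submodule.mem_bot] at this
        exact RR_ne h.og hw hw this
      have hst : ∀ t : F, σ *ᵥ ((1 + t • c) *ᵥ w) = (1 + t • c) *ᵥ w := fun t =>
        JE.ev (Submodule.add_mem _ one_JE (Submodule.smul_mem _ _ (h.le0 hc))) sw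
      have hEt : ∀ t : F, RR G ((1 + t • c) *ᵥ w) ((1 + t • c) *ᵥ w) ∈ E := fun t => by
        have hj : (1 + t • c) ∈ JE σ G := Submodule.add_mem _ one_JE (Submodule.smul_mem _ _ (h.le0 hc))
        have := h.s.ee.u1 (E.smul_mem t hc) hE
        rwa [mul_RR, RR_mul_JE hj] at this
      have hb : ∀ t : F, bil G ((1 + t • c) *ᵥ w) ((1 + t • c) *ᵥ w) = 2 * t * bil G (c *ᵥ w) w + t ^ 2 * bil G (c *ᵥ w) (c *ᵥ w) := by
        intro t
        simp only [add_mulVec, one_mulVec, smul_mulVec, bil_add_left, bil_add_right, bil_smul_left, bil_smul_right, b0,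
          JE.bil (h.le0 hc) w w]
        ring
      by_cases h1 : bil G ((1 + (1:F) • c) *ᵥ w) ((1 + (1:F) • c) *ᵥ w) = 0
      · refine ⟨_, hst (-1), hEt (-1), ?_⟩
        intro h2
        rw [hb] at h1 h2
        apply hc0
        have : (4 : F) * bil G (c *ᵥ w) w = 0 := by linear_combination h1 - h2
        simpa using this
      · exact ⟨_, hst 1, hEt 1, h1⟩
    · exact ⟨w, sw, hE, b0⟩
  obtain ⟨r, hr⟩ := IsAlgClosed.exists_pow_nat_eq (bil G w' w')⁻¹ (n := 2) (by norm_num)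
  refine ⟨r • w', by rw [mulVec_smul, s1], ?_, ?_⟩
  · rw [RR_smul_left, RR_smul_right]
    exact E.smul_mem _ (E.smul_mem _ e1)
  · rw [bil_smul_left, bil_smul_right, ← mul_assoc, ← pow_two, hr, inv_mul_cancel₀ b1]

theorem rankOne [IsAlgClosed F] (h : SA σ G E O) {w : ι → F} (hw : w ≠ 0) (sw : σ *ᵥ w = w) (hE : RR G w w ∈ E)
    (hne : ¬ (JE σ G ≤ E ∧ JO σ G ≤ O)) :
    (∃ u, u ≠ 0 ∧ σ *ᵥ u = u ∧ (∀ c ∈ E, c *ᵥ u = 0) ∧ (∀ x ∈ O, x *ᵥ u = 0)) ∨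
    (∃ u v, σ *ᵥ u = -u ∧ σ *ᵥ v = -v ∧ bil G u v ≠ 0 ∧ (∀ c ∈ E, c *ᵥ u = 0) ∧ (∀ x ∈ O, x *ᵥ u = 0) ∧
      (∀ c ∈ E, c *ᵥ v = 0) ∧ (∀ x ∈ O, x *ᵥ v = 0)) := by
  obtain ⟨w, sw, hE, ww⟩ := r1_norm h hw sw hE
  clear hw
  have hG := h.og
  have ev : ∀ {c}, c ∈ E → ∀ {v : ι → F}, σ *ᵥ v = v → σ *ᵥ (c *ᵥ v) = c *ᵥ v := fun hc _ hv => JE.ev (h.le0 hc) hv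
  have ev' : ∀ {c}, c ∈ E → ∀ {v : ι → F}, σ *ᵥ v = -v → σ *ᵥ (c *ᵥ v) = -(c *ᵥ v) := fun hc _ hv => JE.od (h.le0 hc) hv
  have od : ∀ {c}, c ∈ O → ∀ {v : ι → F}, σ *ᵥ v = v → σ *ᵥ (c *ᵥ v) = -(c *ᵥ v) := fun hc _ hv => JO.ev (h.le1 hc) hv
  have od' : ∀ {c}, c ∈ O → ∀ {v : ι → F}, σ *ᵥ v = -v → σ *ᵥ (c *ᵥ v) = (c *ᵥ v) := fun hc _ hv => JO.od (h.le1 hc) hv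
  have ewE : RR G w w *ᵥ w = w := by rw [RR_mulVec, ww, one_smul]
  -- basic elements
  have S1 : ∀ c ∈ E, RR G w (c *ᵥ w) + RR G (c *ᵥ w) w ∈ E := by
    intro c hc
    have := h.s.ee _ hE c hc
    rwa [mul_RR, RR_mul_JE (h.le0 hc)] at this
  have D1 : ∀ x ∈ O, RR G w (x *ᵥ w) - RR G (x *ᵥ w) w ∈ O := by
    intro x hx
    have := O.neg_mem (h.s.eo _ hE x hx)
    rw [mul_RR, RR_mul_JO hG (h.le1 hx), od hx sw, RR_neg_right] at this
    convert this using 1; abel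
  have symm : ∀ {a b : ι → F}, σ *ᵥ b = b → bil G b a = bil G a b := fun hb => by rw [hG.swap, hb]
  have S2 : ∀ c ∈ E, ∀ d ∈ E, RR G (c *ᵥ w) (d *ᵥ w) + RR G (d *ᵥ w) (c *ᵥ w) ∈ E := by
    intro c hc d hd
    have k := h.s.ee _ (S1 c hc) _ (S1 d hd)
    have k2 := E.sub_mem (E.sub_mem (E.sub_mem k (E.smul_mem (bil G (c *ᵥ w) w) (S1 d hd))) (E.smul_mem (bil G (d *ᵥ w) w) (S1 c hc)))
      (E.smul_mem (2 * bil G (c *ᵥ w) (d *ᵥ w)) hE)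
    convert k2 using 1
    have q1 : bil G w (c *ᵥ w) = bil G (c *ᵥ w) w := symm sw
    have q2 : bil G w (d *ᵥ w) = bil G (d *ᵥ w) w := symm sw
    have q3 : bil G (d *ᵥ w) (c *ᵥ w) = bil G (c *ᵥ w) (d *ᵥ w) := symm (ev hd sw)
    simp only [add_mul, mul_add, RR_mul_RR, ww, q1, q2, q3]
    module
  have D2 : ∀ x ∈ O, ∀ y ∈ O, RR G (x *ᵥ w) (y *ᵥ w) - RR G (y *ᵥ w) (x *ᵥ w) ∈ E := by
    intro x hx y hy
    have k := h.s.oo _ (D1 x hx) _ (D1 y hy)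
    have k2 := E.neg_mem (E.add_mem k (E.smul_mem (bil G (x *ᵥ w) (y *ᵥ w) - bil G (y *ᵥ w) (x *ᵥ w)) hE))
    convert k2 using 1
    simp only [sub_mul, mul_sub, RR_mul_RR, ww, hG.orth sw (od hx sw), hG.orth sw (od hy sw), hG.orth' (od hx sw) sw,
      hG.orth' (od hy sw) sw]
    module
  have D3 : ∀ c ∈ E, ∀ x ∈ O, RR G (c *ᵥ w) (x *ᵥ w) - RR G (x *ᵥ w) (c *ᵥ w) ∈ O := by
    intro c hc x hx
    have k := h.s.eo _ (S1 c hc) _ (D1 x hx)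
    have k2 := O.sub_mem k (O.smul_mem (bil G (c *ᵥ w) w) (D1 x hx))
    convert k2 using 1
    simp only [add_mul, mul_add, sub_mul, mul_sub, RR_mul_RR, ww, hG.orth sw (od hx sw), hG.orth' (od hx sw) sw,
      hG.orth (ev hc sw) (od hx sw), hG.orth' (od hx sw) (ev hc sw)]
    have q1 : bil G w (c *ᵥ w) = bil G (c *ᵥ w) w := symm sw
    rw [q1]
    module
  -- the submodule W
  let W0 : Submodule F (ι → F) := E.map (((Matrix.mulVecBilin F F).flip w))
  let W1 : Submodule F (ι → F) := O.map (((Matrix.mulVecBilin F F).flip w))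
  have m0 : ∀ v, v ∈ W0 ↔ ∃ c ∈ E, c *ᵥ w = v := fun v => Iff.rfl
  have m1 : ∀ v, v ∈ W1 ↔ ∃ c ∈ O, c *ᵥ w = v := fun v => Iff.rfl
  have w0 : w ∈ W0 := (m0 _).2 ⟨_, hE, ewE⟩
  have p0 : ∀ v ∈ W0, σ *ᵥ v = v := by rintro _ ⟨c, hc, rfl⟩; exact ev hc sw
  have p1 : ∀ v ∈ W1, σ *ᵥ v = -v := by rintro _ ⟨c, hc, rfl⟩; exact od hc sw
  have T00 : ∀ c ∈ E, ∀ a ∈ W0, c *ᵥ a ∈ W0 := by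
    rintro c hc _ ⟨d, hd, rfl⟩
    change c *ᵥ (d *ᵥ w) ∈ W0
    have k := E.sub_mem (h.s.ee c hc _ (S1 d hd)) (S2 c hc d hd)
    simp only [mul_add, add_mul, mul_RR, RR_mul_JE (h.le0 hc)] at k
    have k2 : (RR G w (c *ᵥ (d *ᵥ w)) + RR G (c *ᵥ (d *ᵥ w)) w) ∈ E := by convert k using 1; abel
    have := W0.sub_mem ((m0 _).2 ⟨_, k2, rfl⟩) (W0.smul_mem (bil G (c *ᵥ (d *ᵥ w)) w) w0)
    simpa only [add_mulVec, RR_mulVec, ww, one_smul, add_sub_cancel_left] using this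
  have T10 : ∀ x ∈ O, ∀ a ∈ W0, x *ᵥ a ∈ W1 := by
    rintro x hx _ ⟨d, hd, rfl⟩
    change x *ᵥ (d *ᵥ w) ∈ W1
    have k := O.neg_mem (O.add_mem (h.s.eo _ (S1 d hd) x hx) (D3 d hd x hx))
    simp only [mul_add, add_mul, mul_RR, RR_mul_JO hG (h.le1 hx), od hx sw, od hx (ev hd sw), RR_neg_right] at k
    have k2 : (RR G w (x *ᵥ (d *ᵥ w)) - RR G (x *ᵥ (d *ᵥ w)) w) ∈ O := by convert k using 1; abel
    have := W1.neg_mem ((m1 _).2 ⟨_, k2, rfl⟩)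
    simpa only [sub_mulVec, RR_mulVec, ww, one_smul, hG.orth' (od hx (ev hd sw)) sw, zero_smul, zero_sub, neg_neg] using this
  have T01 : ∀ c ∈ E, ∀ a ∈ W1, c *ᵥ a ∈ W1 := by
    rintro c hc _ ⟨x, hx, rfl⟩
    change c *ᵥ (x *ᵥ w) ∈ W1
    have k := O.sub_mem (h.s.eo c hc _ (D1 x hx)) (D3 c hc x hx)
    simp only [mul_sub, sub_mul, mul_RR, RR_mul_JE (h.le0 hc)] at k
    have k2 : (RR G w (c *ᵥ (x *ᵥ w)) - RR G (c *ᵥ (x *ᵥ w)) w) ∈ O := by convert k using 1; abel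
    have := W1.neg_mem ((m1 _).2 ⟨_, k2, rfl⟩)
    simpa only [sub_mulVec, RR_mulVec, ww, one_smul, hG.orth' (ev' hc (od hx sw)) sw, zero_smul, zero_sub, neg_neg] using this
  have T11 : ∀ x ∈ O, ∀ a ∈ W1, x *ᵥ a ∈ W0 := by
    rintro x hx _ ⟨y, hy, rfl⟩
    change x *ᵥ (y *ᵥ w) ∈ W0
    have k := E.sub_mem (D2 x hx y hy) (h.s.oo x hx _ (D1 y hy))
    simp only [mul_sub, sub_mul, mul_RR, RR_mul_JO hG (h.le1 hx), od hx sw, od' hx (od hy sw), RR_neg_right] at k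
    have k2 : (RR G w (x *ᵥ (y *ᵥ w)) + RR G (x *ᵥ (y *ᵥ w)) w) ∈ E := by convert k using 1; abel
    have := W0.sub_mem ((m0 _).2 ⟨_, k2, rfl⟩) (W0.smul_mem (bil G (x *ᵥ (y *ᵥ w)) w) w0)
    simpa only [add_mulVec, RR_mulVec, ww, one_smul, add_sub_cancel_left] using this
  -- the orthogonal complement
  let W : Submodule F (ι → F) := W0 ⊔ W1
  let N : Submodule F (ι → F) :=
    { carrier := {u | ∀ a ∈ W, bil G u a = 0}
      zero_mem' := fun a _ => bil_zero_left a
      add_mem' := fun hu hv a ha => by rw [bil_add_left, hu a ha, hv a ha, add_zero]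
      smul_mem' := fun r u hu a ha => by rw [bil_smul_left, hu a ha, mul_zero] }
  have TW : ∀ c ∈ E, ∀ a ∈ W, c *ᵥ a ∈ W := by
    intro c hc a ha
    obtain ⟨a0, h0, a1, h1, rfl⟩ := Submodule.mem_sup.1 ha
    rw [mulVec_add]
    exact W.add_mem (Submodule.mem_sup_left (T00 c hc _ h0)) (Submodule.mem_sup_right (T01 c hc _ h1))
  have TW' : ∀ c ∈ O, ∀ a ∈ W, c *ᵥ a ∈ W := by
    intro c hc a ha
    obtain ⟨a0, h0, a1, h1, rfl⟩ := Submodule.mem_sup.1 ha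
    rw [mulVec_add]
    exact W.add_mem (Submodule.mem_sup_right (T10 c hc _ h0)) (Submodule.mem_sup_left (T11 c hc _ h1))
  have sW : ∀ a ∈ W, σ *ᵥ a ∈ W := by
    intro a ha
    obtain ⟨a0, h0, a1, h1, rfl⟩ := Submodule.mem_sup.1 ha
    rw [mulVec_add, p0 _ h0, p1 _ h1]
    exact W.add_mem (Submodule.mem_sup_left h0) (Submodule.mem_sup_right (W1.neg_mem h1))
  have TN : ∀ c ∈ E, ∀ a ∈ N, c *ᵥ a ∈ N := fun c hc a ha b hb => by
    rw [JE.bil (h.le0 hc)]; exact ha _ (TW c hc b hb)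
  have TN' : ∀ c ∈ O, ∀ a ∈ N, c *ᵥ a ∈ N := fun c hc a ha b hb => by
    rw [JO.bil (h.le1 hc)]; exact ha _ (TW' c hc _ (sW b hb))
  have sN : ∀ a ∈ N, σ *ᵥ a ∈ N := fun a ha b hb => by
    rw [hG.bils]; exact ha _ (sW b hb)
  have nN : w ∉ N := fun hN => one_ne_zero (ww.symm.trans (hN w (Submodule.mem_sup_left w0)))
  -- A kills N
  have hom : ∀ {X Y : Matrix ι ι F} {v : ι → F}, (X * Y + Y * X) *ᵥ v = X *ᵥ (Y *ᵥ v) + Y *ᵥ (X *ᵥ v) := by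
    intro X Y v; rw [add_mulVec, mulVec_mulVec, mulVec_mulVec]
  have hom' : ∀ {X Y : Matrix ι ι F} {v : ι → F}, (X * Y - Y * X) *ᵥ v = X *ᵥ (Y *ᵥ v) - Y *ᵥ (X *ᵥ v) := by
    intro X Y v; rw [sub_mulVec, mulVec_mulVec, mulVec_mulVec]
  let K : Submodule F (ι → F) → Submodule F (ι → F) → Submodule F (Matrix ι ι F) → Submodule F (Matrix ι ι F) := fun A B Q =>
    { carrier := {c | c ∈ Q ∧ ∀ v ∈ A, c *ᵥ v ∈ B}
      zero_mem' := ⟨zero_mem _, fun v _ => by rw [zero_mulVec]; exact zero_mem _⟩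
      add_mem' := fun ha hb => ⟨add_mem ha.1 hb.1, fun v hv => by rw [add_mulVec]; exact add_mem (ha.2 v hv) (hb.2 v hv)⟩
      smul_mem' := fun r a ha => ⟨Q.smul_mem r ha.1, fun v hv => by rw [smul_mulVec]; exact B.smul_mem r (ha.2 v hv)⟩ }
  have ideal : ∀ A B : Submodule F (ι → F), (∀ c ∈ E, ∀ a ∈ A, c *ᵥ a ∈ A) → (∀ c ∈ O, ∀ a ∈ A, c *ᵥ a ∈ A) →
     (∀ c ∈ E, ∀ a ∈ B, c *ᵥ a ∈ B) → (∀ c ∈ O, ∀ a ∈ B, c *ᵥ a ∈ B) →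
     (K A B E = ⊥ ∧ K A B O = ⊥) ∨ (K A B E = E ∧ K A B O = O) := by
    intro A B h1 h2 h3 h4
    refine h.s.simp _ _ (fun a ha => ha.1) (fun a ha => ha.1) ?_ ?_ ?_ ?_
    · intro a ha b hb
      exact ⟨h.s.ee a ha b hb.1, fun v hv => by
        rw [hom]; exact B.add_mem (h3 a ha _ (hb.2 v hv)) (hb.2 _ (h1 a ha v hv))⟩
    · intro a ha b hb
      exact ⟨h.s.eo b hb.1 a ha, fun v hv => by
        rw [hom]; exact B.add_mem (hb.2 _ (h2 a ha v hv)) (h4 a ha _ (hb.2 v hv))⟩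
    · intro a ha b hb
      exact ⟨h.s.eo a ha b hb.1, fun v hv => by
        rw [hom]; exact B.add_mem (h3 a ha _ (hb.2 v hv)) (hb.2 _ (h1 a ha v hv))⟩
    · intro a ha b hb
      exact ⟨h.s.oo a ha b hb.1, fun v hv => by
        rw [hom']; exact B.sub_mem (h4 a ha _ (hb.2 v hv)) (hb.2 _ (h2 a ha v hv))⟩
  have kill : (∀ u ∈ N, ∀ c ∈ E, c *ᵥ u = 0) ∧ (∀ u ∈ N, ∀ x ∈ O, x *ᵥ u = 0) := by
    have hz : ∀ (Q : Submodule F (Matrix ι ι F)), ∀ c ∈ Q, ∀ a ∈ (⊥ : Submodule F (ι → F)), c *ᵥ a ∈ (⊥ : Submodule F (ι → F)) := by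
      intro Q c _ a ha
      rw [Submodule.mem_bot] at ha ⊢
      rw [ha, mulVec_zero]
    rcases ideal N ⊥ TN TN' (hz E) (hz O) with ⟨k1, -⟩ | ⟨k1, k2⟩
    · exfalso
      have : RR G w w ∈ K N ⊥ E := ⟨hE, fun v hv => by
        rw [Submodule.mem_bot, RR_mulVec]
        have : bil G w v = 0 := by
          rw [hG.swap, sw]
          exact hv w (Submodule.mem_sup_left w0)
        rw [this, zero_smul]⟩
      rw [k1, Submodule.mem_bot] at this
      rw [this, zero_mulVec] at ewE
      rw [← ewE, bil_zero_left] at ww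
      exact zero_ne_one ww
    · constructor
      · intro u hu c hc
        rw [← k1] at hc
        exact (Submodule.mem_bot _).1 (hc.2 u hu)
      · intro u hu c hc
        rw [← k2] at hc
        exact (Submodule.mem_bot _).1 (hc.2 u hu)
  by_cases hN : ∃ u ∈ N, u ≠ 0
  swap
  · -- W is everything
    exfalso
    push Not at hN
    have all : ∀ v, v ∈ W := fun v => dperp hG W fun u hu => by rw [hN u hu, bil_zero_left]
    have all0 : ∀ v, σ *ᵥ v = v → ∃ c ∈ E, c *ᵥ w = v := by
      intro v hv
      obtain ⟨a0, h0, a1, h1, rfl⟩ := Submodule.mem_sup.1 (all v)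
      rw [mulVec_add, p0 _ h0, p1 _ h1] at hv
      have : a1 = 0 := vec_zero_of_neg_self (add_left_cancel hv).symm
      rw [this, add_zero]
      exact h0
    have all1 : ∀ v, σ *ᵥ v = -v → ∃ c ∈ O, c *ᵥ w = v := by
      intro v hv
      obtain ⟨a0, h0, a1, h1, rfl⟩ := Submodule.mem_sup.1 (all v)
      rw [mulVec_add, p0 _ h0, p1 _ h1, neg_add] at hv
      have : a0 = 0 := vec_zero_of_neg_self (add_right_cancel hv)
      rw [this, zero_add]
      exact h1
    apply hne
    constructor
    · apply full_of_nd trF E _ h.le0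
      intro x hx hx0
      apply mat_ext
      intro v
      obtain ⟨a, b, ha, hb, rfl⟩ := hG.split v
      rw [zero_mulVec, mulVec_add]
      have z1 : x *ᵥ a = 0 := by
        apply hG.nd_ev (JE.ev hx ha)
        intro y hy
        obtain ⟨c, hc, rfl⟩ := all0 a ha
        obtain ⟨d, hd, rfl⟩ := all0 y hy
        have := hx0 _ (S2 c hc d hd)
        rw [trF_apply, mul_add, trace_add, mul_RR, mul_RR, trace_RR, trace_RR, ← JE.bil hx (c *ᵥ w), hG.swap (d *ᵥ w),
          JE.ev hx ha] at this
        exact eq_zero_of_neg_self (by linear_combination this)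
      have z2 : x *ᵥ b = 0 := by
        apply hG.nd_od (JE.od hx hb)
        intro y hy
        obtain ⟨c, hc, rfl⟩ := all1 b hb
        obtain ⟨d, hd, rfl⟩ := all1 y hy
        have := hx0 _ (D2 c hc d hd)
        rw [trF_apply, mul_sub, trace_sub, mul_RR, mul_RR, trace_RR, trace_RR, ← JE.bil hx (c *ᵥ w), hG.swap (d *ᵥ w),
          JE.od hx hb, bil_neg_right] at this
        exact eq_zero_of_neg_self (by linear_combination this)
      rw [z1, z2, add_zero]
    · apply full_of_nd (strF σ) O _ h.le1
      intro x hx hx0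
      apply JO_eq_zero' hG hx
      intro b hb
      apply hG.nd_ev (JO.od hx hb)
      intro a ha
      obtain ⟨c, hc, rfl⟩ := all0 a ha
      obtain ⟨d, hd, rfl⟩ := all1 b hb
      have h1 := hx0 _ (D3 c hc d hd)
      rw [strF_apply, mul_sub, mul_sub, trace_sub, mul_RR, mul_RR, mul_RR, mul_RR, trace_RR, trace_RR, JO.ev hx ha, JO.od hx hb,
        bil_neg_right, hG.swap (x *ᵥ (c *ᵥ w)) (d *ᵥ w), hb, bil_neg_right, JO.bil hx, hb, mulVec_neg, bil_neg_right] at h1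
      exact eq_zero_of_neg_self (by linear_combination -h1)
  obtain ⟨u, hu, u0⟩ := hN
  obtain ⟨a, b, ha, hb, rfl⟩ := hG.split u
  have split : ∀ a b : ι → F, σ *ᵥ a = a → σ *ᵥ b = -b → a + b ∈ N → a ∈ N ∧ b ∈ N := by
    intro a b ha hb hab
    have h1 := sN _ hab
    rw [mulVec_add, ha, hb] at h1
    have h2 := N.add_mem hab h1
    have h3 : a ∈ N := by
      have : (2⁻¹ : F) • (a + b + (a + -b)) ∈ N := N.smul_mem _ h2
      convert this using 1
      rw [show a + b + (a + -b) = (2:F) • a by module, smul_smul, inv_mul_cancel₀ two_ne_zero, one_smul]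
    exact ⟨h3, by simpa using N.sub_mem hab h3⟩
  obtain ⟨aN, bN⟩ := split a b ha hb hu
  by_cases a0 : a = 0
  swap
  · exact Or.inl ⟨a, a0, ha, kill.1 a aN, kill.2 a aN⟩
  right
  have b0 : b ≠ 0 := by rintro rfl; simp [a0] at u0
  obtain ⟨u, huN, hub⟩ : ∃ u ∈ N, bil G u b ≠ 0 := by
    by_contra hcon
    push Not at hcon
    have bW : b ∈ W := dperp hG W hcon
    obtain ⟨c0, h0, c1, h1, hc⟩ := Submodule.mem_sup.1 bW
    have hb2 := hb
    rw [← hc, mulVec_add, p0 _ h0, p1 _ h1, neg_add] at hb2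
    have c00 : c0 = 0 := vec_zero_of_neg_self (add_right_cancel hb2)
    rw [c00, zero_add] at hc
    subst hc
    obtain ⟨x, hx, rfl⟩ := (m1 _).1 h1
    rcases ideal W N TW TW' TN TN' with ⟨-, k2⟩ | ⟨k1, -⟩
    · have : RR G w (x *ᵥ w) - RR G (x *ᵥ w) w ∈ K W N O := ⟨D1 x hx, fun v hv => by
        rw [sub_mulVec, RR_mulVec, RR_mulVec, bN v hv, zero_smul, zero_sub]
        exact N.neg_mem (N.smul_mem _ bN)⟩
      rw [k2, Submodule.mem_bot] at this
      have := congrArg (fun X => X *ᵥ w) this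
      simp only [sub_mulVec, RR_mulVec, ww, hG.orth' hb sw, zero_mulVec, zero_smul, one_smul, zero_sub] at this
      exact b0 (neg_eq_zero.1 this)
    · rw [← k1] at hE
      have := hE.2 w (Submodule.mem_sup_left w0)
      rw [ewE] at this
      exact nN this
  obtain ⟨u1, u2, hu1, hu2, rfl⟩ := hG.split u
  obtain ⟨-, u2N⟩ := split u1 u2 hu1 hu2 huN
  rw [bil_add_left, hG.orth hu1 hb, zero_add] at hub
  exact ⟨u2, b, hu2, hb, hub, kill.1 _ u2N, kill.2 _ u2N, kill.1 _ bN, kill.2 _ bN⟩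
end S
end SJ

open Matrix
namespace SJ
set_option linter.unusedSectionVars false
section S
variable {F : Type*} [Field F] [CharZero F] {ι : Type*} [Fintype ι] [DecidableEq ι]
variable {σ G : Matrix ι ι F} {E O : Submodule F (Matrix ι ι F)}

open Polynomial in
lemma sqrt_poly [IsAlgClosed F] (s : Multiset F) (hs : ∀ a ∈ s, a ≠ 0) :
    ∃ P : F[X], (s.map (fun a => X - C a)).prod ∣ P ^ 2 - X := by
  induction s using Multiset.induction_on with
  | empty => exact ⟨0, by simp⟩
  | cons a s ih =>
    obtain ⟨P, S, hS⟩ := ih fun b hb => hs b (Multiset.mem_cons_of_mem hb)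
    have a0 := hs a (Multiset.mem_cons_self a s)
    set R := (s.map (fun a => X - C a)).prod with hR
    obtain ⟨c, hc⟩ : ∃ c : F, S.eval a + 2 * c * P.eval a + c ^ 2 * R.eval a = 0 := by
      by_cases h0 : R.eval a = 0
      · have h1 : P.eval a ≠ 0 := by
          intro h1
          have := congrArg (eval a) hS
          simp [h0, h1] at this
          exact a0 this
        refine ⟨-(S.eval a) / (2 * P.eval a), ?_⟩
        rw [h0]; field_simp; ring
      · obtain ⟨r, hr⟩ := IsAlgClosed.exists_pow_nat_eq ((P.eval a) ^ 2 - R.eval a * S.eval a) (n := 2) (by norm_num)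
        refine ⟨(r - P.eval a) / R.eval a, ?_⟩
        field_simp
        linear_combination hr
    refine ⟨P + C c * R, ?_⟩
    have h1 : (X - C a) ∣ S + 2 * C c * P + C c ^ 2 * R := by
      rw [dvd_iff_isRoot, IsRoot.def]
      simpa using hc
    obtain ⟨V, hV⟩ := h1
    rw [Multiset.map_cons, Multiset.prod_cons]
    refine ⟨V, ?_⟩
    rw [← hR]
    linear_combination hS + R * hV

open Polynomial in
lemma sqrt_mat [IsAlgClosed F] {D D' : Matrix ι ι F} (h : D * D' = 1) : ∃ P : F[X], aeval D P * aeval D P = D := by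
  obtain ⟨P, hP⟩ := sqrt_poly D.charpoly.roots (by
    intro a ha h0
    subst h0
    have h1 := (mem_roots'.1 ha).2
    rw [IsRoot.def, ← coeff_zero_eq_eval_zero] at h1
    have h2 := D.det_eq_sign_charpoly_coeff
    rw [h1, mul_zero] at h2
    have h3 := congrArg det h
    rw [det_mul, h2, det_one, zero_mul] at h3
    exact zero_ne_one h3)
  refine ⟨P, ?_⟩
  have h4 : (D.charpoly.roots.map (fun a => X - C a)).prod = D.charpoly :=
    ((IsAlgClosed.splits D.charpoly).eq_prod_roots_of_monic D.charpoly_monic).symm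
  rw [h4] at hP
  obtain ⟨Q, hQ⟩ := hP
  have := congrArg (aeval D) hQ
  rw [map_mul, Matrix.aeval_self_charpoly, zero_mul, map_sub, aeval_X, map_pow, sub_eq_zero, pow_two] at this
  exact this

open Polynomial in
lemma invSqrt [IsAlgClosed F] (hE : JC E) {k f d : Matrix ι ι F} (hf : f ∈ E) (hd : d ∈ E) (ff : f * f = f)
    (fk : f * k = k) (kf : k * f = k) (fd : f * d = d) (df : d * f = d) (kd : k * d = f) (dk : d * k = f) :
    ∃ b ∈ E, f * b = b ∧ b * f = b ∧ b * k * b = f ∧ b * b = d := by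
  obtain ⟨D, hD⟩ : ∃ D, D = 1 + (d - f) := ⟨_, rfl⟩
  have hDD : D * (k + (1 - f)) = 1 := by
    rw [hD]; simp only [add_mul, mul_add, mul_sub, sub_mul, one_mul, mul_one, fk, df, dk, ff]; abel
  obtain ⟨P, hP⟩ := sqrt_mat hDD
  obtain ⟨B, hB⟩ : ∃ B, B = aeval D P := ⟨_, rfl⟩
  rw [← hB] at hP
  have Df : D * f = d := by rw [hD]; simp [add_mul, sub_mul, df, ff]
  have fD : f * D = d := by rw [hD]; simp [mul_add, mul_sub, fd, ff]
  have cB : ∀ y, D * y = y * D → B * y = y * B := by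
    intro y hy
    have h1 : Commute y D := hy.symm
    have h2 : y ∈ Subalgebra.centralizer F {D} := by
      rw [Subalgebra.mem_centralizer_iff]; simpa using hy
    have h3 : B ∈ Algebra.adjoin F {D} := by rw [hB]; exact aeval_mem_adjoin_singleton _ _
    have h4 : Commute B y := by
      refine Algebra.adjoin_induction (p := fun z _ => Commute z y) ?_ ?_ ?_ ?_ h3
      · intro z hz; rw [Set.mem_singleton_iff.1 hz]; exact h1.symm
      · intro r; exact Algebra.commutes r y
      · intro a b _ _ ha hb; exact ha.add_left hb
      · intro a b _ _ ha hb; exact ha.mul_left hb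
    exact h4
  have hBf : B * f = f * B := cB f (by rw [Df, fD])
  have hBd : B * d = d * B := cB d (by rw [hD]; simp [add_mul, mul_add, sub_mul, mul_sub, df, fd])
  have hfB : f * (B * f) = B * f := by rw [hBf, ← mul_assoc, ff]
  refine ⟨B * f, ?_, hfB, by rw [mul_assoc, ff], ?_, ?_⟩
  · have e1 : aeval (d - f) (P.comp (1 + X)) = B := by
      rw [aeval_comp, hB, hD]; simp
    obtain ⟨R, hR⟩ : X ∣ P.comp (1 + X) - C ((P.comp (1 + X)).eval 0) := by
      have := X_sub_C_dvd_sub_C_eval (a := (0:F)) (p := P.comp (1 + X))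
      simpa using this
    have e2 : B = (P.comp (1 + X)).eval 0 • 1 + aeval (d - f) (X * R) := by
      rw [← hR, map_sub, e1, aeval_C, Algebra.algebraMap_eq_smul_one]; abel
    have e3 : B * f = (P.comp (1 + X)).eval 0 • f + f * aeval (d - f) (X * R) * f := by
      rw [← hfB, e2]
      simp only [add_mul, mul_add, smul_mul_assoc, one_mul, mul_smul_comm, ff, mul_assoc]
    rw [e3]
    exact add_mem (E.smul_mem _ hf) (hE.u hf (hE.aeval (sub_mem hd hf) (Dvd.intro _ rfl)))
  · have hk : k * B = B * k := by
      calc k * B = k * (f * B) := by rw [← mul_assoc, kf]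
        _ = k * (B * (d * k)) := by rw [dk, hBf]
        _ = (k * d) * B * k := by rw [← mul_assoc B, hBd]; simp only [mul_assoc]
        _ = B * (f * k) := by rw [kd, ← hBf, mul_assoc]
        _ = B * k := by rw [fk]
    calc B * f * k * (B * f) = B * (f * k) * B * f := by simp only [mul_assoc]
      _ = B * (k * B) * f := by rw [fk]; simp only [mul_assoc]
      _ = B * B * (k * f) := by rw [hk]; simp only [mul_assoc]
      _ = B * B * (f * k) := by rw [kf, fk]
      _ = d * k := by rw [hP, ← mul_assoc, Df]
      _ = f := dk
  · rw [mul_assoc, hfB, ← mul_assoc, hP, Df]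
end S
end SJ

open Matrix
namespace SJ
set_option linter.unusedSectionVars false
section S
variable {F : Type*} [Field F] [CharZero F] {ι : Type*} [Fintype ι] [DecidableEq ι]
variable {σ G : Matrix ι ι F} {E O : Submodule F (Matrix ι ι F)}

lemma tr_repr (hr : trRad E = ⊥) (φ : Matrix ι ι F →ₗ[F] F) : ∃ k ∈ E, ∀ m ∈ E, φ m = (k * m).trace := by
  let T : E →ₗ[F] Module.Dual F E := LinearMap.mk₂ F (fun a b => ((a : Matrix ι ι F) * b).trace)
    (by intro a b c; simp [add_mul]) (by intro r a b; simp) (by intro a b c; simp [mul_add]) (by intro r a b; simp)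
  have hi : Function.Injective T := by
    rw [← LinearMap.ker_eq_bot, LinearMap.ker_eq_bot']
    intro a ha
    have : (a : Matrix ι ι F) ∈ trRad E := ⟨a.2, fun b hb => by
      have := LinearMap.congr_fun ha ⟨b, hb⟩
      simpa [T] using this⟩
    rw [hr] at this
    exact Subtype.ext (by simpa using this)
  have hs : Function.Surjective T :=
    (LinearMap.injective_iff_surjective_of_finrank_eq_finrank Subspace.dual_finrank_eq.symm).1 hi
  obtain ⟨k, hk⟩ := hs (φ.comp E.subtype)
  refine ⟨k, k.2, fun m hm => ?_⟩
  have := LinearMap.congr_fun hk ⟨m, hm⟩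
  simpa [T] using this.symm

/-- A spectral idempotent `f` of `k` with partial inverse `d`. -/
structure Sp (E : Submodule F (Matrix ι ι F)) (k f d : Matrix ι ι F) : Prop where
  kE : k ∈ E
  fE : f ∈ E
  dE : d ∈ E
  ff : f * f = f
  fk : f * k = k * f
  fd : f * d = d
  df : d * f = d
  kd : k * d = f
  dk : d * k = f

lemma sp_step {S : Type*} {lam : S → Matrix ι ι F →ₗ[F] F} (hE : JC E) (hr : trRad E = ⊥)
    (step : ∀ s, ∀ c ∈ E, ∃ q : Polynomial F, q ≠ 0 ∧ ∀ t, q.eval t ≠ 0 → ∃ s', ∀ m ∈ E,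
      lam s' m = lam s ((1 + t • c) * m * (1 + t • c)))
    {s : S} {k f d : Matrix ι ι F} (h : Sp E k f d) (hl : ∀ m ∈ E, lam s m = (k * m).trace)
    (hn : f * k ≠ k) : ∃ s' k' f' d', Sp E k' f' d' ∧ (∀ m ∈ E, lam s' m = (k' * m).trace) ∧
      ∃ p : Matrix ι ι F, p * p = p ∧ p ≠ 0 ∧ f' = f + p := by
  obtain ⟨kE, fE, dE, ff, fk, fd, df, kd, dk⟩ := h
  have fkf : f * k * f = f * k := by rw [mul_assoc, ← fk, ← mul_assoc, ff]
  obtain ⟨y, hy⟩ : ∃ y, y = k - f * k := ⟨_, rfl⟩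
  have yE : y ∈ E := by rw [hy, ← fkf]; exact sub_mem kE (hE.u fE kE)
  have fy : f * y = 0 := by rw [hy, mul_sub, ← mul_assoc, ff, sub_self]
  have yf : y * f = 0 := by rw [hy, sub_mul, fkf, fk, sub_self]
  obtain ⟨c, cE, hc⟩ : ∃ c ∈ E, (y * c).trace ≠ 0 := by
    by_contra hcon
    push Not at hcon
    have : y ∈ trRad E := ⟨yE, hcon⟩
    rw [hr, Submodule.mem_bot, hy, sub_eq_zero] at this
    exact hn this.symm
  obtain ⟨c', hc'⟩ : ∃ c', c' = (1 - f) * c * (1 - f) := ⟨_, rfl⟩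
  have cE' : c' ∈ E := by rw [hc']; exact hE.um fE cE
  have fc : f * c' = 0 := by rw [hc', ← mul_assoc, ← mul_assoc]; simp [mul_sub, ff]
  have cf : c' * f = 0 := by rw [hc', mul_assoc]; simp [sub_mul, ff]
  have ht : (y * c').trace ≠ 0 := by
    rwa [hc', ← tr_peirce (by rw [sub_mul, fy, one_mul, sub_zero]) (by rw [mul_sub, yf, mul_one, sub_zero])]
  obtain ⟨q, q0, hq⟩ := step s c' cE'
  let r : Polynomial F := Polynomial.C y.trace + Polynomial.C (2 * (y * c').trace) * Polynomial.X
    + Polynomial.C (y * (c' * c')).trace * Polynomial.X ^ 2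
  have r0 : r ≠ 0 := by
    intro h0
    have := congrArg (fun p => Polynomial.coeff p 1) h0
    simp [r, Polynomial.coeff_X, Polynomial.coeff_C, Polynomial.coeff_X_pow] at this
    exact ht this
  obtain ⟨t, htt⟩ := exists_eval_ne (mul_ne_zero q0 r0)
  rw [Polynomial.eval_mul] at htt
  obtain ⟨s', hs'⟩ := hq t (left_ne_zero_of_mul htt)
  have hrt := right_ne_zero_of_mul htt
  obtain ⟨D, hD⟩ : ∃ D, D = 1 + t • c' := ⟨_, rfl⟩
  rw [← hD] at hs'
  have fD : f * D = f := by rw [hD, mul_add, mul_smul_comm, fc]; simp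
  have Df : D * f = f := by rw [hD, add_mul, smul_mul_assoc, cf]; simp
  have uE : ∀ m ∈ E, D * m * D ∈ E := fun m hm => by rw [hD]; exact hE.u1 (E.smul_mem t cE') hm
  obtain ⟨z, hz⟩ : ∃ z, z = D * y * D := ⟨_, rfl⟩
  have zE : z ∈ E := by rw [hz]; exact uE y yE
  have fz : f * z = 0 := by rw [hz, ← mul_assoc, ← mul_assoc, fD, fy, zero_mul]
  have zf : z * f = 0 := by rw [hz, mul_assoc, Df, mul_assoc, yf, mul_zero]
  have hk' : D * k * D = f * k + z := by
    have e1 : k = f * k + y := by rw [hy]; abel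
    have e2 : D * (f * k) * D = f * k := by
      rw [← mul_assoc, Df, fk, mul_assoc, fD]
    rw [hz, ← e2]
    conv_lhs => rw [e1]
    rw [mul_add, add_mul]
  have hzt : z.trace ≠ 0 := by
    have : z.trace = r.eval t := by
      rw [hz, trace_mul_comm, ← mul_assoc, trace_mul_comm, hD]
      simp [r, mul_add, add_mul, mul_assoc]
      ring
    rwa [this]
  obtain ⟨P, Q, hP, hQ, pp, hnil, hzQ⟩ := fitting z
  obtain ⟨p, hp⟩ : ∃ p, p = Polynomial.aeval z P := ⟨_, rfl⟩
  obtain ⟨w, hw⟩ : ∃ w, w = Polynomial.aeval z (Q * P) := ⟨_, rfl⟩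
  have hX : Polynomial.X ∣ Q * P := Dvd.dvd.mul_left hP Q
  have pE : p ∈ E := by rw [hp]; exact hE.aeval zE hP
  have wE : w ∈ E := by rw [hw]; exact hE.aeval zE hX
  have gz : (1 - f) * z = z := by rw [sub_mul, fz, one_mul, sub_zero]
  have zg : z * (1 - f) = z := by rw [mul_sub, zf, mul_one, sub_zero]
  have gl : ∀ {R : Polynomial F}, Polynomial.X ∣ R → f * Polynomial.aeval z R = 0 := fun {R} hR => by
    have := poly_left gz hR
    rwa [sub_mul, one_mul, sub_eq_self] at this
  have gr : ∀ {R : Polynomial F}, Polynomial.X ∣ R → Polynomial.aeval z R * f = 0 := fun {R} hR => by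
    have := poly_right zg hR
    rwa [mul_sub, mul_one, sub_eq_self] at this
  have fp : f * p = 0 := by rw [hp]; exact gl hP
  have pf : p * f = 0 := by rw [hp]; exact gr hP
  have fw : f * w = 0 := by rw [hw]; exact gl hX
  have wf : w * f = 0 := by rw [hw]; exact gr hX
  rw [← hp] at pp hnil hzQ
  have zw : z * w = p := by rw [hw, map_mul, ← mul_assoc, hzQ, ← hp, pp]
  have wz : w * z = p := by rw [hw, aeval_comm, ← hw, zw]
  have pz : p * z = z * p := by rw [hp, aeval_comm]
  have pw : p * w = w := by
    rw [hw, hp, ← map_mul, mul_comm P, mul_assoc, map_mul, map_mul, ← hp, pp, map_mul, ← hp]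
  have wp : w * p = w := by
    rw [hw, map_mul, ← hp, mul_assoc, pp]
  have kfp : k * f * p = 0 := by rw [mul_assoc, fp, mul_zero]
  have zd : z * d = 0 := by rw [← fd, ← mul_assoc, zf, zero_mul]
  have dz : d * z = 0 := by rw [← df, mul_assoc, fz, mul_zero]
  have dw : d * w = 0 := by rw [← df, mul_assoc, fw, mul_zero]
  refine ⟨s', D * k * D, f + p, d + w, ⟨uE k kE, add_mem fE pE, add_mem dE wE, ?_, ?_, ?_, ?_, ?_, ?_⟩, ?_, p, pp, ?_, rfl⟩
  · simp only [add_mul, mul_add, ff, fp, pf, pp]; simp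
  · rw [hk']
    simp only [add_mul, mul_add, fz, zf, ← mul_assoc, ff, pf, fkf, pz]
    rw [fk, kfp]; simp
  · simp only [add_mul, mul_add, fd, fw, pw]
    rw [← fd, ← mul_assoc, pf]; simp
  · simp only [add_mul, mul_add, df, wf, wp]
    rw [← df, mul_assoc, fp]; simp
  · rw [hk', fk]
    simp only [add_mul, mul_add, zd, zw, mul_assoc, fd, kd, fw]; simp
  · rw [hk']
    simp only [add_mul, mul_add, dz, wz, ← mul_assoc, df, dk, wf]; simp
  · intro m hm
    rw [hs' m hm, hl _ (uE m hm)]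
    rw [mul_assoc D m D, ← mul_assoc, ← mul_assoc, trace_mul_comm]
    simp only [mul_assoc]
  · intro h0
    rw [h0, sub_zero, one_mul] at hnil
    exact hzt (trace_nil hnil)

lemma maxL {S : Type*} (lam : S → Matrix ι ι F →ₗ[F] F) (hE : JC E) (hr : trRad E = ⊥) (s0 : S)
    (step : ∀ s, ∀ c ∈ E, ∃ q : Polynomial F, q ≠ 0 ∧ ∀ t, q.eval t ≠ 0 → ∃ s', ∀ m ∈ E,
      lam s' m = lam s ((1 + t • c) * m * (1 + t • c))) :
    ∃ s k f d, Sp E k f d ∧ (∀ m ∈ E, lam s m = (k * m).trace) ∧ f * k = k := by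
  by_contra hcon
  push Not at hcon
  have key : ∀ n : ℕ, ∃ s k f d, Sp E k f d ∧ (∀ m ∈ E, lam s m = (k * m).trace) ∧ ∃ l : ℕ, n ≤ l ∧ f.trace = l := by
    intro n
    induction n with
    | zero =>
      obtain ⟨k, kE, hk⟩ := tr_repr hr (lam s0)
      exact ⟨s0, k, 0, 0, ⟨kE, zero_mem _, zero_mem _, by simp, by simp, by simp, by simp, by simp, by simp⟩, hk, 0, le_rfl, by simp⟩
    | succ n ih =>
      obtain ⟨s, k, f, d, h, hl, l, hnl, hfl⟩ := ih
      obtain ⟨s', k', f', d', h', hl', p, pp, p0, hf'⟩ := sp_step hE hr step h hl (hcon s k f d h hl)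
      obtain ⟨j, hj⟩ := idem_trace_nat pp
      have j0 : j ≠ 0 := by
        rintro rfl
        exact p0 (idem_tr_zero pp (by simpa using hj))
      exact ⟨s', k', f', d', h', hl', l + j, by omega, by rw [hf', trace_add, hfl, hj]; push_cast; rfl⟩
  obtain ⟨s, k, f, d, h, hl, l, hnl, hfl⟩ := key (Fintype.card ι + 1)
  have := tr_le h.ff hfl
  omega
end S
end SJ

open Matrix
namespace SJ
set_option linter.unusedSectionVars false
section S
variable {F : Type*} [Field F] [CharZero F] {ι : Type*} [Fintype ι] [DecidableEq ι]
variable {σ G : Matrix ι ι F} {E O : Submodule F (Matrix ι ι F)} {u₁ u₂ : ι → F}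

/-- `B` acts on the pair `(u₁,u₂)` as fully as `J` does, and the form `λ` is nonzero. -/
structure St (σ G : Matrix ι ι F) (E O : Submodule F (Matrix ι ι F)) (u₁ u₂ : ι → F) : Prop where
  e : ∀ j ∈ JE σ G, ∃ b ∈ E, b *ᵥ u₁ = j *ᵥ u₁ ∧ b *ᵥ u₂ = j *ᵥ u₂
  o : ∀ j ∈ JO σ G, ∃ b ∈ O, b *ᵥ u₁ = j *ᵥ u₁ ∧ b *ᵥ u₂ = j *ᵥ u₂
  n : ∃ c ∈ E, bil G (c *ᵥ u₁) u₂ ≠ 0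

def lamP (G : Matrix ι ι F) (u₁ u₂ : ι → F) : Matrix ι ι F →ₗ[F] F where
  toFun m := bil G (m *ᵥ u₁) u₂
  map_add' a b := by rw [add_mulVec, bil_add_left]
  map_smul' a b := by rw [smul_mulVec, bil_smul_left]; rfl

lemma JE_conj {D j : Matrix ι ι F} (hD : D ∈ JE σ G) (hj : j ∈ JE σ G) : D * j * D ∈ JE σ G := by
  refine ⟨?_, ?_⟩
  · rw [← mul_assoc, ← mul_assoc, hD.1, mul_assoc D, hj.1, mul_assoc, mul_assoc, hD.1]; simp only [mul_assoc]
  · rw [transpose_mul, transpose_mul, mul_assoc, mul_assoc, hD.2, ← mul_assoc jᵀ, hj.2, ← mul_assoc, ← mul_assoc, hD.2]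
    simp only [mul_assoc]

lemma JO_conj {D j : Matrix ι ι F} (hD : D ∈ JE σ G) (hj : j ∈ JO σ G) : D * j * D ∈ JO σ G := by
  refine ⟨?_, ?_⟩
  · rw [← mul_assoc, ← mul_assoc, hD.1, mul_assoc D, hj.1]
    simp only [mul_neg, neg_mul, mul_assoc, hD.1]
  · rw [transpose_mul, transpose_mul, mul_assoc, mul_assoc, hD.2, ← mul_assoc jᵀ, hj.2, mul_assoc _ σ, hD.1, ← mul_assoc, ← mul_assoc, ← mul_assoc, hD.2]
    simp only [mul_assoc]

lemma lamP_conj {D : Matrix ι ι F} (hD : D ∈ JE σ G) (m : Matrix ι ι F) :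
    lamP G (D *ᵥ u₁) (D *ᵥ u₂) m = lamP G u₁ u₂ (D * m * D) := by
  change bil G _ _ = bil G _ _
  rw [← JE.bil hD]; simp only [mulVec_mulVec, mul_assoc]

lemma St.step (h : SA σ G E O) (hs : St σ G E O u₁ u₂) {c D' : Matrix ι ι F} (hc : c ∈ E) (hD : (1 + c) * D' = 1) :
    St σ G E O ((1 + c) *ᵥ u₁) ((1 + c) *ᵥ u₂) := by
  have hD' : D' * (1 + c) = 1 := mul_eq_one_comm.1 hD
  have h2 := h.s.ee.inv hc hD
  have hJ : 1 + c ∈ JE σ G := add_mem one_JE (h.le0 hc)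
  have e1 : D' = 1 + (D' - 1) := by abel
  obtain ⟨D, rfl⟩ : ∃ D, D = 1 + c := ⟨_, rfl⟩
  have key : ∀ {b j : Matrix ι ι F} {u : ι → F}, b *ᵥ u = ((1 + c) * j * (1 + c)) *ᵥ u →
      (D' * b * D') *ᵥ ((1 + c) *ᵥ u) = j *ᵥ ((1 + c) *ᵥ u) := by
    intro b j u hb
    rw [mulVec_mulVec, mul_assoc, hD', mul_one, ← mulVec_mulVec, hb, mulVec_mulVec, mulVec_mulVec, ← mul_assoc, ← mul_assoc, hD', one_mul]
  refine ⟨fun j hj => ?_, fun j hj => ?_, ?_⟩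
  · obtain ⟨b, hb, b1, b2⟩ := hs.e _ (JE_conj hJ hj)
    refine ⟨D' * b * D', ?_, key b1, key b2⟩
    rw [e1]; exact h.s.ee.u1 h2 hb
  · obtain ⟨b, hb, b1, b2⟩ := hs.o _ (JO_conj hJ hj)
    refine ⟨D' * b * D', ?_, key b1, key b2⟩
    rw [e1]; exact h.s.u1o h2 hb
  · obtain ⟨m, hm, hn⟩ := hs.n
    refine ⟨D' * m * D', ?_, ?_⟩
    · rw [e1]; exact h.s.ee.u1 h2 hm
    · have := lamP_conj (u₁ := u₁) (u₂ := u₂) hJ (D' * m * D')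
      have e2 : (1 + c) * (D' * m * D') * (1 + c) = m := by
        rw [← mul_assoc, ← mul_assoc, hD, one_mul, mul_assoc, hD', mul_one]
      rw [e2] at this
      exact fun h0 => hn (this.symm.trans h0)

lemma normal [IsAlgClosed F] (h : SA σ G E O) (hs : St σ G E O u₁ u₂) :
    ∃ D, σ * D = D * σ ∧ St σ G E O (D *ᵥ u₁) (D *ᵥ u₂) ∧ ∃ f ∈ E, f * f = f ∧ f ≠ 0 ∧
      (∀ c ∈ E, bil G (c *ᵥ (D *ᵥ u₁)) (D *ᵥ u₂) = (f * c).trace) ∧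
      bil G (D *ᵥ u₁) (D *ᵥ u₂) ≠ 0 := by
  let S := {D : Matrix ι ι F // σ * D = D * σ ∧ St σ G E O (D *ᵥ u₁) (D *ᵥ u₂)}
  have mk : ∀ (s : S) c, c ∈ E → ∀ D', (1 + c) * D' = 1 → ∃ s' : S, s'.1 = (1 + c) * s.1 := by
    intro s c hc D' hD
    refine ⟨⟨(1 + c) * s.1, ?_, ?_⟩, rfl⟩
    · have : σ * (1 + c) = (1 + c) * σ := (add_mem one_JE (h.le0 hc) : 1 + c ∈ JE σ G).1
      rw [← mul_assoc, this, mul_assoc, s.2.1, mul_assoc]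
    · have := s.2.2.step h hc hD
      simpa only [mulVec_mulVec] using this
  obtain ⟨s, k, f, d, ⟨kE, fE, dE, ff, fk, fd, df, kd, dk⟩, hl, hk⟩ :=
    maxL (S := S) (fun s => lamP G (s.1 *ᵥ u₁) (s.1 *ᵥ u₂)) h.s.ee h.s.n0 ⟨1, by simp, by simpa using hs⟩ (by
      intro s c hc
      obtain ⟨q, q0, hq⟩ := generic_unit c
      refine ⟨q, q0, fun t ht => ?_⟩
      obtain ⟨D', hD⟩ := hq t ht
      obtain ⟨s', hs'⟩ := mk s _ (E.smul_mem t hc) D' hD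
      refine ⟨s', fun m hm => ?_⟩
      change lamP _ _ _ _ = lamP _ _ _ _
      rw [hs', ← lamP_conj (add_mem one_JE (h.le0 (E.smul_mem t hc)))]
      simp only [mulVec_mulVec])
  obtain ⟨b, bE, fb, bf, bkb, bb⟩ := invSqrt h.s.ee fE dE ff hk (fk ▸ hk) fd df kd dk
  have hbc : b - f ∈ E := sub_mem bE fE
  have hfk' : k * f = k := fk ▸ hk
  obtain ⟨s', hs'⟩ := mk s _ hbc ((1 - f) + b * k) (by
    have : (1 + (b - f)) * (1 - f + b * k) = 1 - f * 1 + f * f - f + (b - b * f) + b * b * k + b * k - (f * b) * k := by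
      noncomm_ring
    rw [this, ff, bf, fb, bb, dk]; simp)
  have hl' : ∀ m ∈ E, bil G (m *ᵥ (s'.1 *ᵥ u₁)) (s'.1 *ᵥ u₂) = (f * m).trace := by
    intro m hm
    have e1 := lamP_conj (u₁ := s.1 *ᵥ u₁) (u₂ := s.1 *ᵥ u₂) (add_mem one_JE (h.le0 hbc) : 1 + (b - f) ∈ JE σ G) m
    have e2 := hl _ (h.s.ee.u1 hbc hm)
    change lamP _ _ _ _ = _
    rw [hs', ← mulVec_mulVec, ← mulVec_mulVec, e1, e2]
    have e3 : k * (1 + (b - f)) = k * b := by simp only [mul_add, mul_sub, mul_one, hfk']; abel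
    have e4 : (1 + (b - f)) * (k * b) = f := by
      simp only [add_mul, sub_mul, one_mul, ← mul_assoc, hk, bkb]; abel
    rw [← mul_assoc, ← mul_assoc, e3, trace_mul_comm, ← mul_assoc, e4]
  have f0 : f ≠ 0 := by
    rintro rfl
    obtain ⟨c, hc, hn⟩ := s'.2.2.n
    exact hn (by rw [hl' c hc]; simp)
  refine ⟨s'.1, s'.2.1, s'.2.2, f, fE, ff, f0, hl', ?_⟩
  obtain ⟨e, eE, e1, e2⟩ := s'.2.2.e 1 one_JE
  rw [one_mulVec] at e1 e2
  have h1 := hl' _ (h.s.ee e eE f fE)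
  have h2 := hl' _ eE
  have h3 := hl' _ fE
  rw [e1] at h2
  rw [add_mulVec, ← mulVec_mulVec, ← mulVec_mulVec, e1, bil_add_left, JE.bil (h.le0 eE), e2, h3, mul_add, trace_add,
    ← mul_assoc f e f, trace_mul_comm (f * e), ← mul_assoc, ff, ← h2] at h1
  intro h0
  rw [h0] at h1
  have : f.trace = 0 := by
    have : (2 : F) * f.trace = 0 := by linear_combination h1
    simpa using this
  exact f0 (idem_tr_zero ff this)
end S
end SJ

open Matrix
namespace SJ
set_option linter.unusedSectionVars false
section S
variable {F : Type*} [Field F] [CharZero F] {ι : Type*} [Fintype ι] [DecidableEq ι]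
variable {σ G : Matrix ι ι F} {E O : Submodule F (Matrix ι ι F)} {u₁ u₂ : ι → F}

lemma common_eig [IsAlgClosed F] (C : Set (Matrix ι ι F)) (hC : ∀ a ∈ C, ∀ b ∈ C, a * b = b * a)
    (W₀ : Submodule F (ι → F)) (h0 : W₀ ≠ ⊥) (hW : ∀ a ∈ C, ∀ w ∈ W₀, a *ᵥ w ∈ W₀) :
    ∃ w ∈ W₀, w ≠ 0 ∧ ∀ a ∈ C, ∃ t : F, a *ᵥ w = t • w := by
  obtain ⟨W, ⟨hWle, hWne, hWi⟩, hmin⟩ := WellFounded.has_min (wellFounded_lt (α := Submodule F (ι → F)))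
    {W | W ≤ W₀ ∧ W ≠ ⊥ ∧ ∀ a ∈ C, ∀ w ∈ W, a *ᵥ w ∈ W} ⟨W₀, le_rfl, h0, hW⟩
  obtain ⟨w, hw, w0⟩ := (Submodule.ne_bot_iff _).1 hWne
  refine ⟨w, hWle hw, w0, fun a ha => ?_⟩
  haveI : Nontrivial W := Submodule.nontrivial_iff_ne_bot.2 hWne
  obtain ⟨t, ht⟩ := Module.End.exists_eigenvalue ((Matrix.mulVecLin a).restrict (hWi a ha))
  obtain ⟨x, hx⟩ := ht.exists_hasEigenvector
  have hx1 : a *ᵥ (x : ι → F) = t • (x : ι → F) := by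
    have := congrArg Subtype.val hx.apply_eq_smul
    exact this
  let W' : Submodule F (ι → F) := W ⊓ LinearMap.ker (Matrix.mulVecLin a - t • LinearMap.id)
  have mem : ∀ y, y ∈ W' ↔ y ∈ W ∧ a *ᵥ y = t • y := fun y => by
    simp [W', sub_eq_zero]
  have : ¬ W' < W := hmin W' ⟨inf_le_left.trans hWle, by
    rw [Submodule.ne_bot_iff]
    exact ⟨x, (mem _).2 ⟨x.2, hx1⟩, fun h => hx.2 (Subtype.ext h)⟩, by
    intro b hb y hy
    rw [mem] at hy ⊢
    refine ⟨hWi b hb y hy.1, ?_⟩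
    rw [mulVec_mulVec, hC a ha b hb, ← mulVec_mulVec, hy.2, mulVec_smul]⟩
  have e : W' = W := by
    by_contra hne
    exact this (lt_of_le_of_ne inf_le_left hne)
  rw [← e] at hw
  exact ⟨t, ((mem w).1 hw).2⟩

lemma J_od_onto (hG : OG σ G) {v : ι → F} (hv : σ *ᵥ v = v) (h0 : v ≠ 0) (a : ι → F) (ha : σ *ᵥ a = -a) :
    ∃ j ∈ JO σ G, j *ᵥ v = a := by
  obtain ⟨y, hy, hy1⟩ : ∃ y, σ *ᵥ y = y ∧ bil G y v ≠ 0 := by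
    by_contra hcon
    push Not at hcon
    exact h0 (hG.nd_ev hv hcon)
  refine ⟨(-(bil G y v)⁻¹) • (RR G y a - RR G a y), Submodule.smul_mem _ _ (RR_JO hG hy ha), ?_⟩
  rw [smul_mulVec, sub_mulVec, RR_mulVec, RR_mulVec, hG.orth' ha hv, zero_smul, zero_sub, smul_neg, smul_smul]
  rw [neg_mul, inv_mul_cancel₀ hy1]; simp

theorem caseK [IsAlgClosed F] (h : SA σ G E O) {v : ι → F} (v0 : v ≠ 0) (sv : σ *ᵥ v = v)
    (he : ∀ j ∈ JE σ G, ∃ b ∈ E, b *ᵥ v = j *ᵥ v) (ho : ∀ j ∈ JO σ G, ∃ b ∈ O, b *ᵥ v = j *ᵥ v) :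
    ∃ w, w ≠ 0 ∧ σ *ᵥ w = w ∧ RR G w w ∈ E := by
  have hG := h.og
  have hs : St σ G E O v v := by
    refine ⟨fun j hj => ?_, fun j hj => ?_, ?_⟩
    · obtain ⟨b, hb, e⟩ := he j hj
      exact ⟨b, hb, e, e⟩
    · obtain ⟨b, hb, e⟩ := ho j hj
      exact ⟨b, hb, e, e⟩
    · by_contra hcon
      push Not at hcon
      refine v0 (hG.nd_ev sv fun a ha => ?_)
      obtain ⟨j, hj, ja⟩ := J_ev_onto hG sv v0 a ha
      obtain ⟨b, hb, e⟩ := he j (J00_le hj)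
      rw [← ja, ← e]; exact hcon b hb
  obtain ⟨D, hD, hs', f, fE, ff, f0, hl, bu⟩ := normal h hs
  obtain ⟨u, hu⟩ : ∃ u, u = D *ᵥ v := ⟨_, rfl⟩
  rw [← hu] at hs' hl bu
  have su : σ *ᵥ u = u := by rw [hu, mulVec_mulVec, hD, ← mulVec_mulVec, sv]
  have u0 : u ≠ 0 := by rintro h0; rw [h0, bil_zero_left] at bu; exact bu rfl
  have fJ := h.le0 fE
  have sym : ∀ {a b : ι → F}, σ *ᵥ b = b → bil G b a = bil G a b := fun {a b} hb => by rw [hG.swap, hb]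
  have onto : ∀ a, σ *ᵥ a = a → ∃ c ∈ E, c *ᵥ u = a := fun a ha => by
    obtain ⟨j, hj, ja⟩ := J_ev_onto hG su u0 a ha
    obtain ⟨b, hb, e, _⟩ := hs'.e j (J00_le hj)
    exact ⟨b, hb, e.trans ja⟩
  have fu : f *ᵥ u = u := by
    have : u - f *ᵥ u = 0 := by
      refine hG.nd_ev (by rw [mulVec_sub, JE.ev fJ su, su]) fun a ha => ?_
      obtain ⟨c, hc, rfl⟩ := onto a ha
      have h1 := hl _ (sub_mem (add_mem hc hc) (h.s.ee c hc f fE))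
      have h2 : (f * (c + c - (c * f + f * c))).trace = 0 := by
        have : f * (c + c - (c * f + f * c)) = f * c + f * c - f * c * f - f * f * c := by noncomm_ring
        rw [this, trace_sub, trace_sub, trace_add, trace_mul_comm (f * c) f, ← mul_assoc, ff]; ring
      have h3 : bil G ((c * f) *ᵥ u) u = bil G (c *ᵥ u) (f *ᵥ u) := by
        rw [← mulVec_mulVec, JE.bil (h.le0 hc), sym (JE.ev fJ su)]
      have h4 : bil G ((f * c) *ᵥ u) u = bil G (c *ᵥ u) (f *ᵥ u) := by rw [← mulVec_mulVec, JE.bil fJ]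
      rw [h2, sub_mulVec, add_mulVec, add_mulVec, bil_sub_left, bil_add_left, bil_add_left, h3, h4] at h1
      rw [bil_sub_right]
      have : (2 : F) * (bil G (c *ᵥ u) u - bil G (c *ᵥ u) (f *ᵥ u)) = 0 := by linear_combination h1
      simpa using this
    rw [sub_eq_zero] at this
    exact this.symm
  have fodd : ∀ a, σ *ᵥ a = -a → f *ᵥ a = 0 := by
    have key : ∀ a, σ *ᵥ a = -a → ∃ x ∈ O, f * x = x ∧ x * f = x ∧ x *ᵥ u = f *ᵥ a := fun a ha => by
      obtain ⟨j, hj, ja⟩ := J_od_onto hG su u0 a ha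
      obtain ⟨b, hb, e, _⟩ := hs'.o j hj
      refine ⟨f * b * f, h.s.uo fE hb, by simp only [← mul_assoc, ff], by rw [mul_assoc, ff], ?_⟩
      rw [← mulVec_mulVec, fu, ← mulVec_mulVec, e, ja]
    intro a ha
    refine hG.nd_od (JE.od fJ ha) fun b hb => ?_
    obtain ⟨x, hx, fx, xf, xu⟩ := key a ha
    obtain ⟨y, hy, fy, yf, yu⟩ := key b hb
    have h1 := hl _ (h.s.oo x hx y hy)
    rw [mul_sub, ← mul_assoc, ← mul_assoc, fx, fy, trace_sub, trace_mul_comm, sub_self, sub_mulVec, bil_sub_left,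
      ← mulVec_mulVec, ← mulVec_mulVec, JO.bil (h.le1 hx) (y *ᵥ u), JO.bil (h.le1 hy) (x *ᵥ u), su, hG.swap (y *ᵥ u), JO.ev (h.le1 hx) su, bil_neg_right,
      xu, yu, JE.bil fJ, mulVec_mulVec, ff] at h1
    have : (2 : F) * bil G b (f *ᵥ a) = 0 := by linear_combination h1
    simpa using this
  -- the Peirce 1-space
  let C : Set (Matrix ι ι F) := {c | c ∈ E ∧ f * c = c ∧ c * f = c}
  have ontoC : ∀ a, σ *ᵥ a = a → ∃ c ∈ C, c *ᵥ u = f *ᵥ a := fun a ha => by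
    obtain ⟨c, hc, e⟩ := onto a ha
    refine ⟨f * c * f, ⟨h.s.ee.u fE hc, by simp only [← mul_assoc, ff], by rw [mul_assoc, ff]⟩, ?_⟩
    rw [← mulVec_mulVec, fu, ← mulVec_mulVec, e]
  have hlC : ∀ c, c ∈ C → bil G (c *ᵥ u) u = c.trace := fun c hc => by rw [hl c hc.1, hc.2.1]
  have killC : ∀ x : Matrix ι ι F, x * f = x → (∀ d ∈ C, (x * d) *ᵥ u = 0) → x = 0 := by
    intro x xf hx
    refine mat_ext fun y => ?_
    obtain ⟨a, b, ha, hb, rfl⟩ := hG.split y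
    obtain ⟨d, hd, hd1⟩ := ontoC a ha
    rw [← xf, ← mulVec_mulVec, mulVec_add, fodd b hb, add_zero, ← hd1, mulVec_mulVec, hx d hd, zero_mulVec]
  have tri : ∀ b ∈ C, ∀ c ∈ C, ∀ d ∈ C, (2 : F) * bil G ((d * b * c) *ᵥ u) u = (d * b * c).trace + (c * b * d).trace := by
    intro b hb c hc d hd
    have h1 := hlC (d * b * c + c * b * d) ⟨h.s.ee.tri hd.1 hb.1 hc.1, by simp only [mul_add, ← mul_assoc, hd.2.1, hc.2.1],
      by simp only [add_mul, mul_assoc, hd.2.2, hc.2.2]⟩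
    rw [trace_add, add_mulVec, bil_add_left] at h1
    have h2 : bil G ((c * b * d) *ᵥ u) u = bil G ((d * b * c) *ᵥ u) u := by
      have : ∀ a ∈ C, a ∈ JE σ G := fun a ha => h.le0 ha.1
      rw [← mulVec_mulVec, ← mulVec_mulVec, JE.bil (this c hc), JE.bil (this b hb), JE.bil (this d hd), ← sym]
      · simp only [mulVec_mulVec, mul_assoc]
      · exact JE.ev (this d hd) (JE.ev (this b hb) (JE.ev (this c hc) su))
    linear_combination h1 - h2
  have com : ∀ b ∈ C, ∀ c ∈ C, (b * c) *ᵥ u = (c * b) *ᵥ u := by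
    intro b hb c hc
    have hb' := h.le0 hb.1
    have hc' := h.le0 hc.1
    have : (b * c) *ᵥ u - (c * b) *ᵥ u = 0 := by
      rw [← mulVec_mulVec, ← mulVec_mulVec]
      refine hG.nd_ev (by rw [mulVec_sub, JE.ev hb' (JE.ev hc' su), JE.ev hc' (JE.ev hb' su)]) fun a ha => ?_
      obtain ⟨d, hd, hd1⟩ := ontoC a ha
      have e1 : b *ᵥ c *ᵥ u - c *ᵥ b *ᵥ u = f *ᵥ (b *ᵥ c *ᵥ u - c *ᵥ b *ᵥ u) := by
        rw [mulVec_sub]; simp only [mulVec_mulVec, ← mul_assoc, hb.2.1, hc.2.1]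
      rw [e1, ← JE.bil fJ, ← hd1, bil_sub_right]
      have e2 : ∀ x y : Matrix ι ι F, bil G (d *ᵥ u) (x *ᵥ y *ᵥ u) = bil G ((d * x * y) *ᵥ u) u := fun x y => by
        rw [hG.swap, JE.ev (h.le0 hd.1) su, ← JE.bil (h.le0 hd.1)]; simp only [mulVec_mulVec, mul_assoc]
      have e3 := tri b hb c hc d hd
      have e4 := tri c hc b hb d hd
      have e5 : (d * b * c).trace = (b * c * d).trace := by rw [mul_assoc, trace_mul_comm]
      have e6 : (d * c * b).trace = (c * b * d).trace := by rw [mul_assoc, trace_mul_comm]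
      rw [e2, e2]
      have : (2 : F) * (bil G ((d * b * c) *ᵥ u) u - bil G ((d * c * b) *ᵥ u) u) = 0 := by
        linear_combination e3 - e4 + e5 - e6
      simpa using this
    rwa [sub_eq_zero] at this
  have mulC : ∀ b ∈ C, ∀ c ∈ C, b * c + c * b ∈ C := fun b hb c hc =>
    ⟨h.s.ee b hb.1 c hc.1, by simp only [mul_add, ← mul_assoc, hb.2.1, hc.2.1], by simp only [add_mul, mul_assoc, hb.2.2, hc.2.2]⟩
  have comC : ∀ b ∈ C, ∀ c ∈ C, b * c = c * b := by
    intro b hb c hc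
    rw [← sub_eq_zero]
    refine killC _ (by simp only [sub_mul, mul_assoc, hb.2.2, hc.2.2]) fun d hd => ?_
    have c1 : ∀ x y z : Matrix ι ι F, x ∈ C → y ∈ C → (z * x * y) *ᵥ u = (z * y * x) *ᵥ u := fun x y z hx hy => by
      rw [mul_assoc, ← mulVec_mulVec, com x hx y hy, mulVec_mulVec, mul_assoc]
    have a1 := com b hb _ (mulC c hc d hd)
    have a2 := com c hc _ (mulC b hb d hd)
    simp only [mul_add, add_mul, add_mulVec, ← mul_assoc] at a1 a2
    rw [c1 d c b hd hc, c1 d b c hd hb, c1 c b d hc hb] at a1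
    rw [c1 d b c hd hb, c1 d c b hd hc] at a2
    have : (3 : F) • (((b * c - c * b) * d) *ᵥ u) = 0 := by
      rw [sub_mul, sub_mulVec]
      ext i
      have h1 := congrFun a1 i
      have h2 := congrFun a2 i
      simp only [Pi.add_apply, Pi.smul_apply, Pi.sub_apply, Pi.zero_apply, smul_eq_mul] at h1 h2 ⊢
      linear_combination h1 - h2
    simpa using this
  let W₀ : Submodule F (ι → F) := LinearMap.ker (Matrix.mulVecLin σ - LinearMap.id) ⊓ LinearMap.ker (Matrix.mulVecLin f - LinearMap.id)
  have mem : ∀ y, y ∈ W₀ ↔ σ *ᵥ y = y ∧ f *ᵥ y = y := fun y => by simp [W₀, sub_eq_zero]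
  obtain ⟨w, hw, w0, hwC⟩ := common_eig C comC W₀
    ((Submodule.ne_bot_iff _).2 ⟨u, (mem u).2 ⟨su, fu⟩, u0⟩) (by
      intro a ha y hy
      rw [mem] at hy ⊢
      exact ⟨JE.ev (h.le0 ha.1) hy.1, by rw [mulVec_mulVec, ha.2.1]⟩)
  obtain ⟨sw, fw⟩ := (mem w).1 hw
  refine ⟨w, w0, sw, ?_⟩
  obtain ⟨c, hc, cu⟩ := ontoC w sw
  rw [fw] at cu
  have hφ : ∀ y, ∃ t : F, c *ᵥ y = t • w := by
    intro y
    obtain ⟨a, b, ha, hb, rfl⟩ := hG.split y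
    obtain ⟨d, hd, hd1⟩ := ontoC a ha
    obtain ⟨t, ht⟩ := hwC d hd
    refine ⟨t, ?_⟩
    rw [← hc.2.2, ← mulVec_mulVec, mulVec_add, fodd b hb, add_zero, ← hd1, mulVec_mulVec, comC c hc d hd, ← mulVec_mulVec, cu, ht]
  choose φ hφ using hφ
  obtain ⟨a, ha⟩ : ∃ a, bil G a w ≠ 0 := by
    by_contra hcon
    push Not at hcon
    exact w0 (hG.nd_right hcon)
  have e1 : c = (φ a * (bil G a w)⁻¹) • RR G w w := by
    refine mat_ext fun y => ?_
    have h1 := JE.bil (h.le0 hc.1) a y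
    rw [hφ, hφ, bil_smul_left, bil_smul_right] at h1
    rw [hφ, smul_mulVec, RR_mulVec, smul_smul]
    congr 1
    field_simp
    linear_combination -h1
  have e2 : φ a * (bil G a w)⁻¹ ≠ 0 := by
    intro h0
    rw [h0, zero_smul] at e1
    rw [e1, zero_mulVec] at cu
    exact w0 cu.symm
  have := hc.1
  rw [e1] at this
  exact (Submodule.smul_mem_iff _ e2).1 this
end S
end SJ

open Matrix
namespace SJ
set_option linter.unusedSectionVars false
section S
variable {F : Type*} [Field F] [CharZero F] {ι : Type*} [Fintype ι] [DecidableEq ι]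
variable {σ G : Matrix ι ι F} {E O : Submodule F (Matrix ι ι F)} {u₁ u₂ : ι → F}

lemma r1_of_RR (h : SA σ G E O) (s1 : σ *ᵥ u₁ = -u₁) (s2 : σ *ᵥ u₂ = -u₂) (hω : bil G u₁ u₂ ≠ 0)
    {w : ι → F} (w0 : w ≠ 0) (sw : σ *ᵥ w = w) (h1 : RR G w u₁ - RR G u₁ w ∈ O) (h2 : RR G w u₂ - RR G u₂ w ∈ O) :
    ∃ w, w ≠ 0 ∧ σ *ᵥ w = w ∧ RR G w w ∈ E := by
  refine ⟨w, w0, sw, ?_⟩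
  have hG := h.og
  have q21 : bil G u₂ u₁ = - bil G u₁ u₂ := by rw [hG.swap, s2, bil_neg_right]
  have q11 : bil G u₁ u₁ = 0 := eq_zero_of_neg_self (by rw [← bil_neg_right, ← s1, ← hG.swap])
  have q22 : bil G u₂ u₂ = 0 := eq_zero_of_neg_self (by rw [← bil_neg_right, ← s2, ← hG.swap])
  have o1 := hG.orth sw s1
  have o2 := hG.orth sw s2
  have o1' := hG.orth' s1 sw
  have o2' := hG.orth' s2 sw
  have h3 := h.s.oo _ h1 _ h2
  obtain ⟨ω, hω'⟩ : ∃ ω, ω = bil G u₁ u₂ := ⟨_, rfl⟩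
  obtain ⟨q, hq⟩ : ∃ q, q = bil G w w := ⟨_, rfl⟩
  obtain ⟨z, hz⟩ : ∃ z, z = (2 * ω) • RR G w w + q • (RR G u₁ u₂ - RR G u₂ u₁) := ⟨_, rfl⟩
  have zE : z ∈ E := by
    convert neg_mem h3 using 1
    rw [hz]
    simp only [sub_mul, mul_sub, RR_mul_RR, q21, q11, q22, o1, o2, o1', o2', ← hω', ← hq]
    module
  rw [← hω'] at hω
  by_cases q0 : q = 0
  · rw [hz, q0, zero_smul, add_zero] at zE
    exact (Submodule.smul_mem_iff _ (mul_ne_zero two_ne_zero hω)).1 zE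
  · have h4 := add_mem (h.s.ee.sq zE) (E.smul_mem (q * ω) zE)
    have : z * z + (q * ω) • z = (6 * ω ^ 2 * q) • RR G w w := by
      rw [hz]
      simp only [sub_mul, mul_sub, add_mul, mul_add, smul_mul_assoc, mul_smul_comm, RR_mul_RR, q21, q11, q22, o1, o2, o1', o2', ← hω', ← hq]
      module
    rw [this] at h4
    refine (Submodule.smul_mem_iff _ ?_).1 h4
    simp [hω, q0]

theorem caseK' [IsAlgClosed F] (h : SA σ G E O) {v₁ v₂ w₀ : ι → F} (w0 : w₀ ≠ 0) (sw : σ *ᵥ w₀ = w₀)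
    (sv1 : σ *ᵥ v₁ = -v₁) (sv2 : σ *ᵥ v₂ = -v₂) (hv : bil G v₁ v₂ ≠ 0)
    (he : ∀ j ∈ JE σ G, ∃ b ∈ E, b *ᵥ v₁ = j *ᵥ v₁ ∧ b *ᵥ v₂ = j *ᵥ v₂)
    (ho : ∀ j ∈ JO σ G, ∃ b ∈ O, b *ᵥ v₁ = j *ᵥ v₁ ∧ b *ᵥ v₂ = j *ᵥ v₂) :
    ∃ w, w ≠ 0 ∧ σ *ᵥ w = w ∧ RR G w w ∈ E := by
  have hG := h.og
  have hs : St σ G E O v₁ v₂ := by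
    refine ⟨he, ho, ?_⟩
    obtain ⟨b, hb, e, _⟩ := he 1 one_JE
    exact ⟨b, hb, by rwa [e, one_mulVec]⟩
  obtain ⟨D, hD, hs', f, fE, ff, f0, hl, bu⟩ := normal h hs
  obtain ⟨u₁, hu1⟩ : ∃ u, u = D *ᵥ v₁ := ⟨_, rfl⟩
  obtain ⟨u₂, hu2⟩ : ∃ u, u = D *ᵥ v₂ := ⟨_, rfl⟩
  rw [← hu1, ← hu2] at hs' hl bu
  have s1 : σ *ᵥ u₁ = -u₁ := by rw [hu1, mulVec_mulVec, hD, ← mulVec_mulVec, sv1, mulVec_neg]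
  have s2 : σ *ᵥ u₂ = -u₂ := by rw [hu2, mulVec_mulVec, hD, ← mulVec_mulVec, sv2, mulVec_neg]
  clear hu1 hu2 hD hs he ho hv sv1 sv2
  obtain ⟨ω, hω⟩ : ∃ ω, ω = bil G u₁ u₂ := ⟨_, rfl⟩
  have ω0 : ω ≠ 0 := hω ▸ bu
  have fJ := h.le0 fE
  have alt : ∀ {b : ι → F}, σ *ᵥ b = -b → ∀ a, bil G b a = - bil G a b := fun {b} hb a => by
    rw [hG.swap, hb, bil_neg_right]
  have q21 : bil G u₂ u₁ = - ω := by rw [alt s2, hω]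
  have q11 : bil G u₁ u₁ = 0 := eq_zero_of_neg_self (alt s1 _)
  have q22 : bil G u₂ u₂ = 0 := eq_zero_of_neg_self (alt s2 _)
  -- f fixes both vectors
  have gj : ∀ j ∈ JE σ G, bil G (u₁ - f *ᵥ u₁) (j *ᵥ u₂) + bil G (j *ᵥ u₁) (u₂ - f *ᵥ u₂) = 0 := by
    intro j hj
    obtain ⟨c, hc, e1, e2⟩ := hs'.e j hj
    rw [← e1, ← e2]
    have h1 := hl _ (sub_mem (add_mem hc hc) (h.s.ee c hc f fE))
    have h2 : (f * (c + c - (c * f + f * c))).trace = 0 := by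
      have : f * (c + c - (c * f + f * c)) = f * c + f * c - f * c * f - f * f * c := by noncomm_ring
      rw [this, trace_sub, trace_sub, trace_add, trace_mul_comm (f * c) f, ← mul_assoc, ff]; ring
    have h3 : bil G ((c * f) *ᵥ u₁) u₂ = bil G (f *ᵥ u₁) (c *ᵥ u₂) := by
      rw [← mulVec_mulVec, JE.bil (h.le0 hc)]
    have h4 : bil G ((f * c) *ᵥ u₁) u₂ = bil G (c *ᵥ u₁) (f *ᵥ u₂) := by rw [← mulVec_mulVec, JE.bil fJ]
    rw [h2, sub_mulVec, add_mulVec, add_mulVec, bil_sub_left, bil_add_left, bil_add_left, h3, h4] at h1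
    rw [bil_sub_left, bil_sub_right, ← JE.bil (h.le0 hc)]
    linear_combination h1
  obtain ⟨α, hα⟩ : ∃ α, α = u₁ - f *ᵥ u₁ := ⟨_, rfl⟩
  obtain ⟨β, hβ⟩ : ∃ β, β = u₂ - f *ᵥ u₂ := ⟨_, rfl⟩
  have sα : σ *ᵥ α = -α := by rw [hα, mulVec_sub, JE.od fJ s1, s1]; abel
  have sβ : σ *ᵥ β = -β := by rw [hβ, mulVec_sub, JE.od fJ s2, s2]; abel
  rw [← hα, ← hβ] at gj
  have g1 := gj 1 one_JE
  rw [one_mulVec, one_mulVec] at g1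
  have g2 : bil G α u₂ = bil G u₁ β := by rw [hα, hβ, bil_sub_left, bil_sub_right, JE.bil fJ]
  have g3 : bil G α u₂ = 0 := by
    have : (2 : F) * bil G α u₂ = 0 := by linear_combination g1 + g2
    simpa using this
  have g4 : bil G α u₁ = 0 := by
    have h1 : bil G α u₁ = bil G u₁ α := by rw [hα, bil_sub_left, bil_sub_right, JE.bil fJ]
    exact eq_zero_of_neg_self (h1.trans (alt s1 _))
  have g5 : bil G u₂ β = 0 := by
    have h1 : bil G β u₂ = bil G u₂ β := by rw [hβ, bil_sub_left, bil_sub_right, JE.bil fJ]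
    exact eq_zero_of_neg_self (h1.symm.trans (alt sβ _))
  have g6 : bil G u₁ β = 0 := by rw [← g2, g3]
  have α0 : α = 0 := by
    refine hG.nd_od sα fun a ha => ?_
    have := gj _ (RR_JE_od hG ha s1)
    simp only [sub_mulVec, RR_mulVec, bil_sub_left, bil_sub_right, bil_smul_left, bil_smul_right, g3, g4, g5, g6, q11, ← hω] at this
    rw [alt ha]
    have h1 : ω * bil G α a = 0 := by linear_combination this
    simpa [ω0] using h1
  have β0 : β = 0 := by
    refine hG.nd_od sβ fun a ha => ?_
    have := gj _ (RR_JE_od hG ha s2)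
    simp only [sub_mulVec, RR_mulVec, bil_sub_left, bil_sub_right, bil_smul_left, bil_smul_right, g3, g4, g5, g6, q22, q21] at this
    have h1 : ω * bil G a β = 0 := by linear_combination -this
    simpa [ω0] using h1
  have f1 : f *ᵥ u₁ = u₁ := by rw [hα, sub_eq_zero] at α0; exact α0.symm
  have f2 : f *ᵥ u₂ = u₂ := by rw [hβ, sub_eq_zero] at β0; exact β0.symm
  clear α0 β0 g1 g2 g3 g4 g5 g6 sα sβ gj hα hβ
  have onto1 : ∀ a, σ *ᵥ a = a → ∃ x ∈ O, x *ᵥ u₁ = a ∧ x *ᵥ u₂ = 0 := by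
    intro a ha
    obtain ⟨x, hx, e1, e2⟩ := hs'.o _ (Submodule.smul_mem _ (-ω⁻¹) (RR_JO hG ha s2))
    refine ⟨x, hx, ?_, ?_⟩
    · rw [e1, smul_mulVec, sub_mulVec, RR_mulVec, RR_mulVec, q21, hG.orth ha s1, zero_smul, sub_zero, smul_smul]
      rw [neg_mul_neg, inv_mul_cancel₀ ω0, one_smul]
    · rw [e2, smul_mulVec, sub_mulVec, RR_mulVec, RR_mulVec, q22, hG.orth ha s2]; simp
  have onto2 : ∀ a, σ *ᵥ a = a → ∃ x ∈ O, x *ᵥ u₁ = 0 ∧ x *ᵥ u₂ = a := by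
    intro a ha
    obtain ⟨x, hx, e1, e2⟩ := hs'.o _ (Submodule.smul_mem _ (ω⁻¹) (RR_JO hG ha s1))
    refine ⟨x, hx, ?_, ?_⟩
    · rw [e1, smul_mulVec, sub_mulVec, RR_mulVec, RR_mulVec, q11, hG.orth ha s1]; simp
    · rw [e2, smul_mulVec, sub_mulVec, RR_mulVec, RR_mulVec, ← hω, hG.orth ha s2, zero_smul, sub_zero, smul_smul]
      rw [inv_mul_cancel₀ ω0, one_smul]
  have fev : ∀ b, σ *ᵥ b = b → f *ᵥ b = 0 := by
    intro b hb
    refine hG.nd_ev (JE.ev fJ hb) fun a ha => ?_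
    obtain ⟨x, hx, x1, x2⟩ := onto1 a ha
    obtain ⟨y, hy, y1, y2⟩ := onto2 b hb
    have h1 := hl _ (h.s.oo _ (h.s.uo fE hx) _ (h.s.uo fE hy))
    have h2 : (f * (f * x * f * (f * y * f) - f * y * f * (f * x * f))).trace = 0 := by
      have e1 : f * (f * x * f * (f * y * f)) = (f * x * f) * (f * y * f) := by simp only [← mul_assoc, ff]
      have e2 : f * (f * y * f * (f * x * f)) = (f * y * f) * (f * x * f) := by simp only [← mul_assoc, ff]
      rw [mul_sub, trace_sub, e1, e2, trace_mul_comm, sub_self]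
    have e1 : ∀ z : Matrix ι ι F, (f * z * f) *ᵥ u₁ = f *ᵥ z *ᵥ u₁ := fun z => by
      rw [← mulVec_mulVec, f1, ← mulVec_mulVec]
    have e2 : ∀ z : Matrix ι ι F, (f * z * f) *ᵥ u₂ = f *ᵥ z *ᵥ u₂ := fun z => by
      rw [← mulVec_mulVec, f2, ← mulVec_mulVec]
    rw [h2, sub_mulVec, ← mulVec_mulVec _ (f * x * f), ← mulVec_mulVec _ (f * y * f), e1, e1, y1, x1, mulVec_zero, mulVec_zero, zero_sub, bil_neg_left,
      JO.bil (h.le1 (h.s.uo fE hy)), s2, mulVec_neg, e2, y2, bil_neg_right, neg_neg, JE.bil fJ, mulVec_mulVec, ff] at h1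
    exact h1
  have fxf : ∀ x ∈ O, f * x * f = 0 := by
    intro x hx
    refine mat_ext fun v => ?_
    obtain ⟨a, b, ha, hb, rfl⟩ := hG.split v
    rw [← mulVec_mulVec, ← mulVec_mulVec, mulVec_add, fev a ha, zero_add, zero_mulVec]
    exact fev _ (JO.od (h.le1 hx) (JE.od fJ hb))
  have th : ∀ x ∈ O, ∀ y ∈ O, (f * (x * y - y * x)).trace = bil G (x *ᵥ u₁) (y *ᵥ u₂) - bil G (y *ᵥ u₁) (x *ᵥ u₂) := by
    intro x hx y hy
    rw [← hl _ (h.s.oo x hx y hy), sub_mulVec, bil_sub_left, ← mulVec_mulVec, ← mulVec_mulVec, JO.bil (h.le1 hx) (y *ᵥ u₁),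
      JO.bil (h.le1 hy) (x *ᵥ u₁), s2, mulVec_neg, mulVec_neg, bil_neg_right, bil_neg_right]
    ring
  have thd : ∀ d ∈ E, f * d = d → d * f = d → ∀ x ∈ O, ∀ y ∈ O, bil G (x *ᵥ d *ᵥ u₁) (y *ᵥ u₂) - bil G (y *ᵥ u₁) (x *ᵥ d *ᵥ u₂)
      = bil G (x *ᵥ u₁) (y *ᵥ d *ᵥ u₂) - bil G (y *ᵥ d *ᵥ u₁) (x *ᵥ u₂) := by
    intro d hd fd df x hx y hy
    have ev : ∀ x ∈ O, ∀ u, σ *ᵥ u = -u → (d * x + x * d) *ᵥ u = x *ᵥ d *ᵥ u := by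
      intro x hx u hu
      have : d *ᵥ x *ᵥ u = 0 := by rw [← df, ← mulVec_mulVec, fev _ (JO.od (h.le1 hx) hu), mulVec_zero]
      rw [add_mulVec, ← mulVec_mulVec, ← mulVec_mulVec, this, zero_add]
    have h1 := th _ (h.s.eo d hd x hx) y hy
    have h2 := th x hx _ (h.s.eo d hd y hy)
    rw [ev x hx _ s1, ev x hx _ s2] at h1
    rw [ev y hy _ s1, ev y hy _ s2] at h2
    rw [← h1, ← h2]
    have z1 : f * x * d = 0 := by rw [← fd, ← mul_assoc, fxf x hx, zero_mul]
    have z2 : f * y * d = 0 := by rw [← fd, ← mul_assoc, fxf y hy, zero_mul]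
    have e1 : f * ((d * x + x * d) * y - y * (d * x + x * d)) = (f * d) * x * y + (f * x * d) * y - (f * y * d) * x - f * y * x * d := by
      noncomm_ring
    have e2 : f * (x * (d * y + y * d) - (d * y + y * d) * x) = (f * x * d) * y + f * x * y * d - (f * d) * y * x - (f * y * d) * x := by
      noncomm_ring
    have t1 : (f * y * x * d).trace = (d * y * x).trace := by rw [trace_mul_comm]; simp only [← mul_assoc, df]
    have t2 : (f * x * y * d).trace = (d * x * y).trace := by rw [trace_mul_comm]; simp only [← mul_assoc, df]
    rw [e1, e2, z1, z2, fd]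
    simp only [trace_sub, trace_add, t1, t2, zero_mul, trace_zero]
    ring
  have kill : ∀ a, σ *ᵥ a = -a → f *ᵥ a = a → bil G a u₁ = 0 → bil G a u₂ = 0 → ∀ x ∈ O, x *ᵥ a = 0 := by
    intro a sa fa a1 a2
    have dd : ∀ j ∈ JE σ G, f *ᵥ j *ᵥ u₁ = j *ᵥ u₁ → f *ᵥ j *ᵥ u₂ = j *ᵥ u₂ → ∃ d ∈ E, f * d = d ∧ d * f = d ∧ d *ᵥ u₁ = j *ᵥ u₁ ∧ d *ᵥ u₂ = j *ᵥ u₂ := by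
      intro j hj j1 j2
      obtain ⟨c, hc, c1, c2⟩ := hs'.e j hj
      refine ⟨f * c * f, h.s.ee.u fE hc, by simp only [← mul_assoc, ff], by rw [mul_assoc, ff], ?_, ?_⟩
      · rw [← mulVec_mulVec, f1, ← mulVec_mulVec, c1, j1]
      · rw [← mulVec_mulVec, f2, ← mulVec_mulVec, c2, j2]
    have i1 : ∀ x ∈ O, ∀ y ∈ O, bil G (x *ᵥ u₁) (y *ᵥ a) = - bil G (y *ᵥ u₁) (x *ᵥ a) := by
      have e1 : (ω⁻¹ • (RR G a u₁ - RR G u₁ a)) *ᵥ u₁ = 0 := by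
        rw [smul_mulVec, sub_mulVec, RR_mulVec, RR_mulVec, q11, a1]; simp
      have e2 : (ω⁻¹ • (RR G a u₁ - RR G u₁ a)) *ᵥ u₂ = a := by
        rw [smul_mulVec, sub_mulVec, RR_mulVec, RR_mulVec, ← hω, a2, zero_smul, sub_zero, smul_smul, inv_mul_cancel₀ ω0, one_smul]
      obtain ⟨d, hd, fd, df, d1, d2⟩ := dd _ (Submodule.smul_mem _ (ω⁻¹) (RR_JE_od hG sa s1)) (by rw [e1, mulVec_zero]) (by rw [e2, fa])
      intro x hx y hy
      have := thd d hd fd df x hx y hy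
      rw [d1, d2, e1, e2, mulVec_zero, mulVec_zero, bil_zero_left, bil_zero_left] at this
      linear_combination -this
    have i2 : ∀ x ∈ O, ∀ y ∈ O, bil G (x *ᵥ a) (y *ᵥ u₂) = - bil G (y *ᵥ a) (x *ᵥ u₂) := by
      have e1 : (-ω⁻¹ • (RR G a u₂ - RR G u₂ a)) *ᵥ u₁ = a := by
        rw [smul_mulVec, sub_mulVec, RR_mulVec, RR_mulVec, q21, a1, zero_smul, sub_zero, smul_smul, neg_mul_neg, inv_mul_cancel₀ ω0, one_smul]
      have e2 : (-ω⁻¹ • (RR G a u₂ - RR G u₂ a)) *ᵥ u₂ = 0 := by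
        rw [smul_mulVec, sub_mulVec, RR_mulVec, RR_mulVec, q22, a2]; simp
      obtain ⟨d, hd, fd, df, d1, d2⟩ := dd _ (Submodule.smul_mem _ (-ω⁻¹) (RR_JE_od hG sa s2)) (by rw [e1, fa]) (by rw [e2, mulVec_zero])
      intro x hx y hy
      have := thd d hd fd df x hx y hy
      rw [d1, d2, e1, e2, mulVec_zero, mulVec_zero, bil_zero_right, bil_zero_right] at this
      linear_combination this
    have k1 : ∀ y ∈ O, y *ᵥ u₂ = 0 → y *ᵥ a = 0 := by
      intro y hy y2
      refine hG.nd_ev (JO.od (h.le1 hy) sa) fun e he => ?_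
      obtain ⟨x, hx, x1, x2⟩ := onto2 e he
      have := i2 x hx y hy
      rw [y2, bil_zero_right, x2, hG.swap, JO.od (h.le1 hy) sa] at this
      linear_combination this
    intro x hx
    refine hG.nd_ev (JO.od (h.le1 hx) sa) fun e he => ?_
    obtain ⟨y, hy, y1, y2⟩ := onto1 e he
    have := i1 x hx y hy
    rw [k1 y hy y2, bil_zero_right, y1] at this
    linear_combination this
  have form : ∀ x ∈ O, f * x + x * f = x → ∀ v, σ *ᵥ v = -v → ω • (x *ᵥ v) = bil G v u₂ • (x *ᵥ u₁) - bil G v u₁ • (x *ᵥ u₂) := by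
    intro x hx xf v hv
    have e1 : x *ᵥ v = x *ᵥ f *ᵥ v := by
      conv_lhs => rw [← xf]
      rw [add_mulVec, ← mulVec_mulVec, fev _ (JO.od (h.le1 hx) hv), zero_add, ← mulVec_mulVec]
    obtain ⟨a, ha⟩ : ∃ a, a = ω • (f *ᵥ v) - bil G v u₂ • u₁ + bil G v u₁ • u₂ := ⟨_, rfl⟩
    have := kill a (by rw [ha, mulVec_add, mulVec_sub, mulVec_smul, mulVec_smul, mulVec_smul, JE.od fJ hv, s1, s2]; module)
      (by rw [ha, mulVec_add, mulVec_sub, mulVec_smul, mulVec_smul, mulVec_smul, f1, f2, mulVec_mulVec, ff])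
      (by rw [ha, bil_add_left, bil_sub_left, bil_smul_left, bil_smul_left, bil_smul_left, q11, q21, JE.bil fJ, f1]; ring)
      (by rw [ha, bil_add_left, bil_sub_left, bil_smul_left, bil_smul_left, bil_smul_left, q22, ← hω, JE.bil fJ, f2]; ring) x hx
    rw [ha, mulVec_add, mulVec_sub, mulVec_smul, mulVec_smul, mulVec_smul, ← e1] at this
    rw [← sub_eq_zero, ← this]; abel
  have half : ∀ x ∈ O, ∃ y ∈ O, f * y + y * f = y ∧ y *ᵥ u₁ = x *ᵥ u₁ ∧ y *ᵥ u₂ = x *ᵥ u₂ := by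
    intro x hx
    refine ⟨f * x + x * f, h.s.eo f fE x hx, ?_, ?_, ?_⟩
    · simp only [mul_add, add_mul, ← mul_assoc, ff, fxf x hx]; rw [mul_assoc, ff]; abel
    · rw [add_mulVec, ← mulVec_mulVec, ← mulVec_mulVec, f1, fev _ (JO.od (h.le1 hx) s1), zero_add]
    · rw [add_mulVec, ← mulVec_mulVec, ← mulVec_mulVec, f2, fev _ (JO.od (h.le1 hx) s2), zero_add]
  refine r1_of_RR h s1 s2 bu w0 sw ?_ ?_
  · obtain ⟨x, hx, x1, x2⟩ := onto2 w₀ sw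
    obtain ⟨y, hy, yf, y1, y2⟩ := half x hx
    rw [x1] at y1
    rw [x2] at y2
    have : RR G w₀ u₁ - RR G u₁ w₀ - ω • y = 0 := by
      refine JO_eq_zero' hG (sub_mem (RR_JO hG sw s1) (Submodule.smul_mem _ _ (h.le1 hy))) fun v hv => ?_
      rw [sub_mulVec, sub_mulVec, smul_mulVec, form y hy yf v hv, y1, y2, RR_mulVec, RR_mulVec, hG.orth sw hv, alt s1]
      module
    rw [sub_eq_zero] at this
    rw [this]; exact O.smul_mem _ hy
  · obtain ⟨x, hx, x1, x2⟩ := onto1 w₀ sw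
    obtain ⟨y, hy, yf, y1, y2⟩ := half x hx
    rw [x1] at y1
    rw [x2] at y2
    have : RR G w₀ u₂ - RR G u₂ w₀ + ω • y = 0 := by
      refine JO_eq_zero' hG (add_mem (RR_JO hG sw s2) (Submodule.smul_mem _ _ (h.le1 hy))) fun v hv => ?_
      rw [add_mulVec, sub_mulVec, smul_mulVec, form y hy yf v hv, y1, y2, RR_mulVec, RR_mulVec, hG.orth sw hv, alt s2]
      module
    rw [eq_neg_of_add_eq_zero_left this]; exact neg_mem (O.smul_mem _ hy)
end S
end SJ

open Matrix
namespace SJ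
set_option linter.unusedSectionVars false
section S
variable {F : Type*} [Field F] [CharZero F] {ι : Type*} [Fintype ι] [DecidableEq ι]
variable {σ G : Matrix ι ι F} {E O E' O' : Submodule F (Matrix ι ι F)}

def Kl (E O : Submodule F (Matrix ι ι F)) (u : ι → F) : Prop := (∀ c ∈ E, c *ᵥ u = 0) ∧ ∀ x ∈ O, x *ᵥ u = 0

lemma Kl.onto {U U' W : Submodule F (Matrix ι ι F)} (hs : U ⊔ U' = W) {j : Matrix ι ι F} (hj : j ∈ W) :
    ∃ b ∈ U', ∀ u, (∀ c ∈ U, c *ᵥ u = 0) → b *ᵥ u = j *ᵥ u := by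
  rw [← hs] at hj
  obtain ⟨a, ha, b, hb, rfl⟩ := Submodule.mem_sup.1 hj
  exact ⟨b, hb, fun u hu => by rw [add_mulVec, hu a ha, zero_add]⟩

lemma Kl.orthE (h : SA σ G E O) (hs : E ⊔ E' = JE σ G) {u v : ι → F} (hu : Kl E O u) (hv : Kl E' O' v)
    {j : Matrix ι ι F} (hj : j ∈ JE σ G) : bil G u (j *ᵥ v) = 0 := by
  rw [← hs] at hj
  obtain ⟨a, ha, b, hb, rfl⟩ := Submodule.mem_sup.1 hj
  rw [add_mulVec, hv.1 b hb, add_zero, ← JE.bil (h.le0 ha), hu.1 a ha, bil_zero_left]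

lemma Kl.orthO (h : SA σ G E O) (hs : O ⊔ O' = JO σ G) {u v : ι → F} (hu : Kl E O u) (hv : Kl E' O' v)
    {j : Matrix ι ι F} (hj : j ∈ JO σ G) : bil G u (j *ᵥ v) = 0 := by
  rw [← hs] at hj
  obtain ⟨a, ha, b, hb, rfl⟩ := Submodule.mem_sup.1 hj
  have := JO.bil (h.le1 ha) u (σ *ᵥ v)
  rw [h.og.inv, hu.2 a ha, bil_zero_left] at this
  rw [add_mulVec, hv.2 b hb, add_zero, ← this]

lemma transfer [IsAlgClosed F] (h : SA σ G E O) (h' : SA σ G E' O')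
    (hs : E ⊔ E' = JE σ G) (ho : O ⊔ O' = JO σ G) (hne : ¬ (JE σ G ≤ E ∧ JO σ G ≤ O))
    (hr : ∃ w, w ≠ 0 ∧ σ *ᵥ w = w ∧ RR G w w ∈ E) : ∃ w, w ≠ 0 ∧ σ *ᵥ w = w ∧ RR G w w ∈ E' := by
  obtain ⟨w, w0, sw, hw⟩ := hr
  rcases rankOne h w0 sw hw hne with ⟨u, u0, su, k1, k2⟩ | ⟨u, v, su, sv, huv, k1, k2, k3, k4⟩
  · refine caseK h' u0 su (fun j hj => ?_) fun j hj => ?_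
    · obtain ⟨b, hb, e⟩ := Kl.onto hs hj
      exact ⟨b, hb, e u k1⟩
    · obtain ⟨b, hb, e⟩ := Kl.onto ho hj
      exact ⟨b, hb, e u k2⟩
  · refine caseK' h' w0 sw su sv huv (fun j hj => ?_) fun j hj => ?_
    · obtain ⟨b, hb, e⟩ := Kl.onto hs hj
      exact ⟨b, hb, e u k1, e v k3⟩
    · obtain ⟨b, hb, e⟩ := Kl.onto ho hj
      exact ⟨b, hb, e u k2, e v k4⟩

lemma noKl (h : SA σ G E O) (hs : E ⊔ E' = JE σ G) (ho : O ⊔ O' = JO σ G) {u : ι → F} (u0 : u ≠ 0) (su : σ *ᵥ u = u)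
    (hu : Kl E O u) (hB : (∃ v, v ≠ 0 ∧ σ *ᵥ v = v ∧ Kl E' O' v) ∨
      (∃ v v', σ *ᵥ v = -v ∧ σ *ᵥ v' = -v' ∧ bil G v v' ≠ 0 ∧ Kl E' O' v ∧ Kl E' O' v')) : False := by
  have hG := h.og
  refine u0 (hG.nd_ev su fun a ha => ?_)
  rw [hG.swap]
  rcases hB with ⟨v, v0, sv, kv⟩ | ⟨v, v', sv, sv', hvv, kv, kv'⟩
  · obtain ⟨j, hj, ja⟩ := J_ev_onto hG sv v0 a ha
    rw [ha, ← ja]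
    exact Kl.orthE h hs hu kv (J00_le hj)
  · have := Kl.orthO h ho hu kv' (RR_JO hG ha sv)
    rw [sub_mulVec, RR_mulVec, RR_mulVec, hG.orth ha sv', zero_smul, sub_zero, bil_smul_right] at this
    rw [ha]
    exact (mul_eq_zero.1 this).resolve_left hvv

theorem main_abs [IsAlgClosed F] (h : SA σ G E O) (h' : SA σ G E' O')
    {w0 : ι → F} (hw0 : w0 ≠ 0) (hw1 : σ *ᵥ w0 = w0) (hs : E ⊔ E' = JE σ G) (ho : O ⊔ O' = JO σ G)
    (hne : ¬ (JE σ G ≤ E ∧ JO σ G ≤ O)) (hne' : ¬ (JE σ G ≤ E' ∧ JO σ G ≤ O')) : False := by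
  have hG := h.og
  have hs' : E' ⊔ E = JE σ G := by rw [sup_comm, hs]
  have ho' : O' ⊔ O = JO σ G := by rw [sup_comm, ho]
  have R : ∃ w, w ≠ 0 ∧ σ *ᵥ w = w ∧ RR G w w ∈ E := by
    by_contra hc
    by_cases hc' : ∃ w, w ≠ 0 ∧ σ *ᵥ w = w ∧ RR G w w ∈ E'
    · exact hc (transfer h' h hs' ho' hne' hc')
    · push Not at hc hc'
      exact case1 h h' hw0 hw1 hc hc' hs ho
  obtain ⟨w', w0', sw', hw'⟩ := transfer h h' hs ho hne R
  obtain ⟨w, w0, sw, hw⟩ := R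
  have r' := rankOne h' w0' sw' hw' hne'
  have r := rankOne h w0 sw hw hne
  have c : ∀ {E O : Submodule F (Matrix ι ι F)}, ((∃ u, u ≠ 0 ∧ σ *ᵥ u = u ∧ (∀ c ∈ E, c *ᵥ u = 0) ∧ (∀ x ∈ O, x *ᵥ u = 0)) ∨
    (∃ u v, σ *ᵥ u = -u ∧ σ *ᵥ v = -v ∧ bil G u v ≠ 0 ∧ (∀ c ∈ E, c *ᵥ u = 0) ∧ (∀ x ∈ O, x *ᵥ u = 0) ∧
      (∀ c ∈ E, c *ᵥ v = 0) ∧ (∀ x ∈ O, x *ᵥ v = 0))) → (∃ v, v ≠ 0 ∧ σ *ᵥ v = v ∧ Kl E O v) ∨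
      (∃ v v', σ *ᵥ v = -v ∧ σ *ᵥ v' = -v' ∧ bil G v v' ≠ 0 ∧ Kl E O v ∧ Kl E O v') := by
    intro E O hh
    rcases hh with ⟨u, a, b, c, d⟩ | ⟨u, v, a, b, c, d, e, f, g⟩
    · exact Or.inl ⟨u, a, b, c, d⟩
    · exact Or.inr ⟨u, v, a, b, c, ⟨d, e⟩, ⟨f, g⟩⟩
  replace r := c r
  replace r' := c r'
  clear c
  rcases r with ⟨u, u0, su, ku⟩ | ⟨u, u', su, su', huu, ku, ku'⟩
  · exact noKl h hs ho u0 su ku r'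
  · rcases r' with ⟨v, v0, sv, kv⟩ | ⟨v, v', sv, sv', hvv, kv, kv'⟩
    · exact noKl h' hs' ho' v0 sv kv (Or.inr ⟨u, u', su, su', huu, ku, ku'⟩)
    · have u0 : u = 0 := by
        refine hG.nd_od su fun a ha => ?_
        have h1 := Kl.orthE h hs ku kv' (RR_JE_od hG ha sv)
        have h2 := Kl.orthE h hs ku kv one_JE
        rw [one_mulVec] at h2
        rw [sub_mulVec, RR_mulVec, RR_mulVec, bil_sub_right, bil_smul_right, bil_smul_right, h2, mul_zero, sub_zero] at h1
        rw [hG.swap, ha, bil_neg_right, (mul_eq_zero.1 h1).resolve_left hvv, neg_zero]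
      rw [u0, bil_zero_left] at huu
      exact huu rfl
end S

variable (F : Type*) [Field F]

theorem no_simple_decomposition_osp
    (F : Type*) [Field F] [IsAlgClosed F] [CharZero F]
    (n m : ℕ) (hn : 1 ≤ n) (hm : 1 ≤ m) :
    ¬ ∃ A B : Submodule F (MJ F n (2 * m)),
        A ≤ ospSub F n m ∧ B ≤ ospSub F n m ∧
        IsSubalg F A ∧ IsSubalg F B ∧
        A ≠ ospSub F n m ∧ B ≠ ospSub F n m ∧
        Nontriv F A ∧ Nontriv F B ∧
        IsSimple F A ∧ IsSimple F B ∧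
        A ⊔ B = ospSub F n m := by
  rintro ⟨A, B, hA, hB, sA, sB, nA, nB, tA, tB, iA, iB, hs⟩
  obtain ⟨h1, h2⟩ := sup_ev sA sB hs
  have key : ∀ {A : Submodule F (MJ F n (2 * m))}, A ≤ ospSub F n m → IsSubalg F A → Nontriv F A → IsSimple F A →
      SA (sg F n (2 * m)) (gM F n m) (A ⊓ evenSub F n (2 * m)) (A ⊓ oddSub F n (2 * m)) := fun hA sA tA iA =>
    ⟨og n m, fun x hx => (osp_ev x).2 ⟨hA hx.1, hx.2⟩, fun x hx => (osp_od x).2 ⟨hA hx.1, hx.2⟩, simp_of sA tA iA⟩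
  refine main_abs (key hA sA tA iA) (key hB sB tB iB) (w0 := Pi.single (Sum.inl ⟨0, hn⟩) 1) ?_ ?_ h1 h2 (ne_osp hA nA) (ne_osp hB nB)
  · intro h0
    have := congrFun h0 (Sum.inl ⟨0, hn⟩)
    simp at this
  · rw [sg_diag]
    ext i
    rw [mulVec_diagonal]
    by_cases hi : i = Sum.inl ⟨0, hn⟩
    · subst hi; simp [pty]
    · simp [hi]
end SJ
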